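/- arXiv:2205.09553 — 2 statements merged into one kernel-verified Lean document; each statement's English description precedes it below -/
import Mathlib

section
/- For any rank-2 oriented matroid M on [n], every interval of length 2 in the poset MacP(2,n)_{≤M} ∪ {0̂} has exactly four elements (the poset is thin). -/
/-- A rank-2 chirotope on `n` elements: a nonzero alternating sign function on pairs
satisfying the rank-2 Grassmann–Plücker relations.  A rank-2 oriented matroid is such a
chirotope up to global sign. -/
structure Chirotope2 (n : ℕ) : Type where
  χ : Fin n → Fin n → SignType
  nonzero : ∃ i j, χ i j ≠ 0
  alt : ∀ i j, χ i j = - χ j i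
  gp : ∀ x y0 y1 y2 : Fin n,
    (χ y0 x * χ y1 y2 = 0 ∧ χ y1 x * χ y0 y2 = 0 ∧ χ y2 x * χ y0 y1 = 0) ∨
    ((χ y0 x * χ y1 y2 = 1 ∨ -(χ y1 x * χ y0 y2) = 1 ∨ χ y2 x * χ y0 y1 = 1) ∧
     (χ y0 x * χ y1 y2 = -1 ∨ -(χ y1 x * χ y0 y2) = -1 ∨ χ y2 x * χ y0 y1 = -1))

/-- The weak map order on rank-2 oriented matroids: `N ≤ M` iff, for a suitable global sign,
every basis of `N` is a basis of `M` with matching orientation. -/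
def omLe {n : ℕ} (N M : Chirotope2 n) : Prop :=
  ∃ ε : SignType, (ε = 1 ∨ ε = -1) ∧ ∀ i j, N.χ i j = 0 ∨ N.χ i j = ε * M.χ i j

/-- Strict weak map order. -/
def omLt {n : ℕ} (N M : Chirotope2 n) : Prop := omLe N M ∧ ¬ omLe M N

/-- Two chirotopes determine the same oriented matroid. -/
def omEquiv {n : ℕ} (N M : Chirotope2 n) : Prop := omLe N M ∧ omLe M N

/-- `M` covers `N` in the weak map order: `N < M` and nothing lies strictly between. -/
def OMCovers {n : ℕ} (N M : Chirotope2 n) : Prop :=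
  omLt N M ∧ ∀ N' : Chirotope2 n, omLt N N' → ¬ omLt N' M

/-- `i` is a loop of `M`. -/
def IsLoop {n : ℕ} (M : Chirotope2 n) (i : Fin n) : Prop := ∀ k, M.χ i k = 0

/-- The parallel/anti-parallel class of `i` in `M`. -/
def ParClass {n : ℕ} (M : Chirotope2 n) (i : Fin n) : Set (Fin n) :=
  {j | (∀ k, M.χ j k = M.χ i k) ∨ (∀ k, M.χ j k = - M.χ i k)}

namespace MacThin

variable {n : ℕ}

def gpS (t1 t2 t3 : SignType) : Prop :=
  (t1 = 0 ∧ t2 = 0 ∧ t3 = 0) ∨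
    ((t1 = 1 ∨ -t2 = 1 ∨ t3 = 1) ∧ (t1 = -1 ∨ -t2 = -1 ∨ t3 = -1))

structure IsChi (q : Fin n → Fin n → SignType) : Prop where
  nonzero : ∃ i j, q i j ≠ 0
  alt : ∀ i j, q i j = - q j i
  gp : ∀ x y0 y1 y2 : Fin n,
    gpS (q y0 x * q y1 y2) (q y1 x * q y0 y2) (q y2 x * q y0 y1)

def Le (p q : Fin n → Fin n → SignType) : Prop := ∀ i j, p i j = 0 ∨ p i j = q i j

def NL (q : Fin n → Fin n → SignType) (a : Fin n) : Prop := ∃ k, q a k ≠ 0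

open Classical in
noncomputable def res (q : Fin n → Fin n → SignType) (S : Fin n → Prop) :
    Fin n → Fin n → SignType :=
  fun x y => if S x ∧ S y then q x y else 0

noncomputable def del (q : Fin n → Fin n → SignType) (a : Fin n) :
    Fin n → Fin n → SignType := res q (fun x => x ≠ a)

def inC (q : Fin n → Fin n → SignType) (a b x : Fin n) : Prop := q x a = 0 ∨ q x b = 0

open Classical in
noncomputable def mrg (q : Fin n → Fin n → SignType) (a b : Fin n) :
    Fin n → Fin n → SignType :=
  fun x y => if inC q a b x ∧ inC q a b y then 0 else q x y

def Adj (q : Fin n → Fin n → SignType) (a b : Fin n) : Prop :=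
  q a b ≠ 0 ∧ (∃ s : SignType, s ≠ 0 ∧ ∀ x, q a x ≠ 0 → q b x ≠ 0 → q a x = s * q b x) ∧
    ∃ x, q a x ≠ 0 ∧ q b x ≠ 0

theorem IsChi.self {q : Fin n → Fin n → SignType} (h : IsChi q) (a : Fin n) : q a a = 0 := by
  have := h.alt a a
  revert this; generalize q a a = t; revert t; decide

theorem IsChi.symm0 {q : Fin n → Fin n → SignType} (h : IsChi q) {a b : Fin n}
    (hz : q a b = 0) : q b a = 0 := by
  rw [h.alt, hz]; decide

theorem IsChi.symm1 {q : Fin n → Fin n → SignType} (h : IsChi q) {a b : Fin n}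
    (hz : q a b ≠ 0) : q b a ≠ 0 := fun h' => hz (h.symm0 h')

theorem IsChi.nl {q : Fin n → Fin n → SignType} (h : IsChi q) {a b : Fin n}
    (hz : q a b ≠ 0) : NL q a ∧ NL q b := ⟨⟨b, hz⟩, ⟨a, h.symm1 hz⟩⟩

theorem IsChi.cross {q : Fin n → Fin n → SignType} (h : IsChi q) {a b : Fin n}
    (hz : q a b = 0) (x y : Fin n) : q a x * q b y = q a y * q b x := by
  have := h.gp x a b y
  rw [hz, h.alt b x] at this
  rw [h.alt b x]
  revert this
  unfold gpS
  generalize q a x = t1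
  generalize q b y = t2
  generalize q x b = t3
  generalize q a y = t4
  generalize q y x = t5
  revert t1 t2 t3 t4 t5; decide

theorem IsChi.par {q : Fin n → Fin n → SignType} (h : IsChi q) {a b : Fin n}
    (hz : q a b = 0) (ha : NL q a) (hb : NL q b) :
    ∃ s : SignType, s ≠ 0 ∧ ∀ x, q b x = s * q a x := by
  obtain ⟨y, hy⟩ := ha
  obtain ⟨z, hzz⟩ := hb
  refine ⟨q a y * q b y, ?_, ?_⟩
  · have := h.cross hz y z
    revert this hy hzz
    generalize q a y = t1
    generalize q b y = t2
    generalize q a z = t3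
    generalize q b z = t4
    revert t1 t2 t3 t4; decide
  · intro x
    have := h.cross hz x y
    revert this hy
    generalize q a y = t1
    generalize q b y = t2
    generalize q a x = t3
    generalize q b x = t4
    revert t1 t2 t3 t4; decide

theorem IsChi.tr {q : Fin n → Fin n → SignType} (h : IsChi q) {a b c : Fin n}
    (hb : NL q b) (h1 : q a b = 0) (h2 : q b c = 0) : q a c = 0 := by
  obtain ⟨y, hy⟩ := hb
  have := h.cross h1 c y
  rw [h2] at this
  revert this hy
  generalize q b y = t1
  generalize q a y = t2
  generalize q a c = t3
  revert t1 t2 t3; decide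

theorem le_refl' (p : Fin n → Fin n → SignType) : Le p p := fun _ _ => Or.inr rfl

theorem le_trans' {p q r : Fin n → Fin n → SignType} (h1 : Le p q) (h2 : Le q r) : Le p r := by
  intro i j
  have := h1 i j
  have := h2 i j
  grind

theorem le_antisymm' {p q : Fin n → Fin n → SignType} (h1 : Le p q) (h2 : Le q p) : p = q := by
  funext i j
  have := h1 i j
  have := h2 i j
  grind

theorem res_chi {q : Fin n → Fin n → SignType} (h : IsChi q) (S : Fin n → Prop)
    {u v : Fin n} (hu : S u) (hv : S v) (huv : q u v ≠ 0) : IsChi (res q S) := by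
  refine ⟨⟨u, v, ?_⟩, ?_, ?_⟩
  · simp [res, hu, hv, huv]
  · intro i j
    unfold res
    by_cases h1 : S i <;> by_cases h2 : S j <;> simp [h1, h2]
    exact h.alt i j
  · intro x y0 y1 y2
    have := h.gp x y0 y1 y2
    unfold res
    by_cases h1 : S x <;> by_cases h2 : S y0 <;> by_cases h3 : S y1 <;> by_cases h4 : S y2 <;>
      simp [h1, h2, h3, h4, gpS] <;> simpa [gpS] using this

theorem inC_row {q : Fin n → Fin n → SignType} (h : IsChi q) {a b : Fin n} (hab : Adj q a b)
    {p : Fin n} (hp : inC q a b p) :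
    ∃ s : SignType, ∀ r, ¬ inC q a b r → q p r = s * q a r := by
  obtain ⟨h0, ⟨s, hs, hrow⟩, -⟩ := hab
  by_cases hl : NL q p
  · rcases hp with hp | hp
    · obtain ⟨t, -, ht⟩ := h.par (h.symm0 hp) (h.nl h0).1 hl
      exact ⟨t, fun r _ => ht r⟩
    · obtain ⟨t, -, ht⟩ := h.par (h.symm0 hp) (h.nl h0).2 hl
      refine ⟨t * s, fun r hr => ?_⟩
      rw [ht r]
      unfold inC at hr
      push Not at hr
      rw [hrow r (h.symm1 hr.1) (h.symm1 hr.2)]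
      have aux : ∀ s t t1 : SignType, s ≠ 0 → t * t1 = t * s * (s * t1) := by decide
      exact aux s t _ hs
  · refine ⟨0, fun r _ => ?_⟩
    unfold NL at hl
    push Not at hl
    rw [hl r]; simp

theorem mrg_chi {q : Fin n → Fin n → SignType} (h : IsChi q) {a b : Fin n} (hab : Adj q a b) :
    IsChi (mrg q a b) := by
  refine ⟨?_, ?_, ?_⟩
  · obtain ⟨x, h1, h2⟩ := hab.2.2
    refine ⟨a, x, ?_⟩
    have : ¬ inC q a b x := by
      rintro (h3 | h3)
      · exact h1 (h.symm0 h3)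
      · exact h2 (h.symm0 h3)
    simp [mrg, this, h1]
  · intro i j
    unfold mrg
    by_cases h1 : inC q a b i <;> by_cases h2 : inC q a b j <;> simp [h1, h2] <;> exact h.alt i j
  · have key : ∀ p, inC q a b p → ∃ s : SignType, ∀ r, ¬ inC q a b r → q p r = s * q a r ∧ 
        q r p = - (s * q a r) := by
      intro p hp
      obtain ⟨s, hs⟩ := inC_row h hab hp
      refine ⟨s, fun r hr => ⟨hs r hr, ?_⟩⟩
      rw [h.alt, hs r hr]
    have d1 : ∀ s t A B : SignType, gpS 0 (-(s*A) * (t*B)) (-(s * B) * (t*A)) := by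
      unfold gpS; decide
    have d2 : ∀ s t A B : SignType, gpS (-(s*A) * (t*B)) 0 (-(s * B) * -(t*A)) := by
      unfold gpS; decide
    have d3 : ∀ s t A B : SignType, gpS (-(s*A) * -(t*B)) (-(s * B) * -(t*A)) 0 := by
      unfold gpS; decide
    have d4 : ∀ s t A B : SignType, gpS ((s*A) * (t*B)) ((t * A) * (s*B)) 0 := by
      unfold gpS; decide
    have d5 : ∀ s t A B : SignType, gpS ((s*A) * -(t*B)) 0 ((t * A) * (s*B)) := by
      unfold gpS; decide
    have d6 : ∀ s t A B : SignType, gpS 0 ((s*A) * -(t*B)) ((t * A) * -(s*B)) := by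
      unfold gpS; decide
    intro x y0 y1 y2
    have hg := h.gp x y0 y1 y2
    unfold mrg
    by_cases h1 : inC q a b x <;> by_cases h2 : inC q a b y0 <;> by_cases h3 : inC q a b y1 <;>
      by_cases h4 : inC q a b y2 <;>
      simp only [h1, h2, h3, h4, and_true, and_false, true_and, and_self, if_true, if_false,
        zero_mul, mul_zero]
    all_goals first
      | exact Or.inl ⟨rfl, rfl, rfl⟩
      | exact hg
      | skip
    · obtain ⟨s, hs⟩ := key x h1; obtain ⟨t, ht⟩ := key y0 h2
      rw [(hs y1 h3).2, (hs y2 h4).2, (ht y1 h3).1, (ht y2 h4).1]; apply d1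
    · obtain ⟨s, hs⟩ := key x h1; obtain ⟨t, ht⟩ := key y1 h3
      rw [(hs y0 h2).2, (hs y2 h4).2, (ht y0 h2).2, (ht y2 h4).1]; apply d2
    · obtain ⟨s, hs⟩ := key x h1; obtain ⟨t, ht⟩ := key y2 h4
      rw [(hs y0 h2).2, (hs y1 h3).2, (ht y0 h2).2, (ht y1 h3).2]; apply d3
    · obtain ⟨s, hs⟩ := key y0 h2; obtain ⟨t, ht⟩ := key y1 h3
      rw [(hs x h1).1, (hs y2 h4).1, (ht x h1).1, (ht y2 h4).1]; apply d4
    · obtain ⟨s, hs⟩ := key y0 h2; obtain ⟨t, ht⟩ := key y2 h4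
      rw [(hs x h1).1, (hs y1 h3).1, (ht x h1).1, (ht y1 h3).2]; apply d5
    · obtain ⟨s, hs⟩ := key y1 h3; obtain ⟨t, ht⟩ := key y2 h4
      rw [(hs x h1).1, (hs y0 h2).2, (ht x h1).1, (ht y0 h2).2]; apply d6


theorem extreme {q : Fin n → Fin n → SignType} (h : IsChi q) {a : Fin n} (ha : NL q a)
    {e : SignType} (he : e ≠ 0) :
    ∃ c, q a c ≠ 0 ∧ ∀ d, q a d ≠ 0 → q c d ≠ 0 → q a d = (e * q a c) * q c d := by
  let R : Fin n → Fin n → Prop := fun d c => q a d ≠ 0 ∧ q a c ≠ 0 ∧ q a d * q a c * q d c = e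
  have hirr : Std.Irrefl R := ⟨by
    rintro d ⟨-, -, h3⟩
    rw [h.self d] at h3
    apply he; rw [← h3]; simp⟩
  have htr : IsTrans (Fin n) R := ⟨by
    rintro d c f ⟨h1, h2, h3⟩ ⟨-, h5, h6⟩
    refine ⟨h1, h5, ?_⟩
    have hg := h.gp a d c f
    rw [h.alt d a, h.alt c a, h.alt f a] at hg
    unfold gpS at hg
    revert hg h1 h2 h3 h5 h6 he
    generalize q a d = t1
    generalize q a c = t2
    generalize q a f = t3
    generalize q d c = t4
    generalize q c f = t5
    generalize q d f = t6
    clear hirr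
    clear * -
    revert e t1 t2 t3 t4 t5 t6
    decide⟩
  have wf : WellFounded R := Finite.wellFounded_of_trans_of_irrefl R
  obtain ⟨c, hc, hmin⟩ := wf.has_min {c | q a c ≠ 0} ha
  refine ⟨c, hc, fun d hd hcd => ?_⟩
  have h1 : ¬ R d c := hmin d hd
  have h2 : q a d * q a c * q d c ≠ e := fun h' => h1 ⟨hd, hc, h'⟩
  rw [h.alt d c] at h2
  have hc' : q a c ≠ 0 := hc
  have aux : ∀ e t1 t2 t3 : SignType, (e ≠ 0 ∧ t1 ≠ 0 ∧ t2 ≠ 0 ∧ t3 ≠ 0 ∧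
      t1 * t2 * -t3 ≠ e) → t1 = e * t2 * t3 := by decide
  exact aux _ _ _ _ ⟨he, hd, hc', hcd, h2⟩

def DelOK (q : Fin n → Fin n → SignType) (a : Fin n) : Prop :=
  NL q a ∧ ∃ a', a' ≠ a ∧ NL q a' ∧ q a a' = 0

def Step (q r : Fin n → Fin n → SignType) : Prop :=
  (∃ a, DelOK q a ∧ r = del q a) ∨ ∃ a b, Adj q a b ∧ r = mrg q a b

theorem del_ne {q : Fin n → Fin n → SignType} {a x y : Fin n} (hx : x ≠ a) (hy : y ≠ a) :
    del q a x y = q x y := by simp [del, res, hx, hy]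

theorem del_l (q : Fin n → Fin n → SignType) (a y : Fin n) : del q a a y = 0 := by
  simp [del, res]

theorem del_r (q : Fin n → Fin n → SignType) (a y : Fin n) : del q a y a = 0 := by
  simp [del, res]

theorem nl_del {q : Fin n → Fin n → SignType} (h : IsChi q) {a x : Fin n} (hd : DelOK q a)
    (hx : x ≠ a) (hl : NL q x) : NL (del q a) x := by
  obtain ⟨ha, a', hne, ha', h0⟩ := hd
  obtain ⟨y, hy⟩ := hl
  by_cases hya : y = a
  · subst hya
    refine ⟨a', ?_⟩
    rw [del_ne hx hne]
    intro h'
    exact hy (h.tr ha' h' (h.symm0 h0))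
  · exact ⟨y, by rwa [del_ne hx hya]⟩

theorem del_chi {q : Fin n → Fin n → SignType} (h : IsChi q) {a : Fin n} (hd : DelOK q a) :
    IsChi (del q a) := by
  obtain ⟨a', hne, ha', h0⟩ := hd.2
  obtain ⟨y, hy⟩ := nl_del h hd hne ha'
  have hya : y ≠ a := by rintro rfl; exact hy (del_r _ _ _)
  rw [del_ne hne hya] at hy
  exact res_chi h _ hne hya hy

theorem nl_le {p q : Fin n → Fin n → SignType} (h : Le p q) {a : Fin n} (hl : NL p a) :
    NL q a := by
  obtain ⟨k, hk⟩ := hl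
  refine ⟨k, ?_⟩
  have := h a k
  grind

theorem ne_le {p q : Fin n → Fin n → SignType} (h : Le p q) {a b : Fin n} (hl : p a b ≠ 0) :
    q a b ≠ 0 := by
  have := h a b
  grind

theorem eq_le {p q : Fin n → Fin n → SignType} (h : Le p q) {a b : Fin n} (hl : p a b ≠ 0) :
    p a b = q a b := by
  have := h a b
  grind

theorem z_le {p q : Fin n → Fin n → SignType} (h : Le p q) {a b : Fin n} (hl : q a b = 0) :
    p a b = 0 := by
  have := h a b
  grind

theorem del_le (q : Fin n → Fin n → SignType) (a : Fin n) : Le (del q a) q := by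
  intro x y
  unfold del res
  split_ifs <;> simp

theorem mrg_le (q : Fin n → Fin n → SignType) (a b : Fin n) : Le (mrg q a b) q := by
  intro x y
  unfold mrg
  split_ifs <;> simp

theorem mrg_out {q : Fin n → Fin n → SignType} {a b x : Fin n} (hx : ¬ inC q a b x) (y : Fin n) :
    mrg q a b x y = q x y := by simp [mrg, hx]

theorem mrg_out' {q : Fin n → Fin n → SignType} {a b x : Fin n} (hx : ¬ inC q a b x) (y : Fin n) :
    mrg q a b y x = q y x := by simp [mrg, hx]

theorem mrg_in {q : Fin n → Fin n → SignType} {a b x y : Fin n} (hx : inC q a b x)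
    (hy : inC q a b y) : mrg q a b x y = 0 := by simp [mrg, hx, hy]

theorem inC_l {q : Fin n → Fin n → SignType} (h : IsChi q) (a b : Fin n) : inC q a b a :=
  Or.inl (h.self a)

theorem inC_r {q : Fin n → Fin n → SignType} (h : IsChi q) (a b : Fin n) : inC q a b b :=
  Or.inr (h.self b)

theorem Adj.third {q : Fin n → Fin n → SignType} (h : IsChi q) {a b : Fin n} (hab : Adj q a b) :
    ∃ x, q a x ≠ 0 ∧ q b x ≠ 0 ∧ ¬ inC q a b x := by
  obtain ⟨x, h1, h2⟩ := hab.2.2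
  refine ⟨x, h1, h2, ?_⟩
  rintro (h3 | h3)
  · exact h1 (h.symm0 h3)
  · exact h2 (h.symm0 h3)

theorem nl_mrg {q : Fin n → Fin n → SignType} (h : IsChi q) {a b x : Fin n} (hab : Adj q a b)
    (hl : NL q x) : NL (mrg q a b) x := by
  by_cases hx : inC q a b x
  · obtain ⟨y, h1, h2, h3⟩ := hab.third h
    refine ⟨y, ?_⟩
    rw [mrg_out' h3]
    intro h0
    rcases hx with hx | hx
    · exact h1 (h.tr hl (h.symm0 hx) h0)
    · exact h2 (h.tr hl (h.symm0 hx) h0)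
  · obtain ⟨y, hy⟩ := hl
    exact ⟨y, by rwa [mrg_out hx]⟩

theorem Adj.symm {q : Fin n → Fin n → SignType} (h : IsChi q) {a b : Fin n} (hab : Adj q a b) :
    Adj q b a := by
  obtain ⟨h1, ⟨s, hs, h2⟩, x, h3, h4⟩ := hab
  refine ⟨h.symm1 h1, ⟨s, hs, ?_⟩, x, h4, h3⟩
  intro y hy1 hy2
  rw [h2 y hy2 hy1]
  have aux : ∀ s t : SignType, s ≠ 0 → t = s * (s * t) := by decide
  exact aux _ _ hs

theorem mrg_symm (q : Fin n → Fin n → SignType) (a b : Fin n) : mrg q a b = mrg q b a := by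
  have : inC q a b = inC q b a := by
    funext x
    exact propext or_comm
  unfold mrg
  rw [this]

/-- Zero pattern of parallel elements agree. -/
theorem IsChi.z_iff {q : Fin n → Fin n → SignType} (h : IsChi q) {a b : Fin n} (ha : NL q a)
    (hb : NL q b) (hz : q a b = 0) (x : Fin n) : q x a = 0 ↔ q x b = 0 :=
  ⟨fun h' => h.tr ha h' hz, fun h' => h.tr hb h' (h.symm0 hz)⟩

theorem mrg_congr {q : Fin n → Fin n → SignType} (h : IsChi q) {a a' b : Fin n} (ha : NL q a)
    (ha' : NL q a') (hz : q a a' = 0) : mrg q a b = mrg q a' b := by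
  have : inC q a b = inC q a' b := by
    funext x
    unfold inC
    rw [h.z_iff ha ha' hz]
  unfold mrg
  rw [this]

theorem Adj.congr {q : Fin n → Fin n → SignType} (h : IsChi q) {a a' b : Fin n}
    (hab : Adj q a b) (ha' : NL q a') (hz : q a a' = 0) : Adj q a' b := by
  obtain ⟨h1, ⟨s, hs, h2⟩, x, h3, h4⟩ := hab
  have ha : NL q a := ⟨b, h1⟩
  obtain ⟨t, ht, hr⟩ := h.par hz ha ha'
  have aux : ∀ s t : SignType, s ≠ 0 → (t * s ≠ 0 ↔ t ≠ 0) := by decide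
  have aux2 : ∀ s t : SignType, s ≠ 0 → (s * t ≠ 0 ↔ t ≠ 0) := by decide
  refine ⟨?_, ⟨t * s, (aux _ _ hs).2 ht, ?_⟩, x, ?_, h4⟩
  · rw [hr]; exact (aux2 _ _ ht).2 h1
  · intro y hy1 hy2
    rw [hr] at hy1 ⊢
    rw [h2 y ((aux2 _ _ ht).1 hy1) hy2, mul_assoc]
  · rw [hr]; exact (aux2 _ _ ht).2 h3

theorem le_del {p q : Fin n → Fin n → SignType} (hp : IsChi p) (h : Le p q) {a : Fin n}
    (ha : ¬ NL p a) : Le p (del q a) := by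
  unfold NL at ha
  push Not at ha
  intro x y
  by_cases hx : x = a
  · subst hx; exact Or.inl (ha y)
  by_cases hy : y = a
  · subst hy; exact Or.inl (hp.symm0 (ha x))
  rw [del_ne hx hy]
  exact h x y

theorem le_mrg {p q : Fin n → Fin n → SignType} (hp : IsChi p) (h : Le p q) {a b : Fin n}
    (hz : ∀ x y, q x a = 0 → q y b = 0 → p x y = 0)
    (hq : IsChi q) (ha : NL q a) (hb : NL q b) : Le p (mrg q a b) := by
  intro x y
  by_cases hxy : inC q a b x ∧ inC q a b y
  · left
    rcases hxy with ⟨h1 | h1, h2 | h2⟩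
    · exact z_le h (hq.tr ha h1 (hq.symm0 h2))
    · exact hz x y h1 h2
    · exact hp.symm0 (hz y x h2 h1)
    · exact z_le h (hq.tr hb h1 (hq.symm0 h2))
  · simp only [mrg, hxy, if_false]
    exact h x y

/-- Any proper weak map image factors through an elementary step. -/
theorem exists_step {p q : Fin n → Fin n → SignType} (hp : IsChi p) (hq : IsChi q)
    (h : Le p q) (hne : p ≠ q) : ∃ r, Step q r ∧ Le p r := by
  by_cases hd : ∃ a, DelOK q a ∧ ¬ NL p a
  · obtain ⟨a, h1, h2⟩ := hd
    exact ⟨_, Or.inl ⟨a, h1, rfl⟩, le_del hp h h2⟩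
  by_cases hs : ∃ a, NL q a ∧ ¬ NL p a
  · obtain ⟨a, h1, h2⟩ := hs
    have hsing : ∀ x, x ≠ a → NL q x → q a x ≠ 0 := by
      intro x hx hxl h0
      exact hd ⟨a, ⟨h1, x, hx, hxl, h0⟩, h2⟩
    obtain ⟨c, hc, hcr⟩ := extreme hq h1 (e := 1) (by decide)
    have hadj : Adj q a c := by
      refine ⟨hc, ⟨_, ?_, hcr⟩, ?_⟩
      · simpa using hc
      · obtain ⟨x, y, hxy⟩ := hp.nonzero
        have hxa : x ≠ a := by rintro rfl; exact h2 (hp.nl hxy).1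
        have hya : y ≠ a := by rintro rfl; exact h2 (hp.nl hxy).2
        have hxy' := ne_le h hxy
        have hax := hsing x hxa (hq.nl hxy').1
        have hay := hsing y hya (hq.nl hxy').2
        by_cases hcx : q c x = 0
        · refine ⟨y, hay, fun hcy => ?_⟩
          exact hxy' (hq.tr (hq.nl hc).2 (hq.symm0 hcx) hcy)
        · exact ⟨x, hax, hcx⟩
    refine ⟨_, Or.inr ⟨a, c, hadj, rfl⟩, le_mrg hp h ?_ hq h1 (hq.nl hc).2⟩
    intro x y hx hy
    by_cases hxl : NL q x
    · have : x = a := by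
        by_contra hxa
        exact hsing x hxa hxl (hq.symm0 hx)
      subst this
      by_contra h0
      exact h2 ⟨y, h0⟩
    · by_contra h0
      exact hxl (nl_le h ⟨y, h0⟩)
  · have hnl : ∀ a, NL q a → NL p a := by
      intro a ha
      by_contra h0
      exact hs ⟨a, ha, h0⟩
    have : ∃ b c, q b c ≠ 0 ∧ p b c = 0 := by
      by_contra h0
      push Not at h0
      apply hne
      funext i j
      by_cases hij : q i j = 0
      · rw [hij]; exact z_le h hij
      · exact eq_le h (h0 i j hij)
    obtain ⟨b, c, hbc, hpbc⟩ := this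
    have hb := (hq.nl hbc).1
    have hc := (hq.nl hbc).2
    obtain ⟨s, hs0, hsr⟩ := hp.par hpbc (hnl b hb) (hnl c hc)
    obtain ⟨d, hbd, hdr⟩ := extreme hq hb (e := s * q b c) (by
      revert hs0 hbc
      generalize q b c = t
      clear * -
      revert s t
      decide)
    have hd := (hq.nl hbd).2
    have hpbd : p b d = 0 := by
      by_contra h0
      have h1 := hsr d
      have hpcd : p c d ≠ 0 := by
        rw [h1]
        revert hs0 h0
        generalize p b d = t
        clear * -
        revert s t
        decide
      have h2 := hdr c hbc (hq.symm1 (ne_le h hpcd))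
      rw [eq_le h h0, eq_le h hpcd, hq.alt c d] at h1
      revert h1 h2 hs0 hbc hbd
      generalize q b d = t1
      generalize q b c = t2
      generalize q d c = t3
      clear * -
      revert s t1 t2 t3
      decide
    have hadj : Adj q b d := by
      refine ⟨hbd, ⟨_, ?_, hdr⟩, ?_⟩
      · revert hs0 hbc hbd
        generalize q b c = t
        generalize q b d = t'
        clear * -
        revert s t t'
        decide
      · obtain ⟨x, hx⟩ := hnl b hb
        refine ⟨x, ne_le h hx, ?_⟩
        apply ne_le h (a := d)
        intro h0
        exact hx (hp.tr (hnl d hd) hpbd h0)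
    refine ⟨_, Or.inr ⟨b, d, hadj, rfl⟩, le_mrg hp h ?_ hq hb hd⟩
    intro x y hx hy
    by_contra h0
    have hb' := hnl b hb
    have hd' := hnl d hd
    have h1 := hp.tr hb' (z_le h hx) hpbd
    exact h0 (hp.tr hd' h1 (hp.symm0 (z_le h hy)))

theorem step_chi {q r : Fin n → Fin n → SignType} (h : IsChi q) (hs : Step q r) : IsChi r := by
  rcases hs with ⟨a, h1, rfl⟩ | ⟨a, b, h1, rfl⟩
  · exact del_chi h h1
  · exact mrg_chi h h1

theorem step_le {q r : Fin n → Fin n → SignType} (hs : Step q r) : Le r q := by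
  rcases hs with ⟨a, h1, rfl⟩ | ⟨a, b, h1, rfl⟩
  · exact del_le _ _
  · exact mrg_le _ _ _

theorem step_ne {q r : Fin n → Fin n → SignType} (h : IsChi q) (hs : Step q r) : r ≠ q := by
  rcases hs with ⟨a, h1, rfl⟩ | ⟨a, b, h1, rfl⟩
  · intro h0
    obtain ⟨y, hy⟩ := h1.1
    apply hy
    rw [← h0]
    exact del_l _ _ _
  · intro h0
    apply h1.1
    rw [← h0]
    exact mrg_in (inC_l h _ _) (inC_r h _ _)

/-- Elementary steps are covers. -/
theorem step_cover {q r z : Fin n → Fin n → SignType} (h : IsChi q) (hs : Step q r)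
    (hz : IsChi z) (h1 : Le r z) (h2 : Le z q) : z = r ∨ z = q := by
  rcases hs with ⟨a, hd, rfl⟩ | ⟨a, b, hab, rfl⟩
  · by_cases hza : NL z a
    · right
      obtain ⟨-, a', hne, ha', h0⟩ := id hd
      have hza' : NL z a' := nl_le h1 (nl_del h hd hne ha')
      have key : ∀ y, q a y ≠ 0 → z a y ≠ 0 := by
        intro y hy hz0
        have hya : y ≠ a := by rintro rfl; exact hy (h.self _)
        have h3 : z a' y = 0 := hz.tr hza (z_le h2 (h.symm0 h0)) hz0
        have h4 := z_le h1 h3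
        rw [del_ne hne hya] at h4
        exact hy (h.tr ha' h0 h4)
      apply le_antisymm' h2
      intro x y
      by_cases hxy0 : q x y = 0
      · exact Or.inl hxy0
      right
      refine (eq_le h2 ?_).symm
      by_cases hx : x = a
      · subst hx; exact key y hxy0
      by_cases hy : y = a
      · subst hy; exact hz.symm1 (key x (h.symm1 hxy0))
      apply ne_le h1
      rwa [del_ne hx hy]
    · left
      exact le_antisymm' (le_del hz h2 hza) h1
  · have ha := (h.nl hab.1).1
    have hb := (h.nl hab.1).2
    have hzl : ∀ x, NL q x → NL z x := fun x hx => nl_le h1 (nl_mrg h hab hx)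
    by_cases hzab : z a b = 0
    · left
      refine le_antisymm' (le_mrg hz h2 ?_ h ha hb) h1
      intro x y hx hy
      exact hz.tr (hzl b hb) (hz.tr (hzl a ha) (z_le h2 hx) hzab) (hz.symm0 (z_le h2 hy))
    · right
      have key : ∀ x y, q x y ≠ 0 → q x a = 0 → q y b = 0 → z x y ≠ 0 := by
        intro x y hxy hx hy h0
        have hxl := hzl x (h.nl hxy).1
        have hyl := hzl y (h.nl hxy).2
        exact hzab (hz.tr hyl (hz.tr hxl (hz.symm0 (z_le h2 hx)) h0) (z_le h2 hy))
      apply le_antisymm' h2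
      intro x y
      by_cases h0 : q x y = 0
      · exact Or.inl h0
      right
      refine (eq_le h2 ?_).symm
      by_cases hxy : inC q a b x ∧ inC q a b y
      · rcases hxy with ⟨h3 | h3, h4 | h4⟩
        · exact absurd (h.tr ha h3 (h.symm0 h4)) h0
        · exact key x y h0 h3 h4
        · exact hz.symm1 (key y x (h.symm1 h0) h4 h3)
        · exact absurd (h.tr hb h3 (h.symm0 h4)) h0
      · apply ne_le h1
        simpa only [mrg, hxy, if_false]


def Dia (q r r' p : Fin n → Fin n → SignType) : Prop :=
  Step q r ∧ Step q r' ∧ Step r p ∧ Step r' p ∧ r ≠ r' ∧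
    ∀ z, Step q z → Le p z → z = r ∨ z = r'

theorem Dia.symm {q r r' p : Fin n → Fin n → SignType} (h : Dia q r r' p) : Dia q r' r p := by
  obtain ⟨h1, h2, h3, h4, h5, h6⟩ := h
  exact ⟨h2, h1, h4, h3, h5.symm, fun z hz hp => (h6 z hz hp).symm⟩

theorem mrg_eq {q : Fin n → Fin n → SignType} (h : IsChi q) {b c e f : Fin n}
    (hbc : q b c ≠ 0) (hef : q e f ≠ 0) (he : inC q b c e) (hf : inC q b c f) :
    mrg q e f = mrg q b c := by
  have hb := (h.nl hbc).1
  have hc := (h.nl hbc).2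
  have hel := (h.nl hef).1
  have hfl := (h.nl hef).2
  rcases he with he | he <;> rcases hf with hf | hf
  · exact absurd (h.tr hb he (h.symm0 hf)) hef
  · rw [mrg_congr h hel hb he, mrg_symm, mrg_congr h hfl hc hf, mrg_symm]
  · rw [mrg_congr h hel hc he, mrg_symm, mrg_congr h hfl hb hf]
  · exact absurd (h.tr hc he (h.symm0 hf)) hef

theorem del_rep {q : Fin n → Fin n → SignType} (h : IsChi q) {a : Fin n} (hd : DelOK q a)
    {c : Fin n} (hc : NL q c) : ∃ c0, c0 ≠ a ∧ NL q c0 ∧ q c c0 = 0 := by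
  by_cases hca : c = a
  · subst hca; exact hd.2
  · exact ⟨c, hca, hc, h.self c⟩

theorem not_nl_del (q : Fin n → Fin n → SignType) (a : Fin n) : ¬ NL (del q a) a := by
  rintro ⟨y, hy⟩
  exact hy (del_l _ _ _)

theorem del_comm (q : Fin n → Fin n → SignType) (a b : Fin n) :
    del (del q a) b = del (del q b) a := by
  funext x y
  unfold del res
  grind

theorem ne_par {q : Fin n → Fin n → SignType} (h : IsChi q) {e f e0 f0 : Fin n}
    (hef : q e f ≠ 0) (he0 : NL q e0) (hf0 : NL q f0) (he : q e e0 = 0) (hf : q f f0 = 0) :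
    q e0 f0 ≠ 0 := by
  intro h0
  exact hef (h.tr hf0 (h.tr he0 he h0) (h.symm0 hf))

theorem dia_dd {q : Fin n → Fin n → SignType} (h : IsChi q) {a b : Fin n} (ha : DelOK q a)
    (hb : DelOK (del q a) b) : Dia q (del q a) (del q b) (del (del q a) b) := by
  have hr := del_chi h ha
  have hba : b ≠ a := by rintro rfl; exact not_nl_del _ _ hb.1
  obtain ⟨hbl, b', hne, hbl', h0⟩ := id hb
  have hba' : b' ≠ a := by rintro rfl; exact not_nl_del _ _ hbl'
  have hqb : NL q b := nl_le (del_le _ _) hbl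
  have hqb' : NL q b' := nl_le (del_le _ _) hbl'
  rw [del_ne hba hba'] at h0
  have hb2 : DelOK q b := ⟨hqb, b', hne, hqb', h0⟩
  have hr' := del_chi h hb2
  have hal : NL (del q b) a := nl_del h hb2 hba.symm ha.1
  have ha2 : DelOK (del q b) a := by
    refine ⟨hal, ?_⟩
    obtain ⟨-, a', hne', hal', h1⟩ := id ha
    by_cases hab : a' = b
    · subst hab
      refine ⟨b', hba', nl_del h hb2 hne hqb', ?_⟩
      rw [del_ne hba.symm hne]
      exact h.tr hqb h1 h0
    · refine ⟨a', hne', nl_del h hb2 hab hal', ?_⟩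
      rw [del_ne hba.symm hab]
      exact h1
  refine ⟨Or.inl ⟨a, ha, rfl⟩, Or.inl ⟨b, hb2, rfl⟩, Or.inl ⟨b, hb, rfl⟩,
    Or.inl ⟨a, ha2, del_comm _ _ _⟩, ?_, ?_⟩
  · intro heq
    rw [← heq] at hal
    exact not_nl_del _ _ hal
  · rintro z (⟨c, hc, rfl⟩ | ⟨c, d, hcd, rfl⟩) hle
    · by_cases hca : c = a
      · left; rw [hca]
      by_cases hcb : c = b
      · right; rw [hcb]
      exfalso
      exact not_nl_del q c (nl_le hle (nl_del hr hb hcb (nl_del h ha hca hc.1)))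
    · exfalso
      have rep : ∀ c, NL q c → ∃ c0, c0 ≠ a ∧ c0 ≠ b ∧ NL q c0 ∧ q c c0 = 0 := by
        intro c hc
        obtain ⟨c1, h1, h2, h3⟩ := del_rep h ha hc
        by_cases hcb : c1 = b
        · subst hcb
          exact ⟨b', hba', hne, hqb', h.tr hqb h3 h0⟩
        · exact ⟨c1, h1, hcb, h2, h3⟩
      obtain ⟨c0, h1, h2, h3, h4⟩ := rep c (h.nl hcd.1).1
      obtain ⟨d0, k1, k2, k3, k4⟩ := rep d (h.nl hcd.1).2
      have hz := z_le hle (mrg_in (q := q) (a := c) (b := d) (x := c0) (y := d0)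
        (Or.inl (h.symm0 h4)) (Or.inr (h.symm0 k4)))
      rw [del_ne h2 k2, del_ne h1 k1] at hz
      exact ne_par h hcd.1 h3 k3 h4 k4 hz

theorem dia_dm {q : Fin n → Fin n → SignType} (h : IsChi q) {a b c : Fin n} (ha : DelOK q a)
    (hbc : Adj q b c) (hba : b ≠ a) (hca : c ≠ a) :
    Dia q (del q a) (mrg q b c) (mrg (del q a) b c) ∧
      mrg (del q a) b c = del (mrg q b c) a := by
  have hr := del_chi h ha
  have hr' := mrg_chi h hbc
  obtain ⟨hal, a', hne, hal', h0⟩ := id ha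
  have hadj : Adj (del q a) b c := by
    obtain ⟨h1, ⟨s, hs, h2⟩, x, h3, h4⟩ := hbc
    refine ⟨by rwa [del_ne hba hca], ⟨s, hs, ?_⟩, ?_⟩
    · intro y hy1 hy2
      have hya : y ≠ a := by rintro rfl; exact hy1 (del_r _ _ _)
      rw [del_ne hba hya] at hy1 ⊢
      rw [del_ne hca hya] at hy2 ⊢
      exact h2 y hy1 hy2
    · by_cases hxa : x = a
      · subst hxa
        refine ⟨a', ?_, ?_⟩
        · rw [del_ne hba hne]
          exact fun h' => h3 (h.tr hal' h' (h.symm0 h0))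
        · rw [del_ne hca hne]
          exact fun h' => h4 (h.tr hal' h' (h.symm0 h0))
      · exact ⟨x, by rwa [del_ne hba hxa], by rwa [del_ne hca hxa]⟩
  have heq : mrg (del q a) b c = del (mrg q b c) a := by
    funext x y
    by_cases hx : x = a
    · subst hx
      rw [del_l]
      exact z_le (mrg_le _ _ _) (del_l _ _ _)
    by_cases hy : y = a
    · subst hy
      rw [del_r]
      exact z_le (mrg_le _ _ _) (del_r _ _ _)
    rw [del_ne hx hy]
    unfold mrg inC
    rw [del_ne hx hba, del_ne hx hca, del_ne hy hba, del_ne hy hca, del_ne hx hy]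
  have ha2 : DelOK (mrg q b c) a :=
    ⟨nl_mrg h hbc hal, a', hne, nl_mrg h hbc hal', z_le (mrg_le _ _ _) h0⟩
  refine ⟨⟨Or.inl ⟨a, ha, rfl⟩, Or.inr ⟨b, c, hbc, rfl⟩, Or.inr ⟨b, c, hadj, rfl⟩,
    Or.inl ⟨a, ha2, heq⟩, ?_, ?_⟩, heq⟩
  · intro he
    have := nl_mrg h hbc hal
    rw [← he] at this
    exact not_nl_del _ _ this
  · rw [heq]
    rintro z (⟨d, hd, rfl⟩ | ⟨d, e, hde, rfl⟩) hle
    · left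
      by_cases hda : d = a
      · rw [hda]
      exfalso
      exact not_nl_del q d (nl_le hle (nl_del hr' ha2 hda (nl_mrg h hbc hd.1)))
    · right
      obtain ⟨d0, h1, h2, h3⟩ := del_rep h ha (h.nl hde.1).1
      obtain ⟨e0, k1, k2, k3⟩ := del_rep h ha (h.nl hde.1).2
      have hz := z_le hle (mrg_in (q := q) (a := d) (b := e) (x := d0) (y := e0)
        (Or.inl (h.symm0 h3)) (Or.inr (h.symm0 k3)))
      rw [del_ne h1 k1] at hz
      have hne0 := ne_par h hde.1 h2 k2 h3 k3
      have hin : inC q b c d0 ∧ inC q b c e0 := by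
        by_contra hcon
        simp only [mrg, hcon, if_false] at hz
        exact hne0 hz
      rw [mrg_congr h (h.nl hde.1).1 h2 h3, mrg_symm, mrg_congr h (h.nl hde.1).2 k2 k3, mrg_symm]
      exact mrg_eq h hbc.1 hne0 hin.1 hin.2

theorem three_nbr {q : Fin n → Fin n → SignType} (h : IsChi q) {a b c d : Fin n}
    (hb : Adj q a b) (hc : Adj q a c) (hd : Adj q a d) (hbc : q b c ≠ 0) (hbd : q b d ≠ 0)
    (hcd : q c d ≠ 0) : False := by
  obtain ⟨h1, ⟨s, hs, hsr⟩, -⟩ := hb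
  obtain ⟨h2, ⟨t, ht, htr⟩, -⟩ := hc
  obtain ⟨h3, ⟨u, hu, hur⟩, -⟩ := hd
  have aux : ∀ s t ab ac bc : SignType, (s ≠ 0 ∧ t ≠ 0 ∧ ac = s * bc ∧ ab = t * -bc) →
      s * ab = -(t * ac) := by decide
  have e1 := aux s t (q a b) (q a c) (q b c) ⟨hs, ht, hsr c h2 hbc, by
    rw [← h.alt c b]; exact htr b h1 (h.symm1 hbc)⟩
  have e2 := aux s u (q a b) (q a d) (q b d) ⟨hs, hu, hsr d h3 hbd, by
    rw [← h.alt d b]; exact hur b h1 (h.symm1 hbd)⟩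
  have e3 := aux t u (q a c) (q a d) (q c d) ⟨ht, hu, htr d h3 hcd, by
    rw [← h.alt d c]; exact hur c h2 (h.symm1 hcd)⟩
  have h4 : s * q a b ≠ 0 := mul_ne_zero hs h1
  revert e1 e2 e3 h4
  generalize s * q a b = x
  generalize t * q a c = y
  generalize u * q a d = z
  clear * -
  revert x y z
  decide

theorem dia_sing {q : Fin n → Fin n → SignType} (h : IsChi q) {a c : Fin n}
    (hsing : ∀ x, x ≠ a → NL q x → q a x ≠ 0) (hac : Adj q a c) :
    del (mrg q a c) a = del q a ∧ ∃ d, Dia q (mrg q a c) (mrg q a d) (del q a) := by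
  have ha := (h.nl hac.1).1
  have hc := (h.nl hac.1).2
  have hca : c ≠ a := by rintro rfl; exact hac.1 (h.self _)
  have hdel : ∀ e, Adj q a e → del (mrg q a e) a = del q a := by
    intro e hae
    funext x y
    by_cases hx : x = a
    · subst hx; rw [del_l, del_l]
    by_cases hy : y = a
    · subst hy; rw [del_r, del_r]
    rw [del_ne hx hy, del_ne hx hy]
    by_cases hxy : q x y = 0
    · rw [hxy]; exact z_le (mrg_le _ _ _) hxy
    have hax := hsing x hx (h.nl hxy).1
    have hay := hsing y hy (h.nl hxy).2
    by_cases hin : inC q a e x ∧ inC q a e y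
    · exfalso
      obtain ⟨h1 | h1, h2 | h2⟩ := hin
      · exact hax (h.symm0 h1)
      · exact hax (h.symm0 h1)
      · exact hay (h.symm0 h2)
      · exact hxy (h.tr (h.nl hae.1).2 h1 (h.symm0 h2))
    · simp only [mrg, hin, if_false]
  have hstep : ∀ e, Adj q a e → Step (mrg q a e) (del q a) := by
    intro e hae
    refine Or.inl ⟨a, ⟨nl_mrg h hae ha, e, ?_, nl_mrg h hae (h.nl hae.1).2,
      mrg_in (inC_l h _ _) (inC_r h _ _)⟩, (hdel e hae).symm⟩
    rintro rfl; exact hae.1 (h.self _)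
  refine ⟨hdel c hac, ?_⟩
  obtain ⟨h1, ⟨s, hs, hsr⟩, x0, h2, h3⟩ := id hac
  obtain ⟨d, had, hdr⟩ := extreme h ha (e := - s * q a c) (by
    revert hs h1; generalize q a c = t; clear * -; revert s t; decide)
  have hd := (h.nl had).2
  have hdc : q d c ≠ 0 := by
    intro h0
    obtain ⟨t, ht, htr⟩ := h.par (h.symm0 h0) hc hd
    have e1 := hsr x0 h2 h3
    have e2 := hdr x0 h2 (by rw [htr]; exact mul_ne_zero ht h3)
    have e3 := htr a
    rw [h.alt d a, h.alt c a] at e3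
    rw [htr x0] at e2
    have aux : ∀ s t ac ad ax cx : SignType, s ≠ 0 → t ≠ 0 → ac ≠ 0 → ax ≠ 0 →
        ax = s * cx → -ad = t * -ac → ¬ ax = - s * ac * ad * (t * cx) := by decide
    exact aux _ _ _ _ _ _ hs ht h1 h2 e1 e3 e2
  have hadj : Adj q a d := by
    refine ⟨had, ⟨_, ?_, hdr⟩, c, h1, hdc⟩
    revert hs h1 had; generalize q a c = t; generalize q a d = t'; clear * -
    revert s t t'; decide
  have hda : d ≠ a := by rintro rfl; exact had (h.self _)
  refine ⟨d, Or.inr ⟨a, c, hac, rfl⟩, Or.inr ⟨a, d, hadj, rfl⟩, hstep c hac, hstep d hadj, ?_, ?_⟩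
  · intro heq
    have e1 : mrg q a c a c = 0 := mrg_in (inC_l h _ _) (inC_r h _ _)
    rw [heq, mrg_out'] at e1
    · exact h1 e1
    · rintro (h4 | h4)
      · exact h1 (h.symm0 h4)
      · exact hdc (h.symm0 h4)
  · have huniq : ∀ f, Adj q a f → mrg q a f = mrg q a c ∨ mrg q a f = mrg q a d := by
      intro f hf
      have hfl := (h.nl hf.1).2
      by_cases hfc : q c f = 0
      · left
        rw [mrg_symm, mrg_congr h hfl hc (h.symm0 hfc), mrg_symm]
      by_cases hfd : q d f = 0
      · right
        rw [mrg_symm, mrg_congr h hfl hd (h.symm0 hfd), mrg_symm]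
      exact (three_nbr h hadj hac hf hdc hfd hfc).elim
    rintro z (⟨e, he, rfl⟩ | ⟨e, f, hef, rfl⟩) hle
    · exfalso
      have hea : e ≠ a := by
        rintro rfl
        obtain ⟨-, e', h4, h5, h6⟩ := he
        exact hsing e' h4 h5 h6
      apply not_nl_del q e
      apply nl_le hle
      by_cases hec : q e c = 0
      · refine ⟨d, ?_⟩
        rw [del_ne hea hda]
        intro h4
        exact hdc (h.tr he.1 (h.symm0 h4) hec)
      · exact ⟨c, by rwa [del_ne hea hca]⟩
    · have hz := z_le hle (mrg_in (inC_l h e f) (inC_r h e f))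
      by_cases hea : e = a
      · subst hea; exact huniq f hef
      by_cases hfa : f = a
      · subst hfa
        rw [mrg_symm]; exact huniq e (hef.symm h)
      rw [del_ne hea hfa] at hz
      exact absurd hz hef.1

theorem Adj.of_rows {q q' : Fin n → Fin n → SignType} {a b : Fin n} (h : Adj q a b)
    (ha : ∀ x, q' a x = q a x) (hb : ∀ x, q' b x = q b x) : Adj q' a b := by
  unfold Adj at *
  simp only [ha, hb]
  exact h

theorem dia_mm {q : Fin n → Fin n → SignType} (h : IsChi q) {a b c d : Fin n}
    (hab : Adj q a b) (hcd : Adj (mrg q a b) c d) (hc : ¬ inC q a b c) (hd : ¬ inC q a b d) :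
    Dia q (mrg q a b) (mrg q c d) (mrg (mrg q a b) c d) := by
  have hcd' : Adj q c d :=
    hcd.of_rows (fun x => (mrg_out hc x).symm) (fun x => (mrg_out hd x).symm)
  have hr := mrg_chi h hab
  have hr' := mrg_chi h hcd'
  have ha' : ¬ inC q c d a := by
    rintro (h0 | h0)
    · exact hc (Or.inl (h.symm0 h0))
    · exact hd (Or.inl (h.symm0 h0))
  have hb' : ¬ inC q c d b := by
    rintro (h0 | h0)
    · exact hc (Or.inr (h.symm0 h0))
    · exact hd (Or.inr (h.symm0 h0))
  have hab' : Adj (mrg q c d) a b := hab.of_rows (mrg_out ha') (mrg_out hb')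
  have i1 : ∀ x, inC (mrg q a b) c d x ↔ inC q c d x := by
    intro x
    unfold inC
    rw [mrg_out' hc, mrg_out' hd]
  have i2 : ∀ x, inC (mrg q c d) a b x ↔ inC q a b x := by
    intro x
    unfold inC
    rw [mrg_out' ha', mrg_out' hb']
  have heq : mrg (mrg q a b) c d = mrg (mrg q c d) a b := by
    funext x y
    by_cases h1 : inC q a b x ∧ inC q a b y
    · rw [mrg_in (q := mrg q c d) ((i2 x).2 h1.1) ((i2 y).2 h1.2)]
      exact z_le (mrg_le _ _ _) (mrg_in h1.1 h1.2)
    by_cases h2 : inC q c d x ∧ inC q c d y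
    · rw [mrg_in (q := mrg q a b) ((i1 x).2 h2.1) ((i1 y).2 h2.2)]
      exact (z_le (mrg_le _ _ _) (mrg_in h2.1 h2.2)).symm
    have h1' : ¬ (inC (mrg q c d) a b x ∧ inC (mrg q c d) a b y) := by rwa [i2, i2]
    have h2' : ¬ (inC (mrg q a b) c d x ∧ inC (mrg q a b) c d y) := by rwa [i1, i1]
    rw [mrg, if_neg h2', mrg, if_neg h1, mrg, if_neg h1', mrg, if_neg h2]
  refine ⟨Or.inr ⟨a, b, hab, rfl⟩, Or.inr ⟨c, d, hcd', rfl⟩, Or.inr ⟨c, d, hcd, rfl⟩,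
    Or.inr ⟨a, b, hab', heq⟩, ?_, ?_⟩
  · intro he
    have e1 : mrg q a b a b = 0 := mrg_in (inC_l h _ _) (inC_r h _ _)
    rw [he, mrg_out ha'] at e1
    exact hab.1 e1
  · rintro z (⟨e, he, rfl⟩ | ⟨e, f, hef, rfl⟩) hle
    · exfalso
      exact not_nl_del q e (nl_le hle (nl_mrg hr hcd (nl_mrg h hab he.1)))
    · have hz := z_le hle (mrg_in (inC_l h e f) (inC_r h e f))
      by_cases h1 : inC q a b e ∧ inC q a b f
      · left; exact mrg_eq h hab.1 hef.1 h1.1 h1.2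
      by_cases h2 : inC q c d e ∧ inC q c d f
      · right; exact mrg_eq h hcd'.1 hef.1 h2.1 h2.2
      have h2' : ¬ (inC (mrg q a b) c d e ∧ inC (mrg q a b) c d f) := by rwa [i1, i1]
      rw [mrg, if_neg h2', mrg, if_neg h1] at hz
      exact absurd hz hef.1

def inT (q : Fin n → Fin n → SignType) (a b d x : Fin n) : Prop :=
  q x a = 0 ∨ q x b = 0 ∨ q x d = 0

open Classical in
theorem mrg_mrg {q : Fin n → Fin n → SignType} (h : IsChi q) {a b d : Fin n}
    (hd : ¬ inC q a b d) (x y : Fin n) :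
    mrg (mrg q a b) a d x y = if inT q a b d x ∧ inT q a b d y then 0 else q x y := by
  have i1 : ∀ x, inC (mrg q a b) a d x ↔ inT q a b d x := by
    intro x
    unfold inC inT
    rw [mrg_out' hd]
    by_cases hx : inC q a b x
    · rw [mrg_in hx (inC_l h a b)]
      unfold inC at hx
      tauto
    · rw [mrg_out hx]
      unfold inC at hx
      tauto
  by_cases h1 : inT q a b d x ∧ inT q a b d y
  · rw [if_pos h1, mrg_in ((i1 x).2 h1.1) ((i1 y).2 h1.2)]
  · have h1' : ¬ (inC (mrg q a b) a d x ∧ inC (mrg q a b) a d y) := by rwa [i1, i1]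
    rw [if_neg h1, mrg, if_neg h1', mrg, if_neg]
    rintro ⟨h2, h3⟩
    apply h1
    unfold inC at h2 h3
    unfold inT
    tauto

theorem dia_tri {q : Fin n → Fin n → SignType} (h : IsChi q) {a b d : Fin n}
    (hab : Adj q a b) (hbd : Adj q b d) (hnad : ¬ Adj q a d) (had : Adj (mrg q a b) a d) :
    Dia q (mrg q a b) (mrg q b d) (mrg (mrg q a b) a d) := by
  have hr := mrg_chi h hab
  have hr' := mrg_chi h hbd
  have hd : ¬ inC q a b d := fun h0 => had.1 (mrg_in (inC_l h a b) h0)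
  have hqad : q a d ≠ 0 := fun h0 => hd (Or.inl (h.symm0 h0))
  have ha : ¬ inC q b d a := by
    rintro (h0 | h0)
    · exact hab.1 h0
    · exact hqad h0
  have heq : mrg (mrg q a b) a d = mrg (mrg q b d) b a := by
    funext x y
    rw [mrg_mrg h hd, mrg_mrg h ha]
    have : inT q a b d = inT q b d a := by
      funext x
      unfold inT
      apply propext
      tauto
    rw [this]
  have hadj : Adj (mrg q b d) b a := by
    obtain ⟨h1, ⟨s, hs, h2⟩, -⟩ := hab.symm h
    refine ⟨by rwa [mrg_out' ha], ⟨s, hs, ?_⟩, ?_⟩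
    · intro y hy1 hy2
      rw [mrg_out ha] at hy2 ⊢
      rw [eq_le (mrg_le _ _ _) hy1]
      exact h2 y (ne_le (mrg_le _ _ _) hy1) hy2
    · obtain ⟨x, h3, h4⟩ := had.2.2
      have hx : ¬ inC q a b x := fun h0 => h3 (mrg_in (inC_l h a b) h0)
      have h4' := ne_le (mrg_le _ _ _) h4
      refine ⟨x, ?_, ?_⟩
      · rw [mrg_out']
        · exact fun h0 => hx (Or.inr (h.symm0 h0))
        · rintro (h0 | h0)
          · exact hx (Or.inr h0)
          · exact h4' (h.symm0 h0)
      · rw [mrg_out ha]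
        exact fun h0 => hx (Or.inl (h.symm0 h0))
  refine ⟨Or.inr ⟨a, b, hab, rfl⟩, Or.inr ⟨b, d, hbd, rfl⟩, Or.inr ⟨a, d, had, rfl⟩,
    Or.inr ⟨b, a, hadj, heq⟩, ?_, ?_⟩
  · intro he
    have e1 : mrg q a b a b = 0 := mrg_in (inC_l h _ _) (inC_r h _ _)
    rw [he, mrg_out ha] at e1
    exact hab.1 e1
  · rintro z (⟨e, he, rfl⟩ | ⟨e, f, hef, rfl⟩) hle
    · exfalso
      exact not_nl_del q e (nl_le hle (nl_mrg hr had (nl_mrg h hab he.1)))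
    · have hz := z_le hle (mrg_in (inC_l h e f) (inC_r h e f))
      have hin : inT q a b d e ∧ inT q a b d f := by
        by_contra h0
        rw [mrg_mrg h hd, if_neg h0] at hz
        exact hef.1 hz
      by_cases h1 : inC q a b e ∧ inC q a b f
      · left; exact mrg_eq h hab.1 hef.1 h1.1 h1.2
      by_cases h2 : inC q b d e ∧ inC q b d f
      · right; exact mrg_eq h hbd.1 hef.1 h2.1 h2.2
      exfalso
      have hal := (h.nl hab.1).1
      have hdl := (h.nl hqad).2
      have key : ∀ e f, Adj q e f → q e a = 0 → q f d = 0 → False := by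
        intro e f hef he hf
        exact hnad (((hef.congr h hal he).symm h).congr h hdl hf |>.symm h)
      unfold inT at hin
      unfold inC at h1 h2
      rcases hin with ⟨h3 | h3 | h3, h4 | h4 | h4⟩
      · exact h1 ⟨Or.inl h3, Or.inl h4⟩
      · exact h1 ⟨Or.inl h3, Or.inr h4⟩
      · exact key e f hef h3 h4
      · exact h1 ⟨Or.inr h3, Or.inl h4⟩
      · exact h1 ⟨Or.inr h3, Or.inr h4⟩
      · exact h2 ⟨Or.inl h3, Or.inr h4⟩
      · exact key f e (hef.symm h) h4 h3
      · exact h2 ⟨Or.inr h3, Or.inl h4⟩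
      · exact h2 ⟨Or.inr h3, Or.inr h4⟩

theorem tri_adj {q : Fin n → Fin n → SignType} (h : IsChi q) {a b d : Fin n}
    (hab : Adj q a b) (had : Adj (mrg q a b) a d) :
    (Adj q a d ∧ ¬ Adj q b d) ∨ (Adj q b d ∧ ¬ Adj q a d) := by
  have hd : ¬ inC q a b d := fun h0 => had.1 (mrg_in (inC_l h a b) h0)
  have hqad : q a d ≠ 0 := fun h0 => hd (Or.inl (h.symm0 h0))
  have hqbd : q b d ≠ 0 := fun h0 => hd (Or.inr (h.symm0 h0))
  obtain ⟨h1, ⟨s, hs, hsr⟩, -⟩ := id hab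
  obtain ⟨-, ⟨t, ht, htr⟩, x, h3, h4⟩ := id had
  have ha := (h.nl h1).1
  have hb := (h.nl h1).2
  have hx : ¬ inC q a b x := fun h0 => h3 (mrg_in (inC_l h a b) h0)
  have hdx := ne_le (mrg_le _ _ _) h4
  have hax : q a x ≠ 0 := fun h0 => hx (Or.inl (h.symm0 h0))
  have hbx : q b x ≠ 0 := fun h0 => hx (Or.inr (h.symm0 h0))
  have ht2 : ∀ y, q a y ≠ 0 → q b y ≠ 0 → q d y ≠ 0 → q a y = t * q d y := by
    intro y k1 k2 k3
    have hy : ¬ inC q a b y := by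
      rintro (k | k)
      · exact k1 (h.symm0 k)
      · exact k2 (h.symm0 k)
    have := htr y
    rw [mrg_out' hy, mrg_out' hy] at this
    exact this k1 k3
  have e1 := hsr x hax hbx
  have e2 := ht2 x hax hbx hdx
  have e3 := hsr d hqad hqbd
  have aux0 : ∀ s t z : SignType, s * (t * z) = t * (s * z) := by decide
  -- sufficient conditions
  have A1 : q a b = t * q d b → Adj q a d := by
    intro k
    refine ⟨hqad, ⟨t, ht, ?_⟩, b, h1, h.symm1 hqbd⟩
    intro y k1 k2
    by_cases k3 : q b y = 0
    · obtain ⟨u, hu, hur⟩ := h.par k3 hb ⟨a, h.symm1 k1⟩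
      rw [h.alt a y, h.alt d y, hur, hur, h.alt b a, h.alt b d, k]
      have aux : ∀ u t z : SignType, -(u * -(t * z)) = t * -(u * -z) := by decide
      exact aux _ _ _
    · exact ht2 y k1 k3 k2
  have A2 : q b a = s * t * q d a → Adj q b d := by
    intro k
    refine ⟨hqbd, ⟨s * t, mul_ne_zero hs ht, ?_⟩, a, h.symm1 h1, h.symm1 hqad⟩
    intro y k1 k2
    by_cases k3 : q a y = 0
    · obtain ⟨u, hu, hur⟩ := h.par k3 ha ⟨b, h.symm1 k1⟩
      rw [h.alt b y, h.alt d y, hur, hur, h.alt a b, h.alt a d, k]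
      have aux : ∀ u t z : SignType, -(u * -(t * z)) = t * -(u * -z) := by decide
      exact aux _ _ _
    · have k4 := hsr y k3 k1
      have k5 := ht2 y k3 k1 k2
      have aux : ∀ s t ay b' d' : SignType, s ≠ 0 → ay = s * b' → ay = t * d' → b' = s * t * d' := by
        decide
      exact aux _ _ _ _ _ hs k4 k5
  have B1 : Adj q a d → q a b = t * q d b := by
    rintro ⟨-, ⟨u, hu, hur⟩, -⟩
    have k1 := hur x hax hdx
    have k2 := hur b h1 (h.symm1 hqbd)
    have aux : ∀ t u ax dx : SignType, ax ≠ 0 → ax = t * dx → ax = u * dx → t = u := by decide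
    rw [aux _ _ _ _ hax e2 k1]
    exact k2
  have B2 : Adj q b d → q b a = s * t * q d a := by
    rintro ⟨-, ⟨u, hu, hur⟩, -⟩
    have k1 := hur x hbx hdx
    have k2 := hur a (h.symm1 h1) (h.symm1 hqad)
    have aux : ∀ s t u ax bx dx : SignType, ax ≠ 0 → ax = t * dx → bx = u * dx → ax = s * bx →
      s * t = u := by decide
    rw [aux _ _ _ _ _ _ hax e2 k1 e1]
    exact k2
  rw [h.alt b a, h.alt d a] at A2 B2
  rw [h.alt d b] at A1 B1
  have aux1 : ∀ s t ab ad bd : SignType, s ≠ 0 → t ≠ 0 → ab ≠ 0 → ad ≠ 0 → ad = s * bd →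
      (ab = t * -bd ∧ ¬ (-ab = s * t * -ad)) ∨ (-ab = s * t * -ad ∧ ¬ (ab = t * -bd)) := by
    decide
  rcases aux1 s t _ _ _ hs ht h1 hqad e3 with ⟨k1, k2⟩ | ⟨k1, k2⟩
  · exact Or.inl ⟨A1 k1, fun k => k2 (B2 k)⟩
  · exact Or.inr ⟨A2 k1, fun k => k2 (B1 k)⟩

theorem core_tri {q : Fin n → Fin n → SignType} (h : IsChi q) {a b d : Fin n}
    (hab : Adj q a b) (had : Adj (mrg q a b) a d) :
    ∃ r', Dia q (mrg q a b) r' (mrg (mrg q a b) a d) := by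
  rcases tri_adj h hab had with ⟨h1, h2⟩ | ⟨h1, h2⟩
  · have hr := mrg_chi h hab
    have hal := nl_mrg h hab (h.nl hab.1).1
    have hbl := nl_mrg h hab (h.nl hab.1).2
    have h0 : mrg q a b a b = 0 := mrg_in (inC_l h _ _) (inC_r h _ _)
    have hbd : Adj (mrg q a b) b d := had.congr hr hbl h0
    rw [mrg_congr hr hal hbl h0]
    rw [mrg_symm q a b] at hbd ⊢
    exact ⟨_, dia_tri h (hab.symm h) h1 h2 hbd⟩
  · exact ⟨_, dia_tri h hab h1 h2 had⟩

theorem core_tri' {q : Fin n → Fin n → SignType} (h : IsChi q) {a b c d : Fin n}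
    (hab : Adj q a b) (hcd : Adj (mrg q a b) c d) (hc : inC q a b c) :
    ∃ r', Dia q (mrg q a b) r' (mrg (mrg q a b) c d) := by
  have hr := mrg_chi h hab
  have hcl := (hr.nl hcd.1).1
  have hal := nl_mrg h hab (h.nl hab.1).1
  have h0 : mrg q a b c a = 0 := mrg_in hc (inC_l h _ _)
  rw [mrg_congr hr hcl hal h0]
  exact core_tri h hab (hcd.congr hr hal h0)

theorem core {q r p : Fin n → Fin n → SignType} (h : IsChi q) (h1 : Step q r) (h2 : Step r p) :
    ∃ r', Dia q r r' p := by
  rcases h1 with ⟨a, ha, rfl⟩ | ⟨b, c, hbc, rfl⟩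
  · have hr := del_chi h ha
    rcases h2 with ⟨b, hb, rfl⟩ | ⟨b, c, hbc, rfl⟩
    · exact ⟨_, dia_dd h ha hb⟩
    · have hba : b ≠ a := by rintro rfl; exact hbc.1 (del_l _ _ _)
      have hca : c ≠ a := by rintro rfl; exact hbc.1 (del_r _ _ _)
      refine ⟨_, (dia_dm h ha ?_ hba hca).1⟩
      obtain ⟨h1, ⟨s, hs, h2⟩, x, h3, h4⟩ := hbc
      refine ⟨ne_le (del_le _ _) h1, ⟨s, hs, ?_⟩, x, ne_le (del_le _ _) h3,
        ne_le (del_le _ _) h4⟩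
      intro y hy1 hy2
      by_cases hya : y = a
      · subst hya
        obtain ⟨hal, a', hne, hal', h0⟩ := ha
        obtain ⟨u, hu, hur⟩ := h.par (h.symm0 h0) hal' hal
        have k1 : q b a' ≠ 0 := fun h' => hy1 (h.tr hal' h' (h.symm0 h0))
        have k2 : q c a' ≠ 0 := fun h' => hy2 (h.tr hal' h' (h.symm0 h0))
        have k3 := h2 a'
        rw [del_ne hba hne, del_ne hca hne] at k3
        have k4 := k3 k1 k2
        rw [h.alt b a', h.alt c a'] at k4
        rw [h.alt b, h.alt c, hur, hur]
        revert k4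
        generalize q a' b = t1
        generalize q a' c = t2
        clear * -
        revert s u t1 t2
        decide
      · have k3 := h2 y
        rw [del_ne hba hya, del_ne hca hya] at k3
        exact k3 hy1 hy2
  · have hr := mrg_chi h hbc
    rcases h2 with ⟨a, ha, rfl⟩ | ⟨e, f, hef, rfl⟩
    · by_cases hd : DelOK q a
      · -- replace representatives distinct from `a`
        obtain ⟨b0, k1, k2, k3⟩ := del_rep h hd (h.nl hbc.1).1
        obtain ⟨c0, l1, l2, l3⟩ := del_rep h hd (h.nl hbc.1).2
        have hadj : Adj q b0 c0 :=
          ((hbc.congr h k2 k3).symm h).congr h l2 l3 |>.symm h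
        have heq : mrg q b c = mrg q b0 c0 := by
          rw [mrg_congr h (h.nl hbc.1).1 k2 k3, mrg_symm, mrg_congr h (h.nl hbc.1).2 l2 l3,
            mrg_symm]
        obtain ⟨m1, m2⟩ := dia_dm h hd hadj k1 l1
        rw [heq, ← m2]
        exact ⟨_, m1.symm⟩
      · have hal : NL q a := nl_le (mrg_le _ _ _) ha.1
        have hsing : ∀ x, x ≠ a → NL q x → q a x ≠ 0 :=
          fun x hx hxl h0 => hd ⟨hal, x, hx, hxl, h0⟩
        obtain ⟨-, a', hne, hal', h0⟩ := ha
        have hin : inC q b c a := by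
          by_contra h3
          rw [mrg_out h3] at h0
          exact hsing a' hne (nl_le (mrg_le _ _ _) hal') h0
        have key : ∀ b c, Adj q b c → q a b = 0 → ∃ r', Dia q (mrg q b c) r' (del (mrg q b c) a) := by
          intro b c hbc h3
          have : b = a := by
            by_contra hba
            exact hsing b hba (h.nl hbc.1).1 h3
          subst this
          obtain ⟨m1, d, m2⟩ := dia_sing h hsing hbc
          rw [m1]
          exact ⟨_, m2⟩
        rcases hin with h3 | h3
        · exact key b c hbc h3
        · rw [mrg_symm]
          exact key c b (hbc.symm h) h3
    · by_cases h1 : inC q b c e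
      · exact core_tri' h hbc hef h1
      by_cases h2 : inC q b c f
      · rw [mrg_symm (mrg q b c)]
        exact core_tri' h hbc (hef.symm hr) h2
      exact ⟨_, dia_mm h hbc hef h1 h2⟩


theorem cover_step {q r : Fin n → Fin n → SignType} (hq : IsChi q) (hr : IsChi r)
    (hle : Le r q) (hne : r ≠ q)
    (hcov : ∀ z, IsChi z → Le r z → Le z q → z = r ∨ z = q) : Step q r := by
  obtain ⟨z, h1, h2⟩ := exists_step hr hq hle hne
  rcases hcov z (step_chi hq h1) h2 (step_le h1) with h3 | h3
  · rwa [← h3]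
  · exact absurd h3 (step_ne hq h1)

theorem thin_fun {p q r : Fin n → Fin n → SignType} (hp : IsChi p) (hq : IsChi q) (hr : IsChi r)
    (h1 : Le p r) (h2 : p ≠ r) (hc1 : ∀ z, IsChi z → Le p z → Le z r → z = p ∨ z = r)
    (h3 : Le r q) (h4 : r ≠ q) (hc2 : ∀ z, IsChi z → Le r z → Le z q → z = r ∨ z = q) :
    ∃ r', IsChi r' ∧ Le p r' ∧ p ≠ r' ∧ Le r' q ∧ r' ≠ q ∧ r ≠ r' ∧
      ∀ z, IsChi z → Le p z → p ≠ z → Le z q → z ≠ q → z = r ∨ z = r' := by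
  have s1 := cover_step hq hr h3 h4 hc2
  have s2 := cover_step hr hp h1 h2 hc1
  obtain ⟨r', -, d2, -, d4, d5, d6⟩ := core hq s1 s2
  have hr' := step_chi hq d2
  refine ⟨r', hr', step_le d4, step_ne hr' d4, step_le d2, step_ne hq d2, d5, ?_⟩
  intro z hz k1 k2 k3 k4
  obtain ⟨w, w1, w2⟩ := exists_step hz hq k3 k4
  rcases d6 w w1 (le_trans' k1 w2) with rfl | rfl
  · rcases hc1 z hz k1 w2 with h | h
    · exact absurd h.symm k2
    · exact Or.inl h
  · rcases step_cover hr' d4 hz k1 w2 with h | h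
    · exact absurd h.symm k2
    · exact Or.inr h

def Min (r : Fin n → Fin n → SignType) : Prop := ∀ z, IsChi z → Le z r → z = r

theorem min_nl {r : Fin n → Fin n → SignType} (hr : IsChi r) (hm : Min r) {u v x : Fin n}
    (huv : r u v ≠ 0) (hx : NL r x) : x = u ∨ x = v := by
  have h1 : IsChi (res r (fun y => y = u ∨ y = v)) :=
    res_chi hr _ (Or.inl rfl) (Or.inr rfl) huv
  have h2 := hm _ h1 (by
    intro i j
    unfold res
    split_ifs <;> simp)
  obtain ⟨y, hy⟩ := hx
  rw [← h2] at hy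
  by_contra h0
  apply hy
  simp only [res, h0, false_and, if_false]

theorem min_of {r : Fin n → Fin n → SignType} (hr : IsChi r) {u v : Fin n}
    (h : ∀ x, NL r x → x = u ∨ x = v) : Min r := by
  have key : ∀ x y, r x y ≠ 0 → (x = u ∧ y = v) ∨ (x = v ∧ y = u) := by
    intro x y hxy
    have hne : x ≠ y := by rintro rfl; exact hxy (hr.self _)
    have h1 := h x (hr.nl hxy).1
    have h2 := h y (hr.nl hxy).2
    grind
  intro z hz hle
  obtain ⟨i, j, hij⟩ := hz.nonzero
  apply le_antisymm' hle
  intro x y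
  by_cases hxy : r x y = 0
  · exact Or.inl hxy
  right
  refine (eq_le hle ?_).symm
  have hji := hz.symm1 hij
  have k1 := key x y hxy
  have k2 := key i j (ne_le hle hij)
  grind

theorem thin_min {q r : Fin n → Fin n → SignType} (hq : IsChi q) (hr : IsChi r) (hm : Min r)
    (h3 : Le r q) (h4 : r ≠ q) (hc2 : ∀ z, IsChi z → Le r z → Le z q → z = r ∨ z = q) :
    ∃ r', IsChi r' ∧ Min r' ∧ Le r' q ∧ r' ≠ q ∧ r ≠ r' ∧
      ∀ z, IsChi z → Min z → Le z q → z = r ∨ z = r' := by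
  rcases cover_step hq hr h3 h4 hc2 with ⟨a, ha, rfl⟩ | ⟨a, b, hab, rfl⟩
  · obtain ⟨hal, a', hne, hal', h0⟩ := id ha
    have hd' : DelOK q a' := ⟨hal', a, hne.symm, hal, hq.symm0 h0⟩
    obtain ⟨v, hv⟩ := nl_del hq ha hne hal'
    have hr' := del_chi hq hd'
    have hm' : Min (del q a') := by
      refine min_of hr' (u := a) (v := v) ?_
      intro x hx
      by_cases hxa : x = a
      · exact Or.inl hxa
      right
      have hxa' : x ≠ a' := by rintro rfl; exact not_nl_del _ _ hx
      rcases min_nl hr hm hv (nl_del hq ha hxa (nl_le (del_le _ _) hx)) with h | h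
      · exact absurd h hxa'
      · exact h
    have hs : Step q (del q a') := Or.inl ⟨a', hd', rfl⟩
    refine ⟨del q a', hr', hm', step_le hs, step_ne hq hs, ?_, ?_⟩
    · intro heq
      have := nl_del hq hd' hne.symm hal
      rw [← heq] at this
      exact not_nl_del _ _ this
    · intro z hz hzm hle
      by_cases k1 : NL z a
      · by_cases k2 : NL z a'
        · exfalso
          obtain ⟨i, j, hij⟩ := hz.nonzero
          have hji := hz.symm1 hij
          have e1 := min_nl hz hzm hij k1
          have e2 := min_nl hz hzm hij k2
          have e3 := z_le hle h0
          have e4 := z_le hle (hq.symm0 h0)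
          grind
        · exact Or.inr (hm' z hz (le_del hz hle k2))
      · exact Or.inl (hm z hz (le_del hz hle k1))
  · exfalso
    have h0 : mrg q a b a b = 0 := mrg_in (inC_l hq _ _) (inC_r hq _ _)
    obtain ⟨x, hx⟩ := nl_mrg hq hab (hq.nl hab.1).1
    rcases min_nl hr hm hx (nl_mrg hq hab (hq.nl hab.1).2) with h | h
    · exact hab.1 (by rw [h]; exact hq.self _)
    · rw [← h] at hx; exact hx h0

/-! Transfer to `Chirotope2`. -/

theorem chi (N : Chirotope2 n) : IsChi N.χ := ⟨N.nonzero, N.alt, N.gp⟩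

def mk {p : Fin n → Fin n → SignType} (h : IsChi p) : Chirotope2 n :=
  ⟨p, h.nonzero, h.alt, h.gp⟩

def neg (p : Fin n → Fin n → SignType) : Fin n → Fin n → SignType := fun i j => - p i j

theorem neg_chi {p : Fin n → Fin n → SignType} (h : IsChi p) : IsChi (neg p) := by
  refine ⟨?_, ?_, ?_⟩
  · obtain ⟨i, j, hij⟩ := h.nonzero
    refine ⟨i, j, ?_⟩
    simpa [neg] using hij
  · intro i j
    simp only [neg]
    rw [h.alt i j]
  · intro x y0 y1 y2
    simp only [neg, neg_mul_neg]
    exact h.gp x y0 y1 y2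

theorem neg_neg' (p : Fin n → Fin n → SignType) : neg (neg p) = p := by
  funext i j
  simp [neg]

theorem neg_le {p q : Fin n → Fin n → SignType} (h : Le (neg p) q) : Le p (neg q) := by
  intro i j
  have := h i j
  simp only [neg] at *
  revert this
  generalize p i j = t1
  generalize q i j = t2
  clear * -
  revert t1 t2; decide

def Rel (p : Fin n → Fin n → SignType) (N : Chirotope2 n) : Prop := p = N.χ ∨ p = neg N.χ

theorem Rel.chi {p : Fin n → Fin n → SignType} {N : Chirotope2 n} (h : Rel p N) : IsChi p := by
  rcases h with rfl | rfl
  · exact MacThin.chi N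
  · exact neg_chi (MacThin.chi N)

theorem omLe_iff' (N M : Chirotope2 n) : omLe N M ↔ Le N.χ M.χ ∨ Le (neg N.χ) M.χ := by
  have aux : ∀ t1 t2 : SignType, (t1 = 0 ∨ t1 = -1 * t2) ↔ (-t1 = 0 ∨ -t1 = t2) := by decide
  constructor
  · rintro ⟨e, rfl | rfl, h⟩
    · left
      intro i j
      simpa using h i j
    · right
      intro i j
      exact (aux _ _).1 (h i j)
  · rintro (h | h)
    · refine ⟨1, Or.inl rfl, fun i j => ?_⟩
      simpa using h i j
    · exact ⟨-1, Or.inr rfl, fun i j => (aux _ _).2 (h i j)⟩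

theorem neg_le_neg' {p q : Fin n → Fin n → SignType} (h : Le p q) : Le (neg p) (neg q) := by
  apply neg_le
  rwa [neg_neg']

theorem omLe_iff_rel {p q : Fin n → Fin n → SignType} {N M : Chirotope2 n} (hp : Rel p N)
    (hq : Rel q M) : omLe N M ↔ Le p q ∨ Le (neg p) q := by
  rw [omLe_iff']
  have hn : ∀ p q : Fin n → Fin n → SignType, Le (neg p) q ↔ Le p (neg q) := by
    intro p q
    refine ⟨neg_le, fun h => ?_⟩
    have := neg_le_neg' h
    rwa [neg_neg'] at this
  rcases hp with rfl | rfl <;> rcases hq with rfl | rfl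
  · rfl
  · rw [← hn N.χ M.χ, hn N.χ (neg M.χ), neg_neg']; exact or_comm
  · rw [neg_neg']; exact or_comm
  · rw [neg_neg', hn N.χ (neg M.χ), neg_neg', hn N.χ M.χ]

theorem rep {q : Fin n → Fin n → SignType} {N M : Chirotope2 n} (hq : Rel q M)
    (h : omLe N M) : ∃ p, Rel p N ∧ Le p q := by
  rcases (omLe_iff_rel (Or.inl rfl) hq).1 h with h | h
  · exact ⟨_, Or.inl rfl, h⟩
  · exact ⟨_, Or.inr rfl, h⟩

theorem le_iff {p q m : Fin n → Fin n → SignType} {N M : Chirotope2 n} (hp : Rel p N)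
    (hq : Rel q M) (h1 : Le p m) (h2 : Le q m) : omLe N M ↔ Le p q := by
  rw [omLe_iff_rel hp hq, or_iff_left]
  intro h
  obtain ⟨i, j, hij⟩ := hp.chi.nonzero
  have k1 := h1 i j
  have k2 := h2 i j
  have k3 := h i j
  simp only [neg] at k3
  revert k1 k2 k3 hij
  generalize p i j = t1
  generalize q i j = t2
  generalize m i j = t3
  clear * -
  revert t1 t2 t3
  decide

theorem lt_iff {p q m : Fin n → Fin n → SignType} {N M : Chirotope2 n} (hp : Rel p N)
    (hq : Rel q M) (h1 : Le p m) (h2 : Le q m) : omLt N M ↔ Le p q ∧ p ≠ q := by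
  unfold omLt
  rw [le_iff hp hq h1 h2, le_iff hq hp h2 h1]
  constructor
  · rintro ⟨a, b⟩
    exact ⟨a, by rintro rfl; exact b a⟩
  · rintro ⟨a, b⟩
    exact ⟨a, fun c => b (le_antisymm' a c)⟩

theorem equiv_iff {p q m : Fin n → Fin n → SignType} {N M : Chirotope2 n} (hp : Rel p N)
    (hq : Rel q M) (h1 : Le p m) (h2 : Le q m) : omEquiv N M ↔ p = q := by
  unfold omEquiv
  rw [le_iff hp hq h1 h2, le_iff hq hp h2 h1]
  constructor
  · rintro ⟨a, b⟩
    exact le_antisymm' a b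
  · rintro rfl
    exact ⟨le_refl' _, le_refl' _⟩

theorem min_iff {p : Fin n → Fin n → SignType} {N : Chirotope2 n} (hp : Rel p N) :
    (∀ N', ¬ omLt N' N) ↔ Min p := by
  constructor
  · intro h z hz hle
    by_contra hne
    exact h (mk hz) ((lt_iff (m := p) (Or.inl rfl) hp hle (le_refl' _)).2 ⟨hle, hne⟩)
  · intro h N' hlt
    obtain ⟨p', h1, h2⟩ := rep hp hlt.1
    have := (lt_iff (m := p) h1 hp h2 (le_refl' _)).1 hlt
    exact this.2 (h p' h1.chi h2)

theorem covers_fun {p q m : Fin n → Fin n → SignType} {N M : Chirotope2 n} (hp : Rel p N)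
    (hq : Rel q M) (h1 : Le p m) (h2 : Le q m) (h : OMCovers N M) :
    Le p q ∧ p ≠ q ∧ ∀ z, IsChi z → Le p z → Le z q → z = p ∨ z = q := by
  obtain ⟨h3, h4⟩ := h
  obtain ⟨h5, h6⟩ := (lt_iff hp hq h1 h2).1 h3
  refine ⟨h5, h6, fun z hz k1 k2 => ?_⟩
  by_contra hcon
  push Not at hcon
  have hzm := le_trans' k2 h2
  have hzr : Rel z (mk hz) := Or.inl rfl
  exact h4 (mk hz) ((lt_iff hp hzr h1 hzm).2 ⟨k1, hcon.1.symm⟩)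
    ((lt_iff hzr hq hzm h2).2 ⟨k2, hcon.2⟩)

end MacThin

/-- For any rank-2 oriented matroid `M`, every interval of length 2 in
`MacP(2,n)_{≤M} ∪ {0̂}` has exactly four elements, i.e. exactly two elements strictly
between its endpoints.  The first conjunct treats intervals `[N₀, N₂]` with both endpoints
oriented matroids; the second treats intervals `[0̂, N₂]` (whose strictly intermediate
elements are the minimal oriented matroids below `N₂`). -/
theorem macp_below_thin {n : ℕ} (M : Chirotope2 n) :
    (∀ N0 N2 : Chirotope2 n, omLe N2 M → omLt N0 N2 →
      (∃ N1 : Chirotope2 n, OMCovers N0 N1 ∧ OMCovers N1 N2) →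
      ∃ Z1 Z2 : Chirotope2 n, omLt N0 Z1 ∧ omLt Z1 N2 ∧ omLt N0 Z2 ∧ omLt Z2 N2 ∧
        ¬ omEquiv Z1 Z2 ∧
        ∀ Z : Chirotope2 n, omLt N0 Z → omLt Z N2 → (omEquiv Z Z1 ∨ omEquiv Z Z2)) ∧
    (∀ N2 : Chirotope2 n, omLe N2 M →
      (∃ N1 : Chirotope2 n, (∀ N', ¬ omLt N' N1) ∧ OMCovers N1 N2) →
      ∃ Z1 Z2 : Chirotope2 n,
        (∀ N', ¬ omLt N' Z1) ∧ omLt Z1 N2 ∧ (∀ N', ¬ omLt N' Z2) ∧ omLt Z2 N2 ∧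
        ¬ omEquiv Z1 Z2 ∧
        ∀ Z : Chirotope2 n, (∀ N', ¬ omLt N' Z) → omLt Z N2 →
          (omEquiv Z Z1 ∨ omEquiv Z Z2)) := by
  constructor
  · rintro N0 N2 - h02 ⟨N1, c1, c2⟩
    have R2 : MacThin.Rel N2.χ N2 := Or.inl rfl
    have q2 := MacThin.le_refl' N2.χ
    obtain ⟨r, R1, r1⟩ := MacThin.rep R2 c2.1.1
    obtain ⟨p, R0, p1⟩ := MacThin.rep R2 h02.1
    obtain ⟨a1, a2, a3⟩ := MacThin.covers_fun R0 R1 p1 r1 c1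
    obtain ⟨b1, b2, b3⟩ := MacThin.covers_fun R1 R2 r1 q2 c2
    obtain ⟨r', hr', k1, k2, k3, k4, k5, k6⟩ :=
      MacThin.thin_fun R0.chi R2.chi R1.chi a1 a2 a3 b1 b2 b3
    have R' : MacThin.Rel r' (MacThin.mk hr') := Or.inl rfl
    refine ⟨N1, MacThin.mk hr', c1.1, c2.1, (MacThin.lt_iff R0 R' p1 k3).2 ⟨k1, k2⟩,
      (MacThin.lt_iff R' R2 k3 q2).2 ⟨k3, k4⟩, ?_, ?_⟩
    · rw [MacThin.equiv_iff R1 R' r1 k3]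
      exact k5
    · intro Z h1 h2
      obtain ⟨z, RZ, z1⟩ := MacThin.rep R2 h2.1
      obtain ⟨l1, l2⟩ := (MacThin.lt_iff R0 RZ p1 z1).1 h1
      obtain ⟨l3, l4⟩ := (MacThin.lt_iff RZ R2 z1 q2).1 h2
      rw [MacThin.equiv_iff RZ R1 z1 r1, MacThin.equiv_iff RZ R' z1 k3]
      exact k6 z RZ.chi l1 l2 l3 l4
  · rintro N2 - ⟨N1, c1, c2⟩
    have R2 : MacThin.Rel N2.χ N2 := Or.inl rfl
    have q2 := MacThin.le_refl' N2.χ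
    obtain ⟨r, R1, r1⟩ := MacThin.rep R2 c2.1.1
    obtain ⟨b1, b2, b3⟩ := MacThin.covers_fun R1 R2 r1 q2 c2
    obtain ⟨r', hr', k1, k3, k4, k5, k6⟩ :=
      MacThin.thin_min R2.chi R1.chi ((MacThin.min_iff R1).1 c1) b1 b2 b3
    have R' : MacThin.Rel r' (MacThin.mk hr') := Or.inl rfl
    refine ⟨N1, MacThin.mk hr', c1, c2.1, (MacThin.min_iff R').2 k1,
      (MacThin.lt_iff R' R2 k3 q2).2 ⟨k3, k4⟩, ?_, ?_⟩
    · rw [MacThin.equiv_iff R1 R' r1 k3]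
      exact k5
    · intro Z h1 h2
      obtain ⟨z, RZ, z1⟩ := MacThin.rep R2 h2.1
      rw [MacThin.equiv_iff RZ R1 z1 r1, MacThin.equiv_iff RZ R' z1 k3]
      exact k6 z RZ.chi ((MacThin.min_iff RZ).1 h1) z1
end

section
/- For any rank-2 oriented matroid M on [n], the interval MacP(2,n)_{≤M} ∪ {0̂} admits a recursive atom ordering. -/
theorem omLe_refl {n : ℕ} (N : Chirotope2 n) : omLe N N :=
  ⟨1, Or.inl rfl, fun i j => Or.inr (one_mul _).symm⟩

theorem omLe_trans {n : ℕ} {a b c : Chirotope2 n} (h1 : omLe a b) (h2 : omLe b c) :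
    omLe a c := by
  obtain ⟨e1, he1, H1⟩ := h1
  obtain ⟨e2, he2, H2⟩ := h2
  refine ⟨e1 * e2, ?_, ?_⟩
  · rcases he1 with h | h <;> rcases he2 with h' | h' <;> simp [h, h']
  · intro i j
    rcases H1 i j with h | h
    · exact Or.inl h
    · rcases H2 i j with h' | h'
      · left; rw [h, h', mul_zero]
      · right; rw [h, h', mul_assoc]

/-- Chirotopes determining the same oriented matroid. -/
def macpSetoid (n : ℕ) : Setoid (Chirotope2 n) where
  r := omEquiv
  iseqv := ⟨fun x => ⟨omLe_refl x, omLe_refl x⟩, fun h => ⟨h.2, h.1⟩,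
    fun h1 h2 => ⟨omLe_trans h1.1 h2.1, omLe_trans h2.2 h1.2⟩⟩

/-- The MacPhersonian `MacP(2,n)`: rank-2 oriented matroids on `n` elements. -/
def MacP (n : ℕ) := Quotient (macpSetoid n)

/-- The weak map partial order on `MacP(2,n)`. -/
instance (n : ℕ) : PartialOrder (MacP n) where
  le := Quotient.lift₂ omLe (by
    intro a b a' b' ha hb
    exact propext ⟨fun h => omLe_trans (omLe_trans ha.2 h) hb.1,
                   fun h => omLe_trans (omLe_trans ha.1 h) hb.2⟩)
  le_refl := by rintro ⟨a⟩; exact omLe_refl a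
  le_trans := by rintro ⟨a⟩ ⟨b⟩ ⟨c⟩ h1 h2; exact omLe_trans h1 h2
  le_antisymm := by rintro ⟨a⟩ ⟨b⟩ h1 h2; exact Quotient.sound ⟨h1, h2⟩

/-- The oriented matroid determined by a chirotope. -/
def toMacP {n : ℕ} (M : Chirotope2 n) : MacP n := Quotient.mk (macpSetoid n) M

/-- Auxiliary fuelled version of the recursive atom ordering condition for the interval
`[x, y]` of a poset `P`.  The list of atoms is given as an injective enumeration
`a : Fin t → P` of the atoms of `[x, y]` (elements covering `x` and below `y`). -/
def RAOFuel {P : Type*} [PartialOrder P] : ℕ → P → P → (t : ℕ) → (Fin t → P) → Prop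
  | 0, _, _, _, _ => False
  | (fuel + 1), x, y, t, a =>
      -- `a` enumerates the atoms of `[x,y]` without repetition
      (∀ p : P, (∃ i, a i = p) ↔ (x ⋖ p ∧ p ≤ y)) ∧
      Function.Injective a ∧
      -- if the interval has length greater than 1:
      (¬ x ⋖ y →
        -- (i) each `[a j, y]` admits a recursive atom ordering in which the atoms covering
        -- some earlier `a i` come first
        (∀ j : Fin t, ∃ s : ℕ, ∃ b : Fin s → P,
           RAOFuel fuel (a j) y s b ∧
           ∃ m : ℕ, ∀ q : Fin s, ((∃ i : Fin t, i < j ∧ a i ⋖ b q) ↔ (q : ℕ) < m)) ∧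
        -- (ii) for `i < j`, if `a i, a j < u` then some `z ≤ u` covers `a j` and an earlier atom
        (∀ i j : Fin t, i < j → ∀ u : P, u ≤ y → a i < u → a j < u →
           ∃ k : Fin t, k < j ∧ ∃ z : P, z ≤ u ∧ a k ⋖ z ∧ a j ⋖ z))

/-- `a : Fin t → P` is a recursive atom ordering of the interval `[x, y]`. -/
def IsRAO {P : Type*} [PartialOrder P] (x y : P) (t : ℕ) (a : Fin t → P) : Prop :=
  ∃ fuel, RAOFuel fuel x y t a

/-- `k` lies in the cyclic half-open interval `[i, j)` (everything when `i = j`). -/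
def inI (i k j : ℕ) : Prop := (i < j ∧ i ≤ k ∧ k < j) ∨ (j ≤ i ∧ (i ≤ k ∨ k < j))

/-- Combinatorial model: a set `S` of non-loops on a cycle, and the set `C` of last elements of
the parallel classes. -/
@[ext] structure OMc where
  S : Finset ℕ
  C : Finset ℕ
  sub : ∀ c, c ∈ C → c ∈ S
  two : ∀ s ∈ S, ∃ c ∈ C, c ≠ s

def Prev (S : Finset ℕ) (s e : ℕ) : Prop := s ∈ S ∧ ∀ t ∈ S, inI s t e → t = s

theorem exists_prev (S : Finset ℕ) (hS : S.Nonempty) (e : ℕ) (he : e ∉ S) : ∃ s, Prev S s e := by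
  by_cases h : (S.filter (· < e)).Nonempty
  · obtain ⟨m, hm, hmax⟩ := (S.filter (· < e)).exists_max_image id h
    rw [Finset.mem_filter] at hm
    refine ⟨m, hm.1, fun t ht hi => ?_⟩
    have h2 : t < e → t ≤ m := fun h' => hmax t (Finset.mem_filter.2 ⟨ht, h'⟩)
    have : t ≠ e := fun h => he (h ▸ ht)
    unfold inI at hi
    omega
  · obtain ⟨m, hm, hmax⟩ := S.exists_max_image id hS
    refine ⟨m, hm, fun t ht hi => ?_⟩
    have h2 : t ≤ m := hmax t ht
    have h3 : ¬ t < e := fun h' => h ⟨t, by simp [ht, h']⟩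
    have h4 : ¬ m < e := fun h' => h ⟨m, by simp [hm, h']⟩
    unfold inI at hi
    omega

theorem exists_next (S : Finset ℕ) (c : ℕ) (h : ∃ s ∈ S, s ≠ c) :
    ∃ s ∈ S, s ≠ c ∧ ∀ t ∈ S, inI c t s → t = c := by
  obtain ⟨s0, hs0, hs0c⟩ := h
  by_cases h : (S.filter (c < ·)).Nonempty
  · obtain ⟨m, hm, hmin⟩ := (S.filter (c < ·)).exists_min_image id h
    rw [Finset.mem_filter] at hm
    refine ⟨m, hm.1, by omega, fun t ht hi => ?_⟩
    have h2 : c < t → m ≤ t := fun h' => hmin t (Finset.mem_filter.2 ⟨ht, h'⟩)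
    unfold inI at hi
    omega
  · obtain ⟨m, hm, hmin⟩ := S.exists_min_image id ⟨s0, hs0⟩
    have h3 : ∀ t ∈ S, ¬ c < t := fun t ht h' => h ⟨t, by simp [ht, h']⟩
    have h4 : m ≤ s0 := hmin s0 hs0
    have := h3 _ hs0
    refine ⟨m, hm, by omega, fun t ht hi => ?_⟩
    have h2 : m ≤ t := hmin t ht
    have := h3 _ ht
    unfold inI at hi
    omega

instance : LE OMc where
  le x y := (∀ s ∈ x.S, s ∈ y.S) ∧ ∀ c ∈ x.C, ∀ s ∈ x.S, ∃ c' ∈ y.C, inI c c' s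

theorem le_iff' (x y : OMc) : x ≤ y ↔ (∀ s ∈ x.S, s ∈ y.S) ∧
    ∀ c ∈ x.C, ∀ s ∈ x.S, ∃ c' ∈ y.C, inI c c' s := Iff.rfl

theorem C_sub_of_le {x y : OMc} (h : x ≤ y) (hS : ∀ s ∈ y.S, s ∈ x.S) : ∀ c ∈ x.C, c ∈ y.C := by
  intro c hc
  obtain ⟨d, hd, hdc⟩ := x.two c (x.sub c hc)
  obtain ⟨s, hs, hsc, hn⟩ := exists_next x.S c ⟨d, x.sub d hd, hdc⟩
  obtain ⟨c', hc', hi⟩ := h.2 c hc s hs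
  have := hn c' (hS _ (y.sub _ hc')) hi
  exact this ▸ hc'

instance : PartialOrder OMc where
  le_refl x := ⟨fun s hs => hs, fun c hc s hs => ⟨c, hc, by unfold inI; omega⟩⟩
  le_trans x y z h1 h2 := by
    refine ⟨fun s hs => h2.1 s (h1.1 s hs), fun c hc s hs => ?_⟩
    obtain ⟨c', hc', hi⟩ := h1.2 c hc s hs
    obtain ⟨c'', hc'', hi'⟩ := h2.2 c' hc' s (h1.1 s hs)
    refine ⟨c'', hc'', ?_⟩
    unfold inI at *; omega
  le_antisymm x y h1 h2 := by
    have hS : x.S = y.S := by ext s; exact ⟨h1.1 s, h2.1 s⟩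
    have hC : x.C = y.C := by
      ext s; exact ⟨C_sub_of_le h1 h2.1 s, C_sub_of_le h2 h1.1 s⟩
    exact OMc.ext hS hC

def OMc.rk (x : OMc) : ℕ := x.S.card + x.C.card

def IsSplit (x : OMc) (c : ℕ) (p : OMc) : Prop :=
  c ∈ x.S ∧ c ∉ x.C ∧ p.S = x.S ∧ p.C = insert c x.C
def IsR (x : OMc) (e : ℕ) (p : OMc) : Prop :=
  e ∉ x.S ∧ x.S.Nonempty ∧ p.S = insert e x.S ∧ p.C = x.C
def IsL (x : OMc) (e s : ℕ) (p : OMc) : Prop :=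
  e ∉ x.S ∧ s ∈ x.C ∧ Prev x.S s e ∧ p.S = insert e x.S ∧ p.C = insert e (x.C.erase s)

theorem exists_split (x : OMc) (c : ℕ) (h : c ∈ x.S) (h' : c ∉ x.C) : ∃ p, IsSplit x c p :=
  ⟨⟨x.S, insert c x.C, by
    intro d hd; simp at hd; rcases hd with rfl | hd; exacts [h, x.sub d hd], by
    intro s hs; obtain ⟨d, hd, hds⟩ := x.two s hs; exact ⟨d, by simp [hd], hds⟩⟩, h, h', rfl, rfl⟩

theorem exists_R (x : OMc) (e : ℕ) (h : e ∉ x.S) (h' : x.S.Nonempty) : ∃ p, IsR x e p :=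
  ⟨⟨insert e x.S, x.C, by
    intro d hd; simp [x.sub d hd], by
    intro s hs
    simp at hs
    rcases hs with rfl | hs
    · obtain ⟨t, ht⟩ := h'
      obtain ⟨d, hd, hds⟩ := x.two t ht
      exact ⟨d, hd, fun h'' => h (h'' ▸ x.sub d hd)⟩
    · exact x.two s hs⟩, h, h', rfl, rfl⟩

theorem exists_L (x : OMc) (e s : ℕ) (h : e ∉ x.S) (h' : s ∈ x.C) (h'' : Prev x.S s e) :
    ∃ p, IsL x e s p :=
  ⟨⟨insert e x.S, insert e (x.C.erase s), by
    have := x.sub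
    intro d hd; simp at hd ⊢; grind, by
    intro t ht
    by_cases hte : t = e
    · subst hte
      obtain ⟨d, hd, hds⟩ := x.two s (x.sub s h')
      exact ⟨d, by simp [hd, hds], fun h3 => h (h3 ▸ x.sub d hd)⟩
    · exact ⟨e, by simp, fun h => hte h.symm⟩⟩, h, h', h'', rfl, rfl⟩

theorem IsSplit.le {x c p} (h : IsSplit x c p) : x ≤ p := by
  obtain ⟨h1, h2, h3, h4⟩ := h
  refine ⟨by simp [h3], fun c hc s hs => ⟨c, by simp [h4, hc], by unfold inI; omega⟩⟩
theorem IsR.le {x c p} (h : IsR x c p) : x ≤ p := by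
  obtain ⟨h1, h2, h3, h4⟩ := h
  refine ⟨by simp +contextual [h3], fun c hc s hs => ⟨c, by simp [h4, hc], by unfold inI; omega⟩⟩
theorem IsL.le {x e s p} (h : IsL x e s p) : x ≤ p := by
  obtain ⟨h1, h2, h3, h4, h5⟩ := h
  refine ⟨by simp +contextual [h4], fun c hc t ht => ?_⟩
  by_cases hcs : c = s
  · subst hcs
    refine ⟨e, by simp [h5], ?_⟩
    have := h3.2 t ht
    have : t ≠ e := fun h => h1 (h ▸ ht)
    unfold inI at *; omega
  · exact ⟨c, by simp [h5, hc, hcs], by unfold inI; omega⟩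
theorem IsSplit.rk {x c p} (h : IsSplit x c p) : p.rk = x.rk + 1 := by
  obtain ⟨h1, h2, h3, h4⟩ := h
  simp [OMc.rk, h3, h4, h2]; omega
theorem IsR.rk {x c p} (h : IsR x c p) : p.rk = x.rk + 1 := by
  obtain ⟨h1, h2, h3, h4⟩ := h
  simp [OMc.rk, h3, h4, h1]; omega
theorem IsL.rk {x e s p} (h : IsL x e s p) : p.rk = x.rk + 1 := by
  obtain ⟨h1, h2, h3, h4, h5⟩ := h
  have h6 : e ∉ x.C.erase s := fun h => h1 (x.sub e (by simp at h; exact h.2))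
  have : 0 < x.C.card := Finset.card_pos.2 ⟨s, h2⟩
  simp [OMc.rk, h4, h5, h1, Finset.card_insert_of_notMem h6, Finset.card_erase_of_mem h2]; omega

/-- An atom adding the non-loop `e` below `p`. -/
theorem exists_add {x p : OMc} (hx : x.S.Nonempty) (h : x ≤ p) (e : ℕ) (he : e ∉ x.S) (hep : e ∈ p.S) :
    ∃ m ≤ p, IsR x e m ∨ ∃ s, IsL x e s m := by
  obtain ⟨s, hs⟩ := exists_prev x.S hx e he
  have key : ∀ c ∈ x.C, c ≠ s → ∃ c' ∈ p.C, inI c c' e := by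
    intro c hc hcs
    obtain ⟨c', hc', hi⟩ := h.2 c hc s hs.1
    refine ⟨c', hc', ?_⟩
    have := hs.2 c (x.sub c hc)
    have : c ≠ e := fun h => he (h ▸ x.sub c hc)
    unfold inI at *; omega
  by_cases hsC : s ∈ x.C
  · by_cases hcut : ∃ c' ∈ p.C, inI s c' e
    · obtain ⟨m, hm⟩ := exists_R x e he hx
      refine ⟨m, ⟨?_, ?_⟩, Or.inl hm⟩ <;> simp only [hm.2.2.1, hm.2.2.2, Finset.mem_insert]
      · rintro t (rfl | ht); exacts [hep, h.1 t ht]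
      · rintro c hc t (rfl | ht)
        · by_cases hcs : c = s
          · subst hcs; exact hcut
          · exact key c hc hcs
        · exact h.2 c hc t ht
    · obtain ⟨m, hm⟩ := exists_L x e s he hsC hs
      refine ⟨m, ⟨?_, ?_⟩, Or.inr ⟨s, hm⟩⟩ <;>
        simp only [hm.2.2.2.1, hm.2.2.2.2, Finset.mem_insert, Finset.mem_erase]
      · rintro t (rfl | ht); exacts [hep, h.1 t ht]
      · have hse : s ≠ e := fun h => he (h ▸ hs.1)
        rintro c (rfl | hc) t (rfl | ht)
        · obtain ⟨c', hc', -⟩ := h.2 s hsC s hs.1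
          exact ⟨c', hc', by unfold inI; omega⟩
        · by_cases hts : t = s
          · subst hts
            obtain ⟨d, hd, hds⟩ := x.two t ht
            obtain ⟨c', hc', hi⟩ := h.2 d hd t ht
            refine ⟨c', hc', ?_⟩
            have := hs.2 d (x.sub d hd)
            have : d ≠ c := fun h => he (h ▸ x.sub d hd)
            unfold inI at *; omega
          · obtain ⟨c', hc', hi⟩ := h.2 s hsC t ht
            refine ⟨c', hc', ?_⟩
            have h1 : ¬ inI s c' c := fun h => hcut ⟨c', hc', h⟩
            have := hs.2 t ht
            have : t ≠ c := fun h => he (h ▸ ht)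
            unfold inI at *; omega
        · exact key c hc.2 hc.1
        · exact h.2 c hc.2 t ht
  · obtain ⟨m, hm⟩ := exists_R x e he hx
    refine ⟨m, ⟨?_, ?_⟩, Or.inl hm⟩ <;> simp only [hm.2.2.1, hm.2.2.2, Finset.mem_insert]
    · rintro t (rfl | ht); exacts [hep, h.1 t ht]
    · rintro c hc t (rfl | ht)
      · exact key c hc (fun h => hsC (h ▸ hc))
      · exact h.2 c hc t ht

theorem IsSplit.le_of {x p m : OMc} {c} (h : x ≤ p) (hm : IsSplit x c m)
    (hc : ∀ t ∈ x.S, ∃ c' ∈ p.C, inI c c' t) : m ≤ p := by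
  refine ⟨?_, ?_⟩ <;> simp only [hm.2.2.1, hm.2.2.2, Finset.mem_insert]
  · exact h.1
  · rintro d (rfl | hd) t ht
    · exact hc t ht
    · exact h.2 d hd t ht

theorem rk_le {x p : OMc} (hx : x.S.Nonempty) (h : x ≤ p) : x.rk ≤ p.rk := by
  induction hk : (p.S \ x.S).card generalizing x with
  | zero =>
    have h0 : p.S ⊆ x.S := by simpa [Finset.sdiff_eq_empty_iff_subset] using hk
    have hC := C_sub_of_le h h0
    have : x.S = p.S := Finset.Subset.antisymm h.1 h0
    unfold OMc.rk
    rw [this]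
    have := Finset.card_le_card (s := x.C) (t := p.C) hC
    omega
  | succ k ih =>
    obtain ⟨e, he⟩ : (p.S \ x.S).Nonempty := Finset.card_pos.1 (by omega)
    simp at he
    obtain ⟨m, hmp, hm⟩ := exists_add hx h e he.2 he.1
    have hS : m.S = insert e x.S := by
      rcases hm with hm | ⟨s, hm⟩; exacts [hm.2.2.1, hm.2.2.2.1]
    have hr : m.rk = x.rk + 1 := by
      rcases hm with hm | ⟨s, hm⟩; exacts [hm.rk, hm.rk]
    have : (p.S \ m.S).card = k := by
      rw [hS, Finset.sdiff_insert, Finset.card_erase_of_mem (by simpa using he), hk]; rfl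
    have := ih (by simp [hS]) hmp this
    omega

/-- A move. -/
def Mv (x p : OMc) : Prop := (∃ c, IsSplit x c p) ∨ (∃ e, IsR x e p) ∨ (∃ e s, IsL x e s p)

theorem Mv.le {x p} (h : Mv x p) : x ≤ p := by
  rcases h with ⟨c, h⟩ | ⟨e, h⟩ | ⟨e, s, h⟩ <;> exact h.le
theorem Mv.rk {x p} (h : Mv x p) : p.rk = x.rk + 1 := by
  rcases h with ⟨c, h⟩ | ⟨e, h⟩ | ⟨e, s, h⟩ <;> exact h.rk
theorem Mv.ne {x p} (h : Mv x p) : x.S.Nonempty := by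
  rcases h with ⟨c, h⟩ | ⟨e, h⟩ | ⟨e, s, h⟩
  exacts [⟨_, h.1⟩, h.2.1, ⟨_, h.2.2.1.1⟩]

theorem exists_mv {x p : OMc} (hx : x.S.Nonempty) (h : x < p) : ∃ m ≤ p, Mv x m := by
  by_cases hS : ∃ e ∈ p.S, e ∉ x.S
  · obtain ⟨e, hep, he⟩ := hS
    obtain ⟨m, hm, h1 | ⟨s, h1⟩⟩ := exists_add hx h.le e he hep
    exacts [⟨m, hm, Or.inr (Or.inl ⟨e, h1⟩)⟩, ⟨m, hm, Or.inr (Or.inr ⟨e, s, h1⟩)⟩]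
  · push Not at hS
    have hC := C_sub_of_le h.le hS
    have hS' : x.S = p.S := Finset.Subset.antisymm h.le.1 hS
    have : ∃ c ∈ p.C, c ∉ x.C := by
      by_contra hcon
      push Not at hcon
      exact h.ne (OMc.ext hS' (Finset.Subset.antisymm hC hcon))
    obtain ⟨c, hc, hcx⟩ := this
    obtain ⟨m, hm⟩ := exists_split x c (hS c (p.sub c hc)) hcx
    refine ⟨m, hm.le_of h.le ?_, Or.inl ⟨c, hm⟩⟩
    intro t ht
    exact ⟨c, hc, by unfold inI; omega⟩

theorem S_nonempty_of_le {x p : OMc} (hx : x.S.Nonempty) (h : x ≤ p) : p.S.Nonempty :=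
  hx.mono h.1

theorem rk_lt {x p : OMc} (h : x < p) : x.rk < p.rk := by
  by_cases hx : x.S.Nonempty
  · obtain ⟨m, hm, hmv⟩ := exists_mv hx h
    have := rk_le (S_nonempty_of_le hx hmv.le) hm
    have := hmv.rk
    omega
  · have h0 : x.S = ∅ := by simpa using hx
    have h1 : x.C = ∅ := by
      ext c; simp; intro hc; simpa [h0] using x.sub c hc
    have : p.S.Nonempty := by
      by_contra hp
      have h0' : p.S = ∅ := by simpa using hp
      have h1' : p.C = ∅ := by
        ext c; simp; intro hc; simpa [h0'] using p.sub c hc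
      exact h.ne (OMc.ext (by rw [h0, h0']) (by rw [h1, h1']))
    have := Finset.card_pos.2 this
    simp only [OMc.rk, h0, h1, Finset.card_empty]; omega

theorem Mv.covBy {x p} (h : Mv x p) : x ⋖ p := by
  have := h.rk
  refine ⟨lt_of_le_of_ne h.le (by rintro rfl; omega), fun w h1 h2 => ?_⟩
  have := rk_lt h1
  have := rk_lt h2
  omega

theorem covBy_iff {x p : OMc} (hx : x.S.Nonempty) : x ⋖ p ↔ Mv x p := by
  refine ⟨fun h => ?_, Mv.covBy⟩
  obtain ⟨m, hm, hmv⟩ := exists_mv hx h.lt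
  rcases hm.eq_or_lt with rfl | h'
  · exact hmv
  · exact absurd h' (h.2 hmv.covBy.lt)

def cut (u : OMc) (i j : ℕ) : Prop := ∃ c' ∈ u.C, inI i c' j

theorem cut_mono {u : OMc} {i j i' j' : ℕ} (h : cut u i j) (h' : ∀ k, inI i k j → inI i' k j') :
    cut u i' j' := by
  obtain ⟨c, hc, hi⟩ := h; exact ⟨c, hc, h' c hi⟩

theorem R_cut {x m u : OMc} {e} (h : IsR x e m) (hu : m ≤ u) : e ∈ u.S ∧ ∀ c ∈ x.C, cut u c e :=
  ⟨hu.1 e (by simp [h.2.2.1]), fun c hc => hu.2 c (by simpa [h.2.2.2] using hc) e (by simp [h.2.2.1])⟩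

theorem L_cut {x m u : OMc} {e s} (h : IsL x e s m) (hu : m ≤ u) :
    e ∈ u.S ∧ cut u e e ∧ ∀ t ∈ x.S, cut u e t :=
  ⟨hu.1 e (by simp [h.2.2.2.1]), hu.2 e (by simp [h.2.2.2.2]) e (by simp [h.2.2.2.1]),
    fun t ht => hu.2 e (by simp [h.2.2.2.2]) t (by simp [h.2.2.2.1, ht])⟩

theorem Split_cut {x m u : OMc} {c} (h : IsSplit x c m) (hu : m ≤ u) :
    ∀ t ∈ x.S, cut u c t :=
  fun t ht => hu.2 c (by simp [h.2.2.2]) t (by simpa [h.2.2.1] using ht)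

theorem R_le {x m u : OMc} {e} (hm : IsR x e m) (h : x ≤ u) (he : e ∈ u.S)
    (hc : ∀ c ∈ x.C, cut u c e) : m ≤ u := by
  refine ⟨?_, ?_⟩ <;> simp only [hm.2.2.1, hm.2.2.2, Finset.mem_insert]
  · rintro t (rfl | ht); exacts [he, h.1 t ht]
  · rintro c hc' t (rfl | ht)
    · exact hc c hc'
    · exact h.2 c hc' t ht

theorem R_le' {x m u : OMc} {e s} (hm : IsR x e m) (h : x ≤ u) (he : e ∈ u.S) (hs : Prev x.S s e)
    (hc : s ∈ x.C → cut u s e) : m ≤ u := by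
  refine R_le hm h he fun c hcx => ?_
  by_cases hcs : c = s
  · subst hcs; exact hc hcx
  · refine cut_mono (h.2 c hcx s hs.1) fun k hk => ?_
    have := hs.2 c (x.sub c hcx)
    have : c ≠ e := fun h => hm.1 (h ▸ x.sub c hcx)
    unfold inI at *; omega

theorem L_le' {x m u : OMc} {e s} (hm : IsL x e s m) (h : x ≤ u) (he : e ∈ u.S)
    (hc : ∀ t ∈ x.S, t ≠ s → cut u e t) : m ≤ u := by
  obtain ⟨h1, h2, hs, h4, h5⟩ := hm
  have hse : s ≠ e := fun h => h1 (h ▸ hs.1)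
  refine ⟨?_, ?_⟩ <;> simp only [h4, h5, Finset.mem_insert, Finset.mem_erase]
  · rintro t (rfl | ht); exacts [he, h.1 t ht]
  · rintro c (rfl | hc') t (rfl | ht)
    · obtain ⟨c', hc', -⟩ := h.2 s h2 s hs.1
      exact ⟨c', hc', by unfold inI; omega⟩
    · by_cases hts : t = s
      · subst hts
        obtain ⟨d, hd, hds⟩ := x.two t ht
        refine cut_mono (h.2 d hd t ht) fun k hk => ?_
        have := hs.2 d (x.sub d hd)
        have : d ≠ c := fun h => h1 (h ▸ x.sub d hd)
        unfold inI at *; omega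
      · exact hc t ht hts
    · refine cut_mono (h.2 c hc'.2 s hs.1) fun k hk => ?_
      have := hs.2 c (x.sub c hc'.2)
      have : c ≠ t := fun h => h1 (h ▸ x.sub c hc'.2)
      unfold inI at *; omega
    · exact h.2 c hc'.2 t ht

def Jn (u a b : OMc) : Prop := ∃ z ≤ u, a ⋖ z ∧ b ⋖ z

theorem Jn.symm {u a b : OMc} (h : Jn u a b) : Jn u b a := by
  obtain ⟨z, h1, h2, h3⟩ := h; exact ⟨z, h1, h3, h2⟩

theorem IsSplit.cov {x c p} (h : IsSplit x c p) : x ⋖ p := Mv.covBy (Or.inl ⟨c, h⟩)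
theorem IsR.cov {x c p} (h : IsR x c p) : x ⋖ p := Mv.covBy (Or.inr (Or.inl ⟨c, h⟩))
theorem IsL.cov {x e s p} (h : IsL x e s p) : x ⋖ p := Mv.covBy (Or.inr (Or.inr ⟨e, s, h⟩))

theorem j_split_split {x a b u : OMc} {c d} (ha : IsSplit x c a) (hb : IsSplit x d b) (hab : a ≠ b)
    (hau : a ≤ u) (hbu : b ≤ u) : Jn u a b := by
  have hcd : c ≠ d := by
    rintro rfl
    exact hab (OMc.ext (by rw [ha.2.2.1, hb.2.2.1]) (by rw [ha.2.2.2, hb.2.2.2]))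
  have hc := Split_cut hb hbu
  obtain ⟨a1, a2, a3, a4⟩ := ha
  obtain ⟨b1, b2, b3, b4⟩ := hb
  obtain ⟨z, hz⟩ := exists_split a d (by rwa [a3]) (by simp [a4, b2, hcd.symm])
  refine ⟨z, hz.le_of hau (by rwa [a3]), hz.cov, ?_⟩
  obtain ⟨z1, z2, z3, z4⟩ := hz
  refine IsSplit.cov (c := c) ⟨by rwa [b3], by simp [b4, a2, hcd], by rw [z3, a3, b3], ?_⟩
  rw [z4, a4, b4, Finset.insert_comm]

theorem j_split_R {x a b u : OMc} {c e} (ha : IsSplit x c a) (hb : IsR x e b) 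
    (hau : a ≤ u) (hbu : b ≤ u) : Jn u a b := by
  have hc := Split_cut ha hau
  have hcb := R_cut hb hbu
  obtain ⟨a1, a2, a3, a4⟩ := ha
  obtain ⟨b1, b2, b3, b4⟩ := hb
  obtain ⟨s, hs⟩ := exists_prev x.S b2 e b1
  by_cases hcase : c ≠ s ∨ cut u c e
  · obtain ⟨z, hz⟩ := exists_R a e (by rwa [a3]) (by rwa [a3])
    refine ⟨z, R_le' (s := s) hz hau hcb.1 (by rwa [a3]) ?_, hz.cov, ?_⟩
    · intro h
      simp only [a4, Finset.mem_insert] at h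
      rcases h with h | h
      · rcases hcase with h' | h'
        · exact absurd h.symm h'
        · rwa [h]
      · exact hcb.2 s h
    · obtain ⟨z1, z2, z3, z4⟩ := hz
      exact IsSplit.cov (c := c) ⟨by simp [b3, a1], by rwa [b4], by rw [z3, a3, b3], by rw [z4, a4, b4]⟩
  · push Not at hcase
    obtain ⟨rfl, hncut⟩ := hcase
    obtain ⟨z, hz⟩ := exists_L a e c (by rwa [a3]) (by simp [a4]) (by rwa [a3])
    refine ⟨z, L_le' hz hau hcb.1 ?_, hz.cov, ?_⟩
    · intro t ht htc
      rw [a3] at ht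
      obtain ⟨k, hk, hki⟩ := hc t ht
      refine ⟨k, hk, ?_⟩
      have : ¬ inI c k e := fun h => hncut ⟨k, hk, h⟩
      have := hs.2 t ht
      have : t ≠ e := fun h => b1 (h ▸ ht)
      unfold inI at *; omega
    · obtain ⟨z1, z2, z3, z4, z5⟩ := hz
      refine IsSplit.cov (c := e) ⟨by simp [b3], by rw [b4]; exact fun h => b1 (x.sub e h),
        by rw [z4, a3, b3], ?_⟩
      rw [z5, a4, b4, Finset.erase_insert a2]

theorem j_split_L {x a b u : OMc} {c e s} (ha : IsSplit x c a) (hb : IsL x e s b) 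
    (hau : a ≤ u) (hbu : b ≤ u) : Jn u a b := by
  have hc := Split_cut ha hau
  have hcb := L_cut hb hbu
  obtain ⟨a1, a2, a3, a4⟩ := ha
  obtain ⟨b1, b2, b3, b4, b5⟩ := hb
  obtain ⟨z, hz⟩ := exists_L a e s (by rwa [a3]) (by simp [a4, b2]) (by rwa [a3])
  refine ⟨z, L_le' hz hau hcb.1 (fun t ht _ => hcb.2.2 t (by rwa [a3] at ht)), hz.cov, ?_⟩
  obtain ⟨z1, z2, z3, z4, z5⟩ := hz
  have hce : c ≠ e := fun h => b1 (h ▸ a1)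
  refine IsSplit.cov (c := c) ⟨by simp [b4, a1], by simp [b5, a2, hce], by rw [z4, a3, b4], ?_⟩
  rw [z5, a4, b5]; ext t; simp only [Finset.mem_insert, Finset.mem_erase]; grind

theorem j_R_R {x a b u : OMc} {e f} (ha : IsR x e a) (hb : IsR x f b) (hab : a ≠ b)
    (hau : a ≤ u) (hbu : b ≤ u) : Jn u a b := by
  have hef : e ≠ f := by
    rintro rfl
    exact hab (OMc.ext (by rw [ha.2.2.1, hb.2.2.1]) (by rw [ha.2.2.2, hb.2.2.2]))
  have hcb := R_cut hb hbu
  obtain ⟨a1, a2, a3, a4⟩ := ha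
  obtain ⟨b1, b2, b3, b4⟩ := hb
  obtain ⟨z, hz⟩ := exists_R a f (by simp [a3, b1, hef.symm]) (by simp [a3])
  refine ⟨z, R_le hz hau hcb.1 (by rw [a4]; exact hcb.2), hz.cov, ?_⟩
  obtain ⟨z1, z2, z3, z4⟩ := hz
  refine IsR.cov (c := e) ⟨by simp [b3, a1, hef], by simp [b3], ?_, by rw [z4, a4, b4]⟩
  rw [z3, a3, b3, Finset.insert_comm]

theorem j_R_L_same {x a b u : OMc} {e s} (ha : IsR x e a) (hb : IsL x e s b)
    (hau : a ≤ u) (hbu : b ≤ u) : Jn u a b := by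
  have hcb := L_cut hb hbu
  obtain ⟨a1, a2, a3, a4⟩ := ha
  obtain ⟨b1, b2, b3, b4, b5⟩ := hb
  obtain ⟨z, hz⟩ := exists_split a e (by simp [a3]) (by rw [a4]; exact fun h => b1 (x.sub e h))
  refine ⟨z, hz.le_of hau ?_, hz.cov, ?_⟩
  · intro t ht
    simp only [a3, Finset.mem_insert] at ht
    rcases ht with rfl | ht
    · exact hcb.2.1
    · exact hcb.2.2 t ht
  obtain ⟨z1, z2, z3, z4⟩ := hz
  have hse : s ≠ e := fun h => b1 (h ▸ b3.1)
  refine IsSplit.cov (c := s) ⟨by simp [b4, b3.1], by simp [b5, hse], by rw [z3, a3, b4], ?_⟩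
  rw [z4, a4, b5]; ext t; simp only [Finset.mem_insert, Finset.mem_erase]; grind

theorem j_L_L_ord {x a b u : OMc} {e f s} (ha : IsL x e s a) (hb : IsL x f s b) (hef : e ≠ f)
    (hord : inI s e f) (hau : a ≤ u) (hbu : b ≤ u) : Jn u a b := by
  have hcb := L_cut hb hbu
  obtain ⟨a1, a2, a3, a4, a5⟩ := ha
  obtain ⟨b1, b2, b3, b4, b5⟩ := hb
  have hse : s ≠ e := fun h => a1 (h ▸ b3.1)
  have hsf : s ≠ f := fun h => b1 (h ▸ b3.1)
  obtain ⟨z, hz⟩ := exists_L a f e (by simp [a4, b1, hef.symm]) (by simp [a5]) (by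
    refine ⟨by simp [a4], fun t ht hi => ?_⟩
    simp only [a4, Finset.mem_insert] at ht
    rcases ht with rfl | ht
    · rfl
    · have := a3.2 t ht
      have := b3.2 t ht
      exfalso
      unfold inI at *; omega)
  refine ⟨z, L_le' hz hau hcb.1 ?_, hz.cov, ?_⟩
  · intro t ht hte
    simp only [a4, Finset.mem_insert] at ht
    exact hcb.2.2 t (by tauto)
  obtain ⟨z1, z2, z3, z4, z5⟩ := hz
  refine IsR.cov (c := e) ⟨by simp [b4, a1, hef], by simp [b4], by rw [z4, a4, b4, Finset.insert_comm], ?_⟩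
  rw [z5, a5, b5, Finset.erase_insert (by simp; intro _ h; exact a1 (x.sub e h))]

theorem prev_unique {S : Finset ℕ} {s s' e : ℕ} (he : e ∉ S) (h : Prev S s e) (h' : Prev S s' e) :
    s = s' := by
  have := h.2 s' h'.1
  have := h'.2 s h.1
  have : s ≠ e := fun hh => he (hh ▸ h.1)
  have : s' ≠ e := fun hh => he (hh ▸ h'.1)
  unfold inI at *; omega

theorem prev_insert {S : Finset ℕ} {s s' e f : ℕ} (he : e ∉ S) (hf : f ∉ S)
    (h : Prev S s e) (h' : Prev S s' f) (hs : s ≠ s') (hef : e ≠ f) : Prev (insert e S) s' f := by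
  refine ⟨by simp [h'.1], fun t ht hi => ?_⟩
  simp only [Finset.mem_insert] at ht
  rcases ht with rfl | ht
  · exfalso
    have := h.2 s' h'.1
    have := h'.2 s h.1
    have : s ≠ t := fun hh => he (hh ▸ h.1)
    have : s' ≠ t := fun hh => he (hh ▸ h'.1)
    have : s ≠ f := fun hh => hf (hh ▸ h.1)
    have : s' ≠ f := fun hh => hf (hh ▸ h'.1)
    unfold inI at *; omega
  · exact h'.2 t ht hi

theorem j_L_L {x a b u : OMc} {e f s s'} (ha : IsL x e s a) (hb : IsL x f s' b) (hab : a ≠ b)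
    (hau : a ≤ u) (hbu : b ≤ u) : Jn u a b := by
  have hef : e ≠ f := by
    rintro rfl
    have := prev_unique ha.1 ha.2.2.1 hb.2.2.1
    subst this
    exact hab (OMc.ext (by rw [ha.2.2.2.1, hb.2.2.2.1]) (by rw [ha.2.2.2.2, hb.2.2.2.2]))
  by_cases hss : s = s'
  · subst hss
    by_cases hord : inI s e f
    · exact j_L_L_ord ha hb hef hord hau hbu
    · refine (j_L_L_ord hb ha hef.symm ?_ hbu hau).symm
      have hse : s ≠ e := fun h => ha.1 (h ▸ ha.2.2.1.1)
      have hsf : s ≠ f := fun h => hb.1 (h ▸ ha.2.2.1.1)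
      unfold inI at *; omega
  have hcb := L_cut hb hbu
  obtain ⟨a1, a2, a3, a4, a5⟩ := ha
  obtain ⟨b1, b2, b3, b4, b5⟩ := hb
  have hp := prev_insert a1 b1 a3 b3 hss hef
  have hp' := prev_insert b1 a1 b3 a3 (Ne.symm hss) hef.symm
  have hse : s ≠ e := fun h => a1 (h ▸ a3.1)
  have hsf : s ≠ f := fun h => b1 (h ▸ a3.1)
  have hse' : s' ≠ e := fun h => a1 (h ▸ b3.1)
  have hsf' : s' ≠ f := fun h => b1 (h ▸ b3.1)
  obtain ⟨z, hz⟩ := exists_L a f s' (by simp [a4, b1, hef.symm]) (by simp [a5, b2, Ne.symm hss]) (by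
    rw [a4]; exact hp)
  refine ⟨z, L_le' hz hau hcb.1 ?_, hz.cov, ?_⟩
  · intro t ht hte
    simp only [a4, Finset.mem_insert] at ht
    rcases ht with rfl | ht
    · refine cut_mono (hcb.2.2 s a3.1) fun k hk => ?_
      have := hp'.2 f (by simp)
      unfold inI at *; omega
    · exact hcb.2.2 t ht
  obtain ⟨z1, z2, z3, z4, z5⟩ := hz
  refine IsL.cov (e := e) (s := s) ⟨by simp [b4, a1, hef], by simp [b5, a2, hss], by rwa [b4], 
    by rw [z4, a4, b4, Finset.insert_comm], ?_⟩
  rw [z5, a5, b5]; ext t; simp only [Finset.mem_insert, Finset.mem_erase]; grind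

def DD (x p q : OMc) : Prop := ∃ e s, IsL x e s p ∧ IsR x e q

theorem j_L_R {x a b u : OMc} {e f s} (ha : IsL x e s a) (hb : IsR x f b) 
    (hau : a ≤ u) (hbu : b ≤ u) : Jn u a b ∨ ∃ k ≤ u, DD x k b ∧ Jn u k a ∧ Jn u k b := by
  by_cases hef : e = f
  · subst hef; exact Or.inl (j_R_L_same hb ha hbu hau).symm
  have hca := L_cut ha hau
  have hcb := R_cut hb hbu
  have ha' := ha
  have hb' := hb
  obtain ⟨a1, a2, a3, a4, a5⟩ := ha
  obtain ⟨b1, b2, b3, b4⟩ := hb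
  have hse : s ≠ e := fun h => a1 (h ▸ a3.1)
  have hsf : s ≠ f := fun h => b1 (h ▸ a3.1)
  obtain ⟨s', hs'⟩ := exists_prev x.S b2 f b1
  by_cases hss : s = s'
  · subst hss
    by_cases hcase : inI s e f ∧ cut u e f
    · left
      obtain ⟨z, hz⟩ := exists_R a f (by simp [a4, b1, Ne.symm hef]) (by simp [a4])
      refine ⟨z, R_le' (s := e) hz hau hcb.1 ?_ (fun _ => hcase.2), hz.cov, ?_⟩
      · refine ⟨by simp [a4], fun t ht hi => ?_⟩
        simp only [a4, Finset.mem_insert] at ht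
        rcases ht with rfl | ht
        · rfl
        · have := a3.2 t ht
          have := hs'.2 t ht
          have := hcase.1
          exfalso
          unfold inI at *; omega
      · obtain ⟨z1, z2, z3, z4⟩ := hz
        refine IsL.cov (e := e) (s := s) ⟨by simp [b3, a1, hef], by rwa [b4], ?_, 
          by rw [z3, a4, b3, Finset.insert_comm], by rw [z4, a5, b4]⟩
        refine ⟨by simp [b3, a3.1], fun t ht hi => ?_⟩
        simp only [b3, Finset.mem_insert] at ht
        rcases ht with rfl | ht
        · have := hcase.1
          exfalso
          unfold inI at *; omega
        · exact a3.2 t ht hi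
    · right
      obtain ⟨k, hk⟩ := exists_L x f s b1 a2 hs'
      have hku : k ≤ u := by
        refine L_le' hk (ha'.le.trans hau) hcb.1 fun t ht hts => ?_
        obtain ⟨c, hc, hi⟩ := hca.2.2 t ht
        refine ⟨c, hc, ?_⟩
        have h1 : ¬ (inI s e f ∧ inI e c f) := fun h => hcase ⟨h.1, c, hc, h.2⟩
        have := a3.2 t ht
        have := hs'.2 t ht
        have : t ≠ e := fun h => a1 (h ▸ ht)
        have : t ≠ f := fun h => b1 (h ▸ ht)
        unfold inI at *; omega
      have hne : k ≠ a := by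
        rintro rfl
        have : e ∈ k.S := by simp [a4]
        rw [hk.2.2.2.1] at this
        simp at this; tauto
      exact ⟨k, hku, ⟨f, s, hk, hb'⟩, j_L_L hk ha' hne hku hau, (j_R_L_same hb' hk hbu hku).symm⟩
  · left
    have hp := prev_insert a1 b1 a3 hs' hss hef
    have hp' := prev_insert b1 a1 hs' a3 (Ne.symm hss) (Ne.symm hef)
    obtain ⟨z, hz⟩ := exists_R a f (by simp [a4, b1, Ne.symm hef]) (by simp [a4])
    refine ⟨z, R_le' (s := s') hz hau hcb.1 (by rwa [a4]) ?_, hz.cov, ?_⟩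
    · intro h
      simp only [a5, Finset.mem_insert, Finset.mem_erase] at h
      rcases h with h | h
      · exact absurd hs'.1 (h ▸ a1)
      · exact hcb.2 s' h.2
    · obtain ⟨z1, z2, z3, z4⟩ := hz
      exact IsL.cov (e := e) (s := s) ⟨by simp [b3, a1, hef], by rwa [b4], by rwa [b3], 
          by rw [z3, a4, b3, Finset.insert_comm], by rw [z4, a5, b4]⟩

theorem H1 {x a b u : OMc} (hx : x.S.Nonempty) (ha : x ⋖ a) (hb : x ⋖ b) (hab : a ≠ b)
    (hau : a ≤ u) (hbu : b ≤ u) :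
    Jn u a b ∨ ∃ k ≤ u, (DD x k a ∨ DD x k b) ∧ Jn u k a ∧ Jn u k b := by
  rcases (covBy_iff hx).1 ha with ⟨c, ha⟩ | ⟨e, ha⟩ | ⟨e, s, ha⟩ <;>
  rcases (covBy_iff hx).1 hb with ⟨d, hb⟩ | ⟨f, hb⟩ | ⟨f, s', hb⟩
  · exact Or.inl (j_split_split ha hb hab hau hbu)
  · exact Or.inl (j_split_R ha hb hau hbu)
  · exact Or.inl (j_split_L ha hb hau hbu)
  · exact Or.inl (j_split_R hb ha hbu hau).symm
  · exact Or.inl (j_R_R ha hb hab hau hbu)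
  · rcases j_L_R hb ha hbu hau with h | ⟨k, h1, h2, h3, h4⟩
    · exact Or.inl h.symm
    · exact Or.inr ⟨k, h1, Or.inl h2, h4, h3⟩
  · exact Or.inl (j_split_L hb ha hbu hau).symm
  · rcases j_L_R ha hb hau hbu with h | ⟨k, h1, h2, h3, h4⟩
    · exact Or.inl h
    · exact Or.inr ⟨k, h1, Or.inr h2, h3, h4⟩
  · exact Or.inl (j_L_L ha hb hab hau hbu)

theorem Prev.of_insert {S : Finset ℕ} {s e f} (h : Prev (insert e S) s f) (hs : s ∈ S) : Prev S s f :=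
  ⟨hs, fun t ht hi => h.2 t (by simp [ht]) hi⟩

/-- The key computation for `H2`. -/
theorem H2_aux {x a p : OMc} {f s} (hx : x.S.Nonempty) (ha : x ⋖ a) (hp : IsL a f s p) :
    ∃ a'', a'' ⋖ p ∧ ((∃ s', IsL x f s' a'') ∨ 
      (IsR x f a'' ∧ ∀ s', Prev x.S s' f → s' ∉ x.C)) := by
  have hfx : f ∉ x.S := fun h => hp.1 (ha.le.1 f h)
  obtain ⟨p1, p2, p3, p4, p5⟩ := hp
  rcases (covBy_iff hx).1 ha with ⟨c, ha⟩ | ⟨e, ha⟩ | ⟨e, s0, ha⟩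
  · obtain ⟨a1, a2, a3, a4⟩ := ha
    rw [a3] at p3
    by_cases hs : s ∈ x.C
    · obtain ⟨a'', h⟩ := exists_L x f s hfx hs p3
      refine ⟨a'', ?_, Or.inl ⟨s, h⟩⟩
      obtain ⟨h1, h2, h3, h4, h5⟩ := h
      have : c ≠ f := fun h => hfx (h ▸ a1)
      refine IsSplit.cov (c := c) ⟨by simp [h4, a1], by simp [h5, a2, this], by rw [p4, h4, a3], ?_⟩
      rw [p5, a4, h5]; ext t; simp only [Finset.mem_insert, Finset.mem_erase]; grind
    · have hsc : s = c := by simpa [a4, hs] using p2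
      subst hsc
      obtain ⟨a'', h⟩ := exists_R x f hfx hx
      refine ⟨a'', ?_, Or.inr ⟨h, fun s' hs' => prev_unique hfx p3 hs' ▸ hs⟩⟩
      obtain ⟨h1, h2, h3, h4⟩ := h
      refine IsSplit.cov (c := f) ⟨by simp [h3], by rw [h4]; exact fun h => hfx (x.sub f h), 
        by rw [p4, h3, a3], ?_⟩
      rw [p5, a4, h4, Finset.erase_insert a2]
  · obtain ⟨a1, a2, a3, a4⟩ := ha
    rw [a4] at p2
    rw [a3] at p3 p1
    have hp3 := p3.of_insert (x.sub s p2)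
    obtain ⟨a'', h⟩ := exists_L x f s hfx p2 hp3
    refine ⟨a'', ?_, Or.inl ⟨s, h⟩⟩
    obtain ⟨h1, h2, h3, h4, h5⟩ := h
    have : e ≠ f := by rintro rfl; simp at p1
    exact IsR.cov (c := e) ⟨by simp [h4, a1, this], by simp [h4], 
      by rw [p4, h4, a3, Finset.insert_comm], by rw [p5, h5, a4]⟩
  · obtain ⟨a1, a2, a3, a4, a5⟩ := ha
    rw [a5] at p2
    rw [a4] at p3 p1
    have hef : e ≠ f := by rintro rfl; simp at p1
    by_cases hse : s = e
    · subst hse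
      have hp3 : Prev x.S s0 f := by
        refine ⟨a3.1, fun t ht hi => ?_⟩
        by_contra hne
        have := a3.2 t ht
        have := p3.2 t (by simp [ht])
        have := a3.2 s0 a3.1
        have := p3.2 s0 (by simp [a3.1])
        have : t ≠ s := fun h => a1 (h ▸ ht)
        have : s0 ≠ s := fun h => a1 (h ▸ a3.1)
        have : s0 ≠ f := fun h => hfx (h ▸ a3.1)
        have : t ≠ f := fun h => hfx (h ▸ ht)
        unfold inI at *; omega
      obtain ⟨a'', h⟩ := exists_L x f s0 hfx a2 hp3
      refine ⟨a'', ?_, Or.inl ⟨s0, h⟩⟩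
      obtain ⟨h1, h2, h3, h4, h5⟩ := h
      refine IsR.cov (c := s) ⟨by simp [h4, a1, hef], by simp [h4], 
        by rw [p4, h4, a4, Finset.insert_comm], ?_⟩
      rw [p5, h5, a5, Finset.erase_insert (by simp; intro _ h; exact a1 (x.sub s h))]
    · have hsC : s ≠ s0 ∧ s ∈ x.C := by simpa [hse] using p2
      have hp3 := p3.of_insert (x.sub s hsC.2)
      obtain ⟨a'', h⟩ := exists_L x f s hfx hsC.2 hp3
      refine ⟨a'', ?_, Or.inl ⟨s, h⟩⟩
      obtain ⟨h1, h2, h3, h4, h5⟩ := h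
      have hp' := prev_insert hfx a1 hp3 a3 hsC.1 hef.symm
      refine IsL.cov (e := e) (s := s0) ⟨by simp [h4, a1, hef], by simp [h5, a2, hsC.1.symm], 
        by rwa [h4], by rw [p4, h4, a4, Finset.insert_comm], ?_⟩
      have : s0 ≠ f := fun h => hfx (h ▸ a3.1)
      rw [p5, h5, a5]; ext t; simp only [Finset.mem_insert, Finset.mem_erase]; grind

theorem H2 {x a p q a' : OMc} (hx : x.S.Nonempty) (ha : x ⋖ a) (hD : DD a p q) (ha' : x ⋖ a')
    (haq : a' ⋖ q) (hne : a' ≠ a) : ∃ a'', a'' ⋖ p ∧ (a'' = a' ∨ DD x a'' a') := by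
  obtain ⟨f, s, hp, hq⟩ := hD
  have hfx : f ∉ x.S := fun h => hp.1 (ha.le.1 f h)
  have hf : f ∈ a'.S := by
    by_contra hf
    have hle : a' ≤ a := by
      refine ⟨fun t ht => ?_, fun c hc t ht => ?_⟩
      · have := haq.le.1 t ht
        simp only [hq.2.2.1, Finset.mem_insert] at this
        rcases this with rfl | h
        exacts [absurd ht hf, h]
      · have := haq.le.2 c hc t ht
        rwa [hq.2.2.2] at this
    rcases hle.eq_or_lt with h | h
    · exact hne h
    · exact ha.2 ha'.lt h
  obtain ⟨a'', h1, h2⟩ := H2_aux hx ha hp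
  refine ⟨a'', h1, ?_⟩
  rcases (covBy_iff hx).1 ha' with ⟨c, h⟩ | ⟨e, h⟩ | ⟨e, s0, h⟩
  · rw [h.2.2.1] at hf; exact absurd hf hfx
  · have : f = e := by
      rw [h.2.2.1, Finset.mem_insert] at hf; tauto
    subst this
    rcases h2 with ⟨s', h2⟩ | ⟨h2, -⟩
    · exact Or.inr ⟨f, s', h2, h⟩
    · exact Or.inl (OMc.ext (by rw [h2.2.2.1, h.2.2.1]) (by rw [h2.2.2.2, h.2.2.2]))
  · have : f = e := by
      rw [h.2.2.2.1, Finset.mem_insert] at hf; tauto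
    subst this
    rcases h2 with ⟨s', h2⟩ | ⟨h2, h3⟩
    · have := prev_unique hfx h.2.2.1 h2.2.2.1
      subst this
      exact Or.inl (OMc.ext (by rw [h2.2.2.2.1, h.2.2.2.1]) (by rw [h2.2.2.2.2, h.2.2.2.2]))
    · exact absurd h.2.1 (h3 _ h.2.2.1)

theorem DD.cov {x p q} (h : DD x p q) : x ⋖ p := by
  obtain ⟨e, s, h, -⟩ := h; exact h.cov

theorem DD.not_right {x p q r} (h : DD x p q) : ¬ DD x r p := by
  rintro ⟨f, s', -, h3⟩
  obtain ⟨e, s, h1, -⟩ := h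
  have h4 : e ∈ x.C := by rw [← h3.2.2.2, h1.2.2.2.2]; simp
  exact h1.1 (x.sub e h4)

theorem enum_exists (T : Set OMc) (hT : T.Finite) (key : OMc → ℕ) :
    ∃ (t : ℕ) (a : Fin t → OMc), Function.Injective a ∧ (∀ p, (∃ i, a i = p) ↔ p ∈ T) ∧
      Monotone (key ∘ a) := by
  have := hT.fintype
  let e := Fintype.equivFin T
  let f : Fin (Fintype.card T) → OMc := fun i => (e.symm i : OMc)
  have hf : Function.Injective f := fun i j h => e.symm.injective (Subtype.ext h)
  refine ⟨Fintype.card T, f ∘ Tuple.sort (key ∘ f), hf.comp (Equiv.injective _), ?_, ?_⟩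
  · intro p
    constructor
    · rintro ⟨i, rfl⟩; exact (e.symm _).2
    · intro hp
      exact ⟨(Tuple.sort (key ∘ f)).symm (e ⟨p, hp⟩), by simp [f]⟩
  · exact Tuple.monotone_sort (key ∘ f)

theorem lower_init {s : ℕ} (Q : Fin s → Prop) (h : ∀ i j, i ≤ j → Q j → Q i) :
    ∃ m : ℕ, ∀ q, Q q ↔ (q : ℕ) < m := by
  classical
  by_cases hQ : ∃ m, ∃ hm : m < s, ¬ Q ⟨m, hm⟩
  · refine ⟨Nat.find hQ, fun q => ⟨fun hq => ?_, fun hq => ?_⟩⟩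
    · by_contra hlt
      obtain ⟨hm, hn⟩ := Nat.find_spec hQ
      exact hn (h _ q (by rw [Fin.le_def]; simp at hlt ⊢; exact hlt) hq)
    · by_contra hn
      exact Nat.find_min hQ hq ⟨q.2, hn⟩
  · push Not at hQ
    exact ⟨s, fun q => ⟨fun _ => q.2, fun _ => hQ q q.2⟩⟩

theorem finite_Iic (y : OMc) : {p : OMc | p ≤ y}.Finite := by
  apply Set.Finite.of_finite_image (f := fun p : OMc => (p.S, p.C))
  · apply Set.Finite.subset (Finset.finite_toSet (y.S.powerset ×ˢ y.S.powerset))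
    rintro _ ⟨p, hp, rfl⟩
    simp only [Finset.coe_product, Set.mem_prod, Finset.mem_coe, Finset.mem_powerset]
    exact ⟨hp.1, fun c hc => hp.1 _ (p.sub c hc)⟩
  · intro p _ q _ h
    simp only [Prod.mk.injEq] at h
    exact OMc.ext h.1 h.2

theorem claim (N : ℕ) : ∀ (x y : OMc) (F : OMc → Prop), x.S.Nonempty → x < y → y.rk ≤ x.rk + N →
    (∀ p q, DD x p q → p ≤ y → F q → F p) →
    ∃ t, ∃ b : Fin t → OMc, RAOFuel N x y t b ∧ ∃ m : ℕ, ∀ q, F (b q) ↔ (q : ℕ) < m := by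
  classical
  induction N with
  | zero =>
    intro x y F hx hxy hr
    have := rk_lt hxy
    omega
  | succ N ih =>
    intro x y F hx hxy hr hF
    let key : OMc → ℕ := fun p => (if F p then 0 else 2) + (if ∃ r ≤ y, DD x r p then 1 else 0)
    obtain ⟨t, a, hinj, hmem, hmono⟩ := enum_exists {p | x ⋖ p ∧ p ≤ y}
      ((finite_Iic y).subset (fun p hp => hp.2)) key
    have hcov : ∀ i, x ⋖ a i := fun i => ((hmem _).1 ⟨i, rfl⟩).1
    have hley : ∀ i, a i ≤ y := fun i => ((hmem _).1 ⟨i, rfl⟩).2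
    have hlt : ∀ i j, key (a i) < key (a j) → i < j := by
      intro i j h
      by_contra hn
      have := hmono (not_lt.1 hn)
      simp at this; omega
    have hDD : ∀ p q, DD x p q → p ≤ y → key p < key q := by
      intro p q h hp
      have h1 : ¬ ∃ r ≤ y, DD x r p := fun ⟨r, _, hr⟩ => h.not_right hr
      have h2 : ∃ r ≤ y, DD x r q := ⟨p, hp, h⟩
      have h3 := hF p q h hp
      simp only [key, h1, h2, if_true, if_false]
      by_cases hq : F q
      · simp [hq, h3 hq]
      · simp only [hq, if_false]; split_ifs <;> omega
    refine ⟨t, a, ⟨hmem, hinj, fun hnc => ⟨fun j => ?_, ?_⟩⟩, ?_⟩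
    · have hne : a j < y := lt_of_le_of_ne (hley j) (fun h => hnc (h ▸ hcov j))
      have hrk := rk_lt (hcov j).lt
      refine ih (a j) y (fun b => ∃ i, i < j ∧ a i ⋖ b) (S_nonempty_of_le hx (hcov j).le) hne
        (by omega) ?_
      rintro p q hD hp ⟨i, hij, hi⟩
      obtain ⟨a'', h1, h2⟩ := H2 hx (hcov j) hD (hcov i) hi (fun h => hij.ne (hinj h))
      rcases h2 with rfl | h2
      · exact ⟨i, hij, h1⟩
      · have hle : a'' ≤ y := h1.le.trans hp
        obtain ⟨k, hk⟩ := (hmem a'').2 ⟨h2.cov, hle⟩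
        have := hlt k i (by rw [hk]; exact hDD _ _ h2 hle)
        exact ⟨k, this.trans hij, hk ▸ h1⟩
    · intro i j hij u hu hi hj
      rcases H1 hx (hcov i) (hcov j) (fun h => hij.ne (hinj h)) hi.le hj.le with h | ⟨k, hk, h1, h2, h3⟩
      · obtain ⟨z, hz, h1, h2⟩ := h
        exact ⟨i, hij, z, hz, h1, h2⟩
      · have hkx : x ⋖ k := by rcases h1 with h1 | h1 <;> exact h1.cov
        obtain ⟨l, hl⟩ := (hmem k).2 ⟨hkx, hk.trans hu⟩
        obtain ⟨z, hz, hz1, hz2⟩ := h3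
        refine ⟨l, ?_, z, hz, hl ▸ hz1, hz2⟩
        rcases h1 with h1 | h1
        · exact (hlt l i (by rw [hl]; exact hDD _ _ h1 (hk.trans hu))).trans hij
        · exact hlt l j (by rw [hl]; exact hDD _ _ h1 (hk.trans hu))
    · apply lower_init
      intro i j hij hj
      have := hmono hij
      by_contra hi
      simp only [Function.comp, key, hi, hj, if_true, if_false] at this
      split_ifs at this <;> omega

def botO : OMc := ⟨∅, ∅, by simp, by simp⟩

theorem botO_le (y : OMc) : botO ≤ y := ⟨by simp [botO], by simp [botO]⟩

def IsPair (p : OMc) (i j : ℕ) : Prop := i ≠ j ∧ p.S = {i, j} ∧ p.C = {i, j}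

theorem IsPair.symm {p i j} (h : IsPair p i j) : IsPair p j i :=
  ⟨h.1.symm, by rw [h.2.1, Finset.pair_comm], by rw [h.2.2, Finset.pair_comm]⟩

theorem exists_pair {i j : ℕ} (h : i ≠ j) : ∃ p, IsPair p i j :=
  ⟨⟨{i, j}, {i, j}, fun c hc => hc, by
    intro s hs; simp at hs ⊢; grind⟩, h, rfl, rfl⟩

theorem pair_le {p u : OMc} {i j} (h : IsPair p i j) :
    p ≤ u ↔ i ∈ u.S ∧ j ∈ u.S ∧ cut u i j ∧ cut u j i := by
  obtain ⟨h1, h2, h3⟩ := h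
  rw [le_iff', h2, h3]
  constructor
  · rintro ⟨a, b⟩
    exact ⟨a i (by simp), a j (by simp), b i (by simp) j (by simp), b j (by simp) i (by simp)⟩
  · rintro ⟨a, b, c, d⟩
    refine ⟨by simp [a, b], ?_⟩
    obtain ⟨k, hk, _⟩ := id c
    have h5 : ∀ i, cut u i i := fun i => ⟨k, hk, by unfold inI; omega⟩
    intro c' hc' s hs
    simp at hc' hs
    rcases hc' with rfl | rfl <;> rcases hs with rfl | rfl <;> first | assumption | apply h5

theorem S_nonempty_of_ne {z : OMc} (h : botO < z) : z.S.Nonempty := by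
  by_contra hn
  rw [Finset.not_nonempty_iff_eq_empty] at hn
  have : z.C = ∅ := by
    apply Finset.eq_empty_of_forall_notMem
    intro c hc; have := z.sub c hc; simp [hn] at this
  exact h.ne (OMc.ext (by simp [botO, hn]) (by simp [botO, this]))

theorem bot_cov {p : OMc} : botO ⋖ p ↔ ∃ i j, IsPair p i j := by
  constructor
  · intro h
    obtain ⟨s, hs⟩ := S_nonempty_of_ne h.lt
    obtain ⟨c, hc, _⟩ := p.two s hs
    obtain ⟨d, hd, hdc⟩ := p.two c (p.sub c hc)
    obtain ⟨w, hw⟩ := exists_pair hdc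
    have hle : w ≤ p := (pair_le hw).2 ⟨p.sub d hd, p.sub c hc, ⟨d, hd, by unfold inI; omega⟩,
      ⟨c, hc, by unfold inI; omega⟩⟩
    have hb : botO < w := lt_of_le_of_ne (botO_le w) (by
      intro h'
      have := hw.2.1
      rw [← h'] at this
      have h3 : d ∈ botO.S := by rw [this]; simp
      simp [botO] at h3)
    have : w = p := by
      by_contra hne
      exact h.2 hb (lt_of_le_of_ne hle hne)
    exact ⟨d, c, this ▸ hw⟩
  · rintro ⟨i, j, h⟩
    refine ⟨lt_of_le_of_ne (botO_le p) ?_, ?_⟩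
    · intro h'
      have := h.2.1
      rw [← h'] at this
      have h3 : i ∈ botO.S := by rw [this]; simp
      simp [botO] at h3
    · intro z hz hzp
      obtain ⟨s, hs⟩ := S_nonempty_of_ne hz
      obtain ⟨c, hc, _⟩ := z.two s hs
      obtain ⟨d, hd, hdc⟩ := z.two c (z.sub c hc)
      have hS : ∀ s ∈ z.S, s = i ∨ s = j := by
        intro s hs
        have := hzp.le.1 s hs
        rw [h.2.1] at this; simpa using this
      have h1 := hS c (z.sub c hc)
      have h2 := hS d (z.sub d hd)
      have hiC : i ∈ z.C ∧ j ∈ z.C := by grind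
      have hi := z.sub i hiC.1
      have hj := z.sub j hiC.2
      apply hzp.ne
      apply OMc.ext
      · rw [h.2.1]; ext k; simp; grind
      · rw [h.2.2]; ext k; have := z.sub k; simp; grind

theorem share {P Q u : OMc} {a b c : ℕ} (hP : IsPair P a b) (hQ : IsPair Q a c) (hbc : b ≠ c)
    (h : inI a b c) (hPu : P ≤ u) (hQu : Q ≤ u) : Jn u P Q := by
  have h1 := hP.1
  have h2 := hQ.1
  have hbS : b ∉ Q.S := by rw [hQ.2.1]; simp; grind
  have hcS : c ∉ P.S := by rw [hP.2.1]; simp; grind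
  obtain ⟨z, hz⟩ := exists_R Q b hbS ⟨a, by rw [hQ.2.1]; simp⟩
  have hpb := (pair_le hP).1 hPu
  have hprev : Prev Q.S a b := ⟨by rw [hQ.2.1]; simp, by
    rw [hQ.2.1]; intro t ht hi; simp at ht; rcases ht with rfl | rfl
    · rfl
    · unfold inI at *; omega⟩
  have hprev' : Prev P.S b c := ⟨by rw [hP.2.1]; simp, by
    rw [hP.2.1]; intro t ht hi; simp at ht; rcases ht with rfl | rfl
    · unfold inI at *; omega
    · rfl⟩
  have hzL : IsL P c b z := by
    refine ⟨hcS, by rw [hP.2.2]; simp, hprev', ?_, ?_⟩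
    · rw [hz.2.2.1, hP.2.1, hQ.2.1]; ext k; simp; grind
    · rw [hz.2.2.2, hP.2.2, hQ.2.2]; ext k; simp; grind
  refine ⟨z, R_le' hz hQu hpb.2.1 hprev (fun _ => hpb.2.2.1), hzL.cov, hz.cov⟩

theorem share' {P Q u : OMc} {a b c : ℕ} (hP : IsPair P a b) (hQ : IsPair Q a c) (hbc : b ≠ c)
    (hPu : P ≤ u) (hQu : Q ≤ u) : Jn u P Q := by
  by_cases h : inI a b c
  · exact share hP hQ hbc h hPu hQu
  · refine (share hQ hP hbc.symm ?_ hQu hPu).symm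
    have := hP.1; have := hQ.1
    unfold inI at *; omega

def pkey (N : ℕ) (p : OMc) : ℕ := (N - p.S.sup (N - ·)) * (N + 1) + (N - p.S.sup id)

theorem pkey_eq {N : ℕ} {p : OMc} {i j} (h : IsPair p i j) (hij : i < j) (hj : j ≤ N) :
    pkey N p = i * (N + 1) + (N - j) := by
  unfold pkey
  rw [h.2.1]
  simp only [Finset.sup_insert, Finset.sup_singleton, id]
  have e1 : N - max (N - i) (N - j) = i := by omega
  have e2 : max i j = j := by omega
  change (N - max (N - i) (N - j)) * (N+1) + (N - max i j) = _
  rw [e1, e2]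

theorem key_le {N i j i' j' : ℕ} (h : i * (N + 1) + (N - j) ≤ i' * (N + 1) + (N - j'))
   (hj : j ≤ N) (hj' : j' ≤ N) : i < i' ∨ (i = i' ∧ j' ≤ j) := by
  rcases lt_trichotomy i i' with h1 | rfl | h1
  · exact Or.inl h1
  · right; omega
  · exfalso
    have : (i' + 1) * (N + 1) ≤ i * (N + 1) := Nat.mul_le_mul_right _ h1
    have e : (i' + 1) * (N + 1) = i' * (N + 1) + (N + 1) := by ring
    omega

theorem key_lt {N i j i' j' : ℕ} (hj : j ≤ N) (hj' : j' ≤ N) (h : i < i' ∨ (i = i' ∧ j' < j)) :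
    i * (N + 1) + (N - j) < i' * (N + 1) + (N - j') := by
  by_contra hn
  have := key_le (not_lt.1 hn) hj' hj
  omega

theorem pkey_le {N : ℕ} {p q : OMc} {i j i' j'} (h : IsPair p i j) (h' : IsPair q i' j')
    (hi : i ≤ N) (hj : j ≤ N) (hi' : i' ≤ N) (hj' : j' ≤ N) :
    pkey N p ≤ pkey N q ↔ min i j < min i' j' ∨ (min i j = min i' j' ∧ max i' j' ≤ max i j) := by
  have key : ∀ {p : OMc} {i j}, IsPair p i j → i ≤ N → j ≤ N →
      pkey N p = (min i j) * (N + 1) + (N - max i j) := by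
    intro p i j h hi hj
    rcases lt_or_gt_of_ne h.1 with h1 | h1
    · rw [pkey_eq h h1 hj]; rw [min_eq_left h1.le, max_eq_right h1.le]
    · rw [pkey_eq h.symm h1 hi]; rw [min_eq_right h1.le, max_eq_left h1.le]
  rw [key h hi hj, key h' hi' hj']
  constructor
  · intro h; exact key_le h (by omega) (by omega)
  · intro h
    by_contra hn
    have := key_le (not_le.1 hn).le (by omega) (by omega)
    have h3 : min i j = min i' j' ∧ max i' j' = max i j := by omega
    rw [h3.1, h3.2] at hn; omega

theorem bottom_rao (y : OMc) : ∃ t, ∃ a : Fin t → OMc, RAOFuel (y.rk + 1) botO y t a := by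
  let N := y.S.sup id
  have hN : ∀ s ∈ y.S, s ≤ N := fun s hs => Finset.le_sup (f := id) hs
  obtain ⟨t, a, hinj, hmem, hmono⟩ := enum_exists {p | botO ⋖ p ∧ p ≤ y}
    ((finite_Iic y).subset (fun p hp => hp.2)) (pkey N)
  have hpair : ∀ i, ∃ k l, IsPair (a i) k l := fun i => bot_cov.1 ((hmem _).1 ⟨i, rfl⟩).1
  have hley : ∀ i, a i ≤ y := fun i => ((hmem _).1 ⟨i, rfl⟩).2
  have hlt : ∀ i j, pkey N (a i) < pkey N (a j) → i < j := by
    intro i j h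
    by_contra hn
    have := hmono (not_lt.1 hn)
    simp at this; omega
  have hbd : ∀ {p k l}, IsPair p k l → p ≤ y → k ≤ N ∧ l ≤ N := by
    intro p k l h hp
    have := (pair_le h).1 hp
    exact ⟨hN _ this.1, hN _ this.2.1⟩
  have hord : ∀ {i j k l k' l'}, IsPair (a i) k l → IsPair (a j) k' l' → i < j → 
      min k l < min k' l' ∨ (min k l = min k' l' ∧ max k' l' ≤ max k l) := by
    intro i j k l k' l' h h' hij
    have h1 := hbd h (hley i)
    have h2 := hbd h' (hley j)
    exact (pkey_le h h' h1.1 h1.2 h2.1 h2.2).1 (hmono hij.le)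
  have hord' : ∀ {i j k l k' l'}, IsPair (a i) k l → IsPair (a j) k' l' →
      min k l < min k' l' ∨ (min k l = min k' l' ∧ max k' l' < max k l) → i < j := by
    intro i j k l k' l' h h' hij
    have h1 := hbd h (hley i)
    have h2 := hbd h' (hley j)
    apply hlt
    by_contra hn
    have := (pkey_le h' h h2.1 h2.2 h1.1 h1.2).1 (not_lt.1 hn)
    omega
  have hatom : ∀ {p k l}, IsPair p k l → p ≤ y → ∃ i, a i = p := fun h hp =>
    (hmem _).2 ⟨bot_cov.2 ⟨_, _, h⟩, hp⟩
  refine ⟨t, a, hmem, hinj, fun hnc => ⟨fun j => ?_, ?_⟩⟩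
  · have hcov := ((hmem _).1 ⟨j, rfl⟩).1
    have hne : a j < y := lt_of_le_of_ne (hley j) (fun h => hnc (h ▸ hcov))
    refine claim y.rk (a j) y (fun b => ∃ i, i < j ∧ a i ⋖ b) (S_nonempty_of_ne hcov.lt) hne
        (by omega) ?_
    rintro p q ⟨e, s, hL, hR⟩ hp ⟨i, hij, hi⟩
    obtain ⟨g, h, hgh⟩ : ∃ g h, IsPair (a j) g h ∧ s = g := by
      obtain ⟨g, h, hgh⟩ := hpair j
      have := hL.2.1
      rw [hgh.2.2] at this
      simp at this
      rcases this with rfl | rfl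
      · exact ⟨_, _, hgh, rfl⟩
      · exact ⟨_, _, hgh.symm, rfl⟩
    obtain ⟨hgh, rfl⟩ := hgh
    have hne := hgh.1
    have heS := hL.1
    rw [hgh.2.1] at heS
    simp at heS
    have hcyc : ¬ inI s h e := by
      intro h'
      exact hne (hL.2.2.1.2 h (by rw [hgh.2.1]; simp) h').symm
    obtain ⟨k, l, hkl⟩ := hpair i
    have hle := (pair_le hkl).1 hi.le
    have hqS := hR.2.2.1
    rw [hgh.2.1] at hqS
    have hqC := hR.2.2.2
    rw [hgh.2.2] at hqC
    rw [hqS] at hle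
    simp only [cut, hqC] at hle
    simp at hle
    obtain ⟨hk, hl, hc1, hc2⟩ := hle
    have hkl1 := hkl.1
    have hij' : ¬ ((k = s ∧ l = h) ∨ (k = h ∧ l = s)) := by
      intro h'
      apply hij.ne
      apply hinj
      rcases h' with ⟨rfl, rfl⟩ | ⟨rfl, rfl⟩
      · exact OMc.ext (hkl.2.1.trans hgh.2.1.symm) (hkl.2.2.trans hgh.2.2.symm)
      · exact OMc.ext (hkl.2.1.trans hgh.symm.2.1.symm) (hkl.2.2.trans hgh.symm.2.2.symm)
    have hse : (k = s ∧ l = e) ∨ (k = e ∧ l = s) := by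
      unfold inI at *; omega
    have hiP : IsPair (a i) s e := by
      rcases hse with ⟨rfl, rfl⟩ | ⟨rfl, rfl⟩
      exacts [hkl, hkl.symm]
    have ho := hord hiP hgh hij
    obtain ⟨w, hw⟩ := exists_pair (i := e) (j := h) (fun h => heS.2 h)
    have hwR : IsR w s p := by
      refine ⟨by rw [hw.2.1]; simp; grind, ⟨e, by rw [hw.2.1]; simp⟩, ?_, ?_⟩
      · rw [hL.2.2.2.1, hgh.2.1, hw.2.1]; ext k; simp; grind
      · rw [hL.2.2.2.2, hgh.2.2, hw.2.2]; ext k; simp; grind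
    obtain ⟨m, hm⟩ := hatom hw (hwR.cov.le.trans hp)
    refine ⟨m, hord' (hm ▸ hw) hgh ?_, hm ▸ hwR.cov⟩
    unfold inI at *; omega
  · intro i j hij u hu hi hj
    obtain ⟨e, f, hef, hp⟩ : ∃ e f, e < f ∧ IsPair (a i) e f := by
      obtain ⟨e, f, h⟩ := hpair i
      rcases lt_or_gt_of_ne h.1 with h1 | h1
      exacts [⟨_, _, h1, h⟩, ⟨_, _, h1, h.symm⟩]
    obtain ⟨g, h, hgh, hq⟩ : ∃ e f, e < f ∧ IsPair (a j) e f := by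
      obtain ⟨e, f, h⟩ := hpair j
      rcases lt_or_gt_of_ne h.1 with h1 | h1
      exacts [⟨_, _, h1, h⟩, ⟨_, _, h1, h.symm⟩]
    have ho := hord hp hq hij
    rcases Nat.lt_or_ge e g with heg | heg
    · obtain ⟨p1, p2, p3, p4⟩ := (pair_le hp).1 hi.le
      obtain ⟨q1, q2, q3, q4⟩ := (pair_le hq).1 hj.le
      obtain ⟨c, hc, hci⟩ := id q4
      by_cases hce : inI e c g
      · obtain ⟨w, hw⟩ := exists_pair (i := g) (j := e) (by omega)
        have hwu : w ≤ u := (pair_le hw).2 ⟨q1, p1, cut_mono q3 (by intro k; unfold inI; omega),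
          ⟨c, hc, hce⟩⟩
        obtain ⟨m, hm⟩ := hatom hw (hwu.trans hu)
        obtain ⟨z, hz, h1, h2⟩ := share' hw hq (by omega) hwu hj.le
        exact ⟨m, hord' (hm ▸ hw) hq (by omega), z, hz, hm ▸ h1, h2⟩
      · obtain ⟨w, hw⟩ := exists_pair (i := h) (j := e) (by omega)
        have hwu : w ≤ u := (pair_le hw).2 ⟨q2, p1, ⟨c, hc, by unfold inI at *; omega⟩, 
          cut_mono q3 (by intro k; unfold inI; omega)⟩
        obtain ⟨m, hm⟩ := hatom hw (hwu.trans hu)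
        obtain ⟨z, hz, h1, h2⟩ := share' hw hq.symm (by omega) hwu hj.le
        exact ⟨m, hord' (hm ▸ hw) hq (by omega), z, hz, hm ▸ h1, h2⟩
    · have heg' : e = g := by omega
      subst heg'
      have hfh : f ≠ h := by
        rintro rfl
        exact hij.ne (hinj (OMc.ext (hp.2.1.trans hq.2.1.symm) (hp.2.2.trans hq.2.2.symm)))
      obtain ⟨z, hz, h1, h2⟩ := share' hp hq hfh hi.le hj.le
      exact ⟨i, hij, z, hz, h1, h2⟩

def GPp (A B C : SignType) : Prop :=
    (A = 0 ∧ B = 0 ∧ C = 0) ∨ ((A = 1 ∨ -B = 1 ∨ C = 1) ∧ (A = -1 ∨ -B = -1 ∨ C = -1))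

instance (A B C : SignType) : Decidable (GPp A B C) := by unfold GPp; infer_instance

theorem GPp_scale : ∀ e A B C : SignType, e ≠ 0 → (GPp (e * A) (e * B) (e * C) ↔ GPp A B C) := by
  decide

theorem sort4 {α : Type*} [LinearOrder α] (P : α → α → α → α → Prop)
    (h1 : ∀ a b c d, P a b c d → P b a c d) (h2 : ∀ a b c d, P a b c d → P a c b d)
    (h3 : ∀ a b c d, P a b c d → P a b d c)
    (hs : ∀ a b c d, a ≤ b → b ≤ c → c ≤ d → P a b c d) : ∀ a b c d, P a b c d := by
  have s2 : ∀ a b c d, b ≤ c → c ≤ d → P a b c d := by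
    intro a b c d hbc hcd
    rcases le_total a b with h | h
    · exact hs _ _ _ _ h hbc hcd
    apply h1
    rcases le_total a c with h' | h'
    · exact hs _ _ _ _ h h' hcd
    apply h2
    rcases le_total a d with h'' | h''
    · exact hs _ _ _ _ hbc h' h''
    apply h3
    exact hs _ _ _ _ hbc hcd h''
  have s3 : ∀ a b c d, c ≤ d → P a b c d := by
    intro a b c d hcd
    rcases le_total b c with h | h
    · exact s2 _ _ _ _ h hcd
    apply h2
    rcases le_total b d with h' | h'
    · exact s2 _ _ _ _ h h'
    apply h3
    exact s2 _ _ _ _ hcd h'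
  intro a b c d
  rcases le_total c d with h | h
  · exact s3 _ _ _ _ h
  · exact h3 _ _ _ _ (s3 _ _ _ _ h)

/-- The exact crossing form of the support of a totally ordered chirotope. -/
def Quad {α : Type*} [LinearOrder α] (G : α → α → Prop) : Prop :=
  ∀ a b c d, a < b → b < c → c < d → ((G a c ∧ G b d) ↔ (G a b ∧ G c d) ∨ (G a d ∧ G b c))

theorem sg1 : ∀ xa xb xc ab ac bc : SignType,
    GPp (xa * bc) (xb * ac) (xc * ab) → GPp (xb * ac) (xa * bc) (xc * -ab) := by decide
theorem sg2 : ∀ xa xb xc ab ac bc : SignType,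
    GPp (xa * bc) (xb * ac) (xc * ab) → GPp (xa * -bc) (xc * ab) (xb * ac) := by decide
theorem sg3 : ∀ ax bx cx ab ac bc : SignType,
    GPp (ax * bc) (bx * ac) (cx * ab) → GPp (-ax * bc) (-ab * -cx) (-ac * -bx) := by decide
theorem sg4 : ∀ ab cd ac bd ad bc : SignType, ab ≠ -1 → cd ≠ -1 → ac ≠ -1 → bd ≠ -1 → ad ≠ -1 →
    bc ≠ -1 → (((ac ≠ 0 ∧ bd ≠ 0) ↔ (ab ≠ 0 ∧ cd ≠ 0) ∨ (ad ≠ 0 ∧ bc ≠ 0)) ↔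
    GPp (-ab * cd) (-ac * bd) (-ad * bc)) := by decide
theorem norm_gp {n : ℕ} (h : Fin n → Fin n → SignType) (alt : ∀ i j, h i j = - h j i)
    (hn : ∀ i j, i < j → h i j ≠ -1) (hq : Quad (fun i j => h i j ≠ 0)) :
    ∀ x y0 y1 y2, GPp (h y0 x * h y1 y2) (h y1 x * h y0 y2) (h y2 x * h y0 y1) := by
  have h0 : ∀ i, h i i = 0 := by
    intro i; have := alt i i; revert this; generalize h i i = s; revert s; decide
  apply sort4
  · intro a b c d H
    have := sg3 _ _ _ _ _ _ H
    rw [← alt, ← alt, ← alt, ← alt, ← alt] at this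
    exact this
  · intro a b c d H
    have := sg1 _ _ _ _ _ _ H
    rw [← alt] at this
    exact this
  · intro a b c d H
    have := sg2 _ _ _ _ _ _ H
    rw [← alt] at this
    exact this
  · intro a b c d hab hbc hcd
    rw [alt b a, alt c a, alt d a]
    rcases hab.eq_or_lt with rfl | hab
    · rw [h0]
      generalize h a c = x; generalize h a d = y; generalize h c d = z
      revert x y z; decide
    rcases hbc.eq_or_lt with rfl | hbc
    · rw [h0]
      generalize h a b = x; generalize h b d = y; generalize h a d = z
      revert x y z; decide
    rcases hcd.eq_or_lt with rfl | hcd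
    · rw [h0]
      generalize h a b = x; generalize h a c = y; generalize h b c = z
      revert x y z; decide
    exact (sg4 _ _ _ _ _ _ (hn _ _ hab) (hn _ _ hcd) (hn _ _ (hab.trans hbc))
      (hn _ _ (hbc.trans hcd)) (hn _ _ (hab.trans (hbc.trans hcd))) (hn _ _ hbc)).1
      (hq a b c d hab hbc hcd)

theorem norm_quad {n : ℕ} (h : Fin n → Fin n → SignType) (alt : ∀ i j, h i j = - h j i)
    (hn : ∀ i j, i < j → h i j ≠ -1)
    (hg : ∀ x y0 y1 y2, GPp (h y0 x * h y1 y2) (h y1 x * h y0 y2) (h y2 x * h y0 y1)) :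
    Quad (fun i j => h i j ≠ 0) := by
  intro a b c d hab hbc hcd
  have := hg a b c d
  rw [alt b a, alt c a, alt d a] at this
  exact (sg4 _ _ _ _ _ _ (hn _ _ hab) (hn _ _ hcd) (hn _ _ (hab.trans hbc))
      (hn _ _ (hbc.trans hcd)) (hn _ _ (hab.trans (hbc.trans hcd))) (hn _ _ hbc)).2 this

theorem sort_chi {n : ℕ} (M : Chirotope2 n) : ∃ (π : Equiv.Perm (Fin n)) (σ : Fin n → SignType),
    (∀ i, σ i ≠ 0) ∧ ∀ i j, i < j → σ i * σ j * M.χ (π i) (π j) ≠ -1 := by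
  classical
  obtain ⟨o, p, hop⟩ : ∃ o p, M.χ o p = 1 := by
    obtain ⟨o, p, h⟩ := M.nonzero
    by_cases h1 : M.χ o p = 1
    · exact ⟨o, p, h1⟩
    · refine ⟨p, o, ?_⟩
      rw [M.alt p o]
      revert h h1; generalize M.χ o p = s; revert s; decide
  let τ : Fin n → SignType := fun i => if M.χ o i ≠ 0 then M.χ o i else
    if M.χ i p ≠ 0 then M.χ i p else 1
  have hτ : ∀ i, τ i ≠ 0 := by
    intro i; simp only [τ]; split_ifs <;> first | assumption | decide
  have hτ1 : ∀ i, M.χ o i ≠ 0 → τ i = M.χ o i := fun i h => by simp [τ, h]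
  have hτ2 : ∀ i, M.χ o i = 0 → τ i * M.χ i p ≠ -1 := by
    intro i h
    simp only [τ, h]
    generalize M.χ i p = s; revert s; decide
  let f : Fin n → Fin n → SignType := fun i j => τ i * τ j * M.χ i j
  have falt : ∀ i j, f i j = - f j i := by
    intro i j; simp only [f]; rw [M.alt i j]
    generalize M.χ j i = s; generalize τ i = a; generalize τ j = b
    revert s a b; decide
  have hu : ∀ i, τ i * M.χ o i = if M.χ o i = 0 then 0 else 1 := by
    intro i
    by_cases h : M.χ o i = 0
    · simp [h]
    · rw [hτ1 i h]; simp only [h, if_false]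
      revert h; generalize M.χ o i = s; revert s; decide
  have hz : ∀ i j, M.χ o i = 0 → f i j = (τ j * M.χ o j) * (τ i * M.χ i p) := by
    intro i j h
    have := M.gp o p i j
    rw [M.alt p o, hop, M.alt i o, h, M.alt j o, M.alt p i] at this
    simp only [f]
    revert this
    generalize M.χ i j = a; generalize M.χ o j = b; generalize M.χ i p = c
    generalize M.χ p j = d; generalize τ i = e; generalize τ j = g
    intro this
    have h5 : a = b * c := by revert this; revert a b c d; decide
    rw [h5]
    clear this h5
    revert b c e g; decide
  have hg : ∀ i j k, GPp ((τ i * M.χ o i) * f j k) ((τ j * M.χ o j) * f i k)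
      ((τ k * M.χ o k) * f i j) := by
    intro i j k
    have := M.gp o i j k
    rw [M.alt i o, M.alt j o, M.alt k o] at this
    have h2 := (GPp_scale (-(τ i * τ j * τ k)) _ _ _ (by
      have h1 := hτ i
      have h2 := hτ j
      have h3 := hτ k
      revert h1 h2 h3
      generalize τ i = a; generalize τ j = b; generalize τ k = c
      clear this
      revert a b c; decide)).2 this
    convert h2 using 1
    all_goals
      simp only [f]
      simp only [neg_mul, mul_neg, neg_neg]
      ac_rfl
  have htrans : ∀ i j k, f i j = 1 → f j k = 1 → f i k = 1 := by
    intro i j k h1 h2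
    have hnz : ∀ i j, f i j = 1 → M.χ o j ≠ 0 := by
      intro i j h h0
      rw [falt, hz j i h0] at h
      have e1 := hu i
      have e2 := hτ2 j h0
      split_ifs at e1 with hi
      all_goals
        rw [e1] at h
        revert h e2; generalize τ j * M.χ j p = s; revert s; decide
    have hj := hnz _ _ h1
    have hk := hnz _ _ h2
    have ej := hu j
    have ek := hu k
    simp only [hj, hk, if_false] at ej ek
    by_cases hi : M.χ o i = 0
    · rw [hz i j hi, ej] at h1
      rw [hz i k hi, ek, h1]
    · have ei := hu i
      simp only [hi, if_false] at ei
      have := hg i j k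
      rw [ei, ej, ek, h1, h2] at this
      revert this; generalize f i k = s; revert s; decide
  have hirr : ∀ i, f i i ≠ 1 := by
    intro i; have := falt i i; revert this; generalize f i i = s; revert s; decide
  let κ : Fin n → ℕ := fun i => (Finset.univ.filter (fun j => f j i = 1)).card
  have hκ : ∀ i j, f i j = 1 → κ i < κ j := by
    intro i j h
    apply Finset.card_lt_card
    rw [Finset.ssubset_iff_of_subset]
    · exact ⟨i, by simp [h], by simp [hirr]⟩
    · intro k hk
      simp at hk ⊢
      exact htrans _ _ _ hk h
  refine ⟨Tuple.sort κ, τ ∘ Tuple.sort κ, fun i => hτ _, fun i j hij h => ?_⟩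
  have hm := Tuple.monotone_sort κ hij.le
  have h1 : f (Tuple.sort κ j) (Tuple.sort κ i) = 1 := by
    rw [falt]; simp only [f]; simp only [Function.comp] at h; rw [h]; decide
  have := hκ _ _ h1
  simp at hm
  omega

def Gr (c : OMc) (i j : ℕ) : Prop := i ≠ j ∧ i ∈ c.S ∧ j ∈ c.S ∧ cut c i j ∧ cut c j i

theorem Gr.mono {c c' : OMc} (h : c ≤ c') {i j} (hg : Gr c i j) : Gr c' i j := by
  obtain ⟨p, hp⟩ := exists_pair hg.1
  exact ⟨hg.1, (pair_le hp).1 (((pair_le hp).2 hg.2).trans h)⟩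

theorem Gr.symm {c : OMc} {i j} (hg : Gr c i j) : Gr c j i :=
  ⟨hg.1.symm, hg.2.2.1, hg.2.1, hg.2.2.2.2, hg.2.2.2.1⟩

theorem Gr_CC {c : OMc} {i j} (h : i ≠ j) (hi : i ∈ c.C) (hj : j ∈ c.C) : Gr c i j :=
  ⟨h, c.sub _ hi, c.sub _ hj, ⟨i, hi, by unfold inI; omega⟩, ⟨j, hj, by unfold inI; omega⟩⟩

theorem Gr_nbr {c : OMc} {s} (hs : s ∈ c.S) : ∃ t, Gr c s t := by
  obtain ⟨d, hd, hds⟩ := c.two s hs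
  obtain ⟨e, he, hed⟩ := c.two d (c.sub d hd)
  by_cases hes : e = s
  · subst hes; exact ⟨d, Gr_CC hed he hd⟩
  · by_cases h : inI d s e
    · exact ⟨d, hds.symm, hs, c.sub _ hd, ⟨e, he, by unfold inI at *; omega⟩,
        ⟨d, hd, by unfold inI at *; omega⟩⟩
    · exact ⟨e, fun h => hes h.symm, hs, c.sub _ he, ⟨d, hd, by unfold inI at *; omega⟩,
        ⟨e, he, by unfold inI at *; omega⟩⟩

theorem Gr_le {c c' : OMc} : c ≤ c' ↔ ∀ i j, Gr c i j → Gr c' i j := by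
  refine ⟨fun h i j => Gr.mono h, fun h => ⟨fun s hs => ?_, fun k hk s hs => ?_⟩⟩
  · obtain ⟨t, ht⟩ := Gr_nbr hs
    exact (h _ _ ht).2.1
  · obtain ⟨d, hd, hds⟩ := c.two k (c.sub k hk)
    by_cases hg : Gr c k s
    · exact (h _ _ hg).2.2.2.1
    · refine cut_mono (h _ _ (Gr_CC hds.symm hk hd)).2.2.2.1 ?_
      intro l hl
      by_cases hks : k = s
      · unfold inI at *; omega
      · have : ¬ inI s d k := fun h' => hg ⟨hks, c.sub _ hk, hs, ⟨k, hk, by unfold inI; omega⟩,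
          ⟨d, hd, h'⟩⟩
        unfold inI at *; omega

theorem cut_split {c : OMc} {i j k : ℕ} (h : inI i j k) : cut c i k ↔ (i ≠ j ∧ cut c i j) ∨ cut c j k := by
  constructor
  · rintro ⟨d, hd, hi⟩
    by_cases h' : inI j d k
    · exact Or.inr ⟨d, hd, h'⟩
    · left; exact ⟨by rintro rfl; exact h' hi, d, hd, by unfold inI at *; omega⟩
  · rintro (⟨h0, d, hd, hi⟩ | ⟨d, hd, hi⟩) <;> exact ⟨d, hd, by unfold inI at *; omega⟩

theorem Gr_quad (u : OMc) : Quad (Gr u) := by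
  intro a b c d hab hbc hcd
  have h1 : cut u a c ↔ cut u a b ∨ cut u b c := by
    rw [cut_split (j := b) (by unfold inI; omega)]; simp [hab.ne]
  have h2 : cut u b d ↔ cut u b c ∨ cut u c d := by
    rw [cut_split (j := c) (by unfold inI; omega)]; simp [hbc.ne]
  have h3 : cut u c a ↔ cut u c d ∨ cut u d a := by
    rw [cut_split (j := d) (by unfold inI; omega)]; simp [hcd.ne]
  have h4 : cut u d b ↔ cut u d a ∨ cut u a b := by
    rw [cut_split (j := a) (by unfold inI; omega)]; simp [(hab.trans (hbc.trans hcd)).ne']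
  have h5 : cut u a d ↔ cut u a b ∨ cut u b d := by
    rw [cut_split (j := b) (by unfold inI; omega)]; simp [hab.ne]
  have h6 : cut u b a ↔ cut u b c ∨ cut u c a := by
    rw [cut_split (j := c) (by unfold inI; omega)]; simp [hbc.ne]
  have h7 : cut u c b ↔ cut u c d ∨ cut u d b := by
    rw [cut_split (j := d) (by unfold inI; omega)]; simp [hcd.ne]
  have h8 : cut u d c ↔ cut u d a ∨ cut u a c := by
    rw [cut_split (j := a) (by unfold inI; omega)]; simp [(hab.trans (hbc.trans hcd)).ne']
  have e1 : a ≠ b := by omega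
  have e2 : a ≠ c := by omega
  have e3 : a ≠ d := by omega
  have e4 : b ≠ c := by omega
  have e5 : b ≠ d := by omega
  have e6 : c ≠ d := by omega
  simp only [Gr, h1, h3, h5, h6, h7, h8, h2, h4, ne_eq, e1, e2, e3, e4, e5, e6, not_false_eq_true, true_and]
  generalize cut u a b = p; generalize cut u b c = q; generalize cut u c d = r
  generalize cut u d a = s
  clear h1 h2 h3 h4 h5 h6 h7 h8
  by_cases p <;> by_cases q <;> by_cases r <;> by_cases s <;> simp only [*, true_or, or_true,
    or_false, false_or, and_true, true_and, and_false, false_and] <;> tauto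

theorem exchange {G : ℕ → ℕ → Prop} (hsym : ∀ i j, G i j → G j i) (hirr : ∀ i, ¬ G i i)
    (hq : Quad G) {a b x y : ℕ} (hax : G a x) (hby : G b y) (hab : ¬ G a b) : G a y ∧ G b x := by
  have hs : ∀ i j, G i j ↔ G j i := fun i j => ⟨hsym i j, hsym j i⟩
  have key : ∀ a b c d, (G a b ∧ G c d → (G a c ∧ G b d) ∨ (G a d ∧ G b c)) ∧
      (G a c ∧ G b d → (G a b ∧ G c d) ∨ (G a d ∧ G b c)) ∧
      (G a d ∧ G b c → (G a b ∧ G c d) ∨ (G a c ∧ G b d)) := by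
    apply sort4
    · intro a b c d h
      rw [hs b a]; grind
    · intro a b c d h
      rw [hs c b]; grind
    · intro a b c d h
      rw [hs d c]; grind
    · intro a b c d h1 h2 h3
      rcases h1.eq_or_lt with rfl | h1
      · have := hirr a; grind
      rcases h2.eq_or_lt with rfl | h2
      · have := hirr b; grind
      rcases h3.eq_or_lt with rfl | h3
      · have := hirr c; grind
      have := hq a b c d h1 h2 h3
      grind
  have := (key a b x y).2.1 ⟨hax, hby⟩
  exact (this.resolve_left (fun h => hab h.1))

theorem structure_thm {n : ℕ} {G : ℕ → ℕ → Prop} (hsym : ∀ i j, G i j → G j i)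
    (hirr : ∀ i, ¬ G i i) (hb : ∀ i j, G i j → i < n) (hq : Quad G) :
    ∃ c : OMc, (∀ i ∈ c.S, i < n) ∧ ∀ i j, G i j ↔ Gr c i j := by
  classical
  obtain ⟨S, hS⟩ : ∃ S : Finset ℕ, ∀ i, i ∈ S ↔ ∃ j, G i j :=
    ⟨(Finset.range n).filter (fun i => ∃ j, G i j), fun i => by
      simp only [Finset.mem_filter, Finset.mem_range]
      exact ⟨fun h => h.2, fun h => ⟨hb _ _ h.choose_spec, h⟩⟩⟩
  obtain ⟨C, hC⟩ : ∃ C : Finset ℕ, ∀ i, i ∈ C ↔ ∃ j, G i j ∧ ∀ t ∈ S, inI i t j → t = i :=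
    ⟨S.filter (fun i => ∃ j, G i j ∧ ∀ t ∈ S, inI i t j → t = i), fun i => by
      simp only [Finset.mem_filter, hS]
      exact ⟨fun h => h.2, fun h => ⟨h.imp fun _ h => h.1, h⟩⟩⟩
  have hex : ∀ {a b x y : ℕ}, G a x → G b y → ¬ G a b → G a y ∧ G b x :=
    fun h1 h2 h3 => exchange hsym hirr hq h1 h2 h3
  have claim1 : ∀ (N : ℕ) (i j : ℕ), (S.filter (fun t => inI i t j)).card ≤ N → G i j →
      ∃ c ∈ C, inI i c j := by
    intro N
    induction N with
    | zero =>
      intro i j h hg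
      exfalso
      have : i ∈ S.filter (fun t => inI i t j) := by
        rw [Finset.mem_filter]; exact ⟨(hS i).2 ⟨j, hg⟩, by unfold inI; omega⟩
      have := Finset.card_pos.2 ⟨i, this⟩
      omega
    | succ N ih =>
      intro i j h hg
      have hij : i ≠ j := fun h => hirr _ (h ▸ hg)
      have hiS : i ∈ S := (hS i).2 ⟨j, hg⟩
      obtain ⟨k, hkS, hk⟩ := exists_prev (S.erase j) ⟨i, by simp [hij, hiS]⟩ j (by simp)
      rw [Finset.mem_erase] at hkS
      have hik : inI k i j → i = k := hk i (by simp [hij, hiS])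
      have hkj : inI i k j := by
        have := hkS.1
        by_cases h : inI k i j
        · rw [hik h]; unfold inI; omega
        · unfold inI at *; omega
      by_cases hg' : G k j
      · refine ⟨k, (hC k).2 ⟨j, hg', fun t ht hi => hk t ?_ hi⟩, hkj⟩
        rw [Finset.mem_erase]
        refine ⟨?_, ht⟩
        rintro rfl
        have := hkS.1
        unfold inI at hi; omega
      · have hki : k ≠ i := by rintro rfl; exact hg' hg
        obtain ⟨y, hy⟩ := (hS k).1 hkS.2
        have h3 := (hex (hsym _ _ hg) hy (fun h => hg' (hsym _ _ h))).2
        obtain ⟨c, hc, hci⟩ := ih i k (by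
          have : (S.filter (fun t => inI i t k)).card < (S.filter (fun t => inI i t j)).card := by
            apply Finset.card_lt_card
            rw [Finset.ssubset_iff_of_subset]
            · refine ⟨k, by simp [hkS.2, hkj], ?_⟩
              simp only [Finset.mem_filter, not_and]
              intro _; unfold inI; omega
            · intro t ht
              simp only [Finset.mem_filter] at ht ⊢
              refine ⟨ht.1, ?_⟩
              have := ht.2
              unfold inI at *; omega
          omega) (hsym _ _ h3)
        exact ⟨c, hc, by unfold inI at *; omega⟩
  have claim1' : ∀ i j, G i j → ∃ c ∈ C, inI i c j := fun i j h => claim1 _ i j le_rfl h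
  let c : OMc := ⟨S, C, fun c hc => by
    obtain ⟨j, hj, _⟩ := (hC c).1 hc
    exact (hS c).2 ⟨j, hj⟩, fun s hs => by
    obtain ⟨j, hj⟩ := (hS s).1 hs
    obtain ⟨c, hc, hci⟩ := claim1' _ _ hj
    obtain ⟨d, hd, hdi⟩ := claim1' _ _ (hsym _ _ hj)
    have : s ≠ j := fun h => hirr _ (h ▸ hj)
    by_cases hcs : c = s
    · exact ⟨d, hd, by unfold inI at *; omega⟩
    · exact ⟨c, hc, hcs⟩⟩
  -- a cut in `[i, j)` yields an element separating two nonadjacent elements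
  have sep : ∀ i j, i ∈ S → j ∈ S → i ≠ j → ¬ G i j → cut c i j →
      ∃ m, G i m ∧ G j m ∧ inI i m j := by
    rintro i j hi hj hij hn ⟨k, hk, hki⟩
    obtain ⟨l, hkl, hl⟩ := (hC k).1 hk
    obtain ⟨yi, hyi⟩ := (hS i).1 hi
    obtain ⟨yj, hyj⟩ := (hS j).1 hj
    have hn' : ¬ G j i := fun h => hn (hsym _ _ h)
    by_cases hGk : G i k
    · exact ⟨k, hGk, (hex hGk hyj hn).2, hki⟩
    · have hil : G i l := (hex hyi hkl hGk).1
      have hjl := (hex hil hyj hn).2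
      refine ⟨l, hil, hjl, ?_⟩
      have hlj : l ≠ j := fun h => hirr _ (h ▸ hjl)
      have hli : l ≠ i := fun h => hirr _ (h ▸ hil)
      have hkl' : k ≠ l := fun h => hirr _ (h ▸ hkl)
      have := hl j hj
      have := hl i hi
      have hjk : k ≠ j := by unfold inI at hki; omega
      unfold inI at *; omega
  refine ⟨c, fun i hi => ?_, fun i j => ⟨fun h => ?_, fun h => ?_⟩⟩
  · obtain ⟨j, hj⟩ := (hS i).1 hi
    exact hb _ _ hj
  · exact ⟨fun h' => hirr _ (h' ▸ h), (hS i).2 ⟨j, h⟩, (hS j).2 ⟨i, hsym _ _ h⟩, claim1' _ _ h,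
      claim1' _ _ (hsym _ _ h)⟩
  · have main : ∀ i j, i < j → Gr c i j → G i j := by
      intro i j hlt ⟨hij, hi, hj, h1, h2⟩
      by_contra hn
      obtain ⟨m, hm1, hm2, hm⟩ := sep i j hi hj hij hn h1
      obtain ⟨m', hm1', hm2', hm'⟩ := sep j i hj hi hij.symm (fun h => hn (hsym _ _ h)) h2
      have e1 : m ≠ i := fun h => hirr _ (h ▸ hm1)
      have e2 : m' ≠ j := fun h => hirr _ (h ▸ hm1')
      have e3 : m' ≠ i := fun h => hirr _ (h ▸ hm2')
      have hmi : i < m ∧ m < j := by unfold inI at hm; omega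
      rcases lt_or_gt_of_ne e2 with h | h
      · have := hq m' i m j (by unfold inI at hm'; omega) hmi.1 hmi.2
        exact hn (this.2 (Or.inr ⟨hsym _ _ hm1', hm1⟩)).2
      · have := hq i m j m' hmi.1 hmi.2 h
        exact hn (this.2 (Or.inl ⟨hm1, hm1'⟩)).1
    rcases lt_or_gt_of_ne h.1 with h' | h'
    · exact main i j h' h
    · exact hsym _ _ (main j i h' h.symm)

theorem rao_transfer {Q : Type*} [PartialOrder Q] (g : Q → OMc) (hle : ∀ a b, g a ≤ g b ↔ a ≤ b)
    (hlow : ∀ a z, z ≤ g a → ∃ b, g b = z) (N : ℕ) : ∀ (x y : Q) (t : ℕ) (a : Fin t → Q),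
    RAOFuel N (g x) (g y) t (g ∘ a) → RAOFuel N x y t a := by
  have hinj : Function.Injective g := fun a b h =>
    le_antisymm ((hle a b).1 h.le) ((hle b a).1 h.ge)
  have hlt : ∀ a b, g a < g b ↔ a < b := by
    intro a b; rw [lt_iff_le_not_ge, lt_iff_le_not_ge, hle, hle]
  have hcov : ∀ a b, g a ⋖ g b ↔ a ⋖ b := by
    intro a b
    constructor
    · intro h
      exact ⟨(hlt _ _).1 h.1, fun c h1 h2 => h.2 ((hlt _ _).2 h1) ((hlt _ _).2 h2)⟩
    · intro h
      refine ⟨(hlt _ _).2 h.1, fun c h1 h2 => ?_⟩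
      obtain ⟨d, rfl⟩ := hlow b c h2.le
      exact h.2 ((hlt _ _).1 h1) ((hlt _ _).1 h2)
  induction N with
  | zero => intro x y t a h; exact h
  | succ N ih =>
    rintro x y t a ⟨h1, h2, h3⟩
    have hm : ∀ p : Q, (∃ i, a i = p) ↔ (x ⋖ p ∧ p ≤ y) := by
      intro p
      have := h1 (g p)
      rw [hcov, hle] at this
      rw [← this]
      exact ⟨fun ⟨i, hi⟩ => ⟨i, by simp [hi]⟩, fun ⟨i, hi⟩ => ⟨i, hinj hi⟩⟩
    refine ⟨hm, Function.Injective.of_comp h2, fun hn => ?_⟩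
    obtain ⟨h4, h5⟩ := h3 (fun h => hn ((hcov _ _).1 h))
    refine ⟨fun j => ?_, ?_⟩
    · obtain ⟨s, b, hb, m, hmm⟩ := h4 j
      have hby : ∀ q, ∃ b', g b' = b q := by
        intro q
        cases N with
        | zero => exact hb.elim
        | succ N =>
          have := (hb.1 (b q)).1 ⟨q, rfl⟩
          exact hlow y _ this.2
      choose b' hb' using hby
      have hbb : b = g ∘ b' := funext fun q => (hb' q).symm
      subst hbb
      refine ⟨s, b', ih _ _ _ _ hb, m, fun q => ?_⟩
      rw [← hmm q]
      simp only [Function.comp, hcov]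
    · intro i j hij u hu hi hj
      obtain ⟨k, hk, z, hz, hz1, hz2⟩ := h5 i j hij (g u) ((hle _ _).2 hu) ((hlt _ _).2 hi)
        ((hlt _ _).2 hj)
      obtain ⟨z', rfl⟩ := hlow u z hz
      exact ⟨k, hk, z', (hle _ _).1 hz, (hcov _ _).1 hz1, (hcov _ _).1 hz2⟩

theorem rao_final {Q : Type*} [PartialOrder Q] (g : Q → OMc) (hle : ∀ a b, g a ≤ g b ↔ a ≤ b)
    (hlow : ∀ a z, z ≤ g a → ∃ b, g b = z) (x y : Q) (hx : ∀ q, x ≤ q) :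
    ∃ (t : ℕ) (a : Fin t → Q), IsRAO x y t a := by
  have hb : g x = botO := by
    obtain ⟨b, hb⟩ := hlow x botO (botO_le _)
    refine le_antisymm ?_ (botO_le _)
    rw [← hb, hle]; exact hx b
  obtain ⟨t, a, ha⟩ := bottom_rao (g y)
  have hay : ∀ q, ∃ b, g b = a q := fun q => hlow y _ ((ha.1 (a q)).1 ⟨q, rfl⟩).2
  choose b hb' using hay
  have hbb : a = g ∘ b := funext fun q => (hb' q).symm
  subst hbb
  exact ⟨t, b, _, rao_transfer g hle hlow _ x y t b (hb ▸ ha)⟩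

/-- Support of an element of the extended MacPhersonian. -/
def supp {n : ℕ} (x : WithBot (MacP n)) (i j : Fin n) : Prop :=
  ∃ N : Chirotope2 n, x = (toMacP N : WithBot (MacP n)) ∧ N.χ i j ≠ 0

theorem toMacP_le {n : ℕ} (N N' : Chirotope2 n) :
    (toMacP N : WithBot (MacP n)) ≤ (toMacP N' : WithBot (MacP n)) ↔ omLe N N' := by
  rw [WithBot.coe_le_coe]; exact Iff.rfl

theorem omLe_supp {n : ℕ} {N N' : Chirotope2 n} (h : omLe N N') {i j} (hN : N.χ i j ≠ 0) :
    N'.χ i j ≠ 0 := by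
  obtain ⟨e, he, h⟩ := h
  rcases h i j with h | h
  · exact (hN h).elim
  · intro h'; rw [h', mul_zero] at h; exact hN h

theorem supp_coe {n : ℕ} (N : Chirotope2 n) (i j : Fin n) :
    supp (toMacP N : WithBot (MacP n)) i j ↔ N.χ i j ≠ 0 := by
  constructor
  · rintro ⟨N', h, h'⟩
    exact omLe_supp ((toMacP_le _ _).1 h.ge) h'
  · intro h; exact ⟨N, rfl, h⟩

theorem supp_bot {n : ℕ} (i j : Fin n) : ¬ supp (⊥ : WithBot (MacP n)) i j := by
  rintro ⟨N, h, -⟩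
  exact WithBot.bot_ne_coe h

theorem cases_Q {n : ℕ} (x : WithBot (MacP n)) : x = ⊥ ∨ ∃ N : Chirotope2 n, x = (toMacP N : WithBot (MacP n)) := by
  induction x using WithBot.recBotCoe with
  | bot => exact Or.inl rfl
  | coe a =>
    right
    obtain ⟨N, rfl⟩ := Quotient.exists_rep a
    exact ⟨N, rfl⟩

theorem le_iff_supp {n : ℕ} {M : Chirotope2 n} {x x' : WithBot (MacP n)}
    (hx : x ≤ (toMacP M : WithBot (MacP n))) (hx' : x' ≤ (toMacP M : WithBot (MacP n))) :
    x ≤ x' ↔ ∀ i j, supp x i j → supp x' i j := by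
  rcases cases_Q x with rfl | ⟨N, rfl⟩
  · simp [supp_bot]
  rcases cases_Q x' with rfl | ⟨N', rfl⟩
  · obtain ⟨i, j, hij⟩ := N.nonzero
    constructor
    · intro h; simp at h
    · intro h; exact (supp_bot _ _ (h i j ((supp_coe _ _ _).2 hij))).elim
  simp only [supp_coe]
  rw [toMacP_le] at *
  refine ⟨fun h i j => omLe_supp h, fun h => ?_⟩
  obtain ⟨e, he, h1⟩ := hx
  obtain ⟨e', he', h1'⟩ := hx'
  refine ⟨e * e', ?_, fun i j => ?_⟩
  · rcases he with rfl | rfl <;> rcases he' with rfl | rfl <;> decide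
  · have a1 := h1 i j
    have a2 := h1' i j
    have a3 := h i j
    revert a1 a2 a3 he he'
    generalize N.χ i j = p; generalize N'.χ i j = q; generalize M.χ i j = r
    clear h1 h1'
    revert p q r e e'; decide

/-- An oriented matroid and a combinatorial model with the same support. -/
def MRel {n : ℕ} (π : Equiv.Perm (Fin n)) (x : WithBot (MacP n)) (c : OMc) : Prop :=
  (∀ i ∈ c.S, i < n) ∧ ∀ i j : Fin n, supp x (π i) (π j) ↔ Gr c i j

theorem MRel.le {n : ℕ} {π : Equiv.Perm (Fin n)} {M : Chirotope2 n} {x x' : WithBot (MacP n)}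
    {c c' : OMc} (hx : x ≤ (toMacP M : WithBot (MacP n))) (hx' : x' ≤ (toMacP M : WithBot (MacP n)))
    (h : MRel π x c) (h' : MRel π x' c') : c ≤ c' ↔ x ≤ x' := by
  rw [Gr_le, le_iff_supp hx hx']
  constructor
  · intro H i j hij
    have := (h.2 (π.symm i) (π.symm j)).1 (by simpa using hij)
    have := (h'.2 (π.symm i) (π.symm j)).2 (H _ _ this)
    simpa using this
  · intro H i j hij
    have := (h.2 ⟨i, h.1 _ hij.2.1⟩ ⟨j, h.1 _ hij.2.2.1⟩).2 hij
    exact (h'.2 ⟨i, h.1 _ hij.2.1⟩ ⟨j, h.1 _ hij.2.2.1⟩).1 (H _ _ this)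

theorem MRel.exists_left {n : ℕ} {π : Equiv.Perm (Fin n)} {σ : Fin n → SignType} {M : Chirotope2 n}
    (hσ : ∀ i, σ i ≠ 0) (hM : ∀ i j, i < j → σ i * σ j * M.χ (π i) (π j) ≠ -1)
    {x : WithBot (MacP n)} (hx : x ≤ (toMacP M : WithBot (MacP n))) : ∃ c, MRel π x c := by
  rcases cases_Q x with rfl | ⟨N, rfl⟩
  · refine ⟨botO, by simp [botO], fun i j => ?_⟩
    simp [supp_bot, Gr, botO]
  rw [toMacP_le] at hx
  obtain ⟨e, he, hN⟩ := hx
  let h : Fin n → Fin n → SignType := fun i j => e * (σ i * σ j) * N.χ (π i) (π j)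
  have halt : ∀ i j, h i j = - h j i := by
    intro i j; simp only [h]; rw [N.alt (π i) (π j), mul_comm (σ i), mul_neg]
  have hne : ∀ i j, h i j ≠ 0 ↔ N.χ (π i) (π j) ≠ 0 := by
    intro i j
    have h1 := hσ i
    have h2 := hσ j
    simp only [h]
    revert h1 h2 he
    generalize N.χ (π i) (π j) = p; generalize σ i = q; generalize σ j = r
    clear hN halt h
    revert p q r e; decide
  have hnorm : ∀ i j, i < j → h i j ≠ -1 := by
    intro i j hij
    have h1 := hM i j hij
    have h2 := hN (π i) (π j)
    simp only [h]
    revert h1 h2 he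
    generalize N.χ (π i) (π j) = p; generalize σ i = q; generalize σ j = r
    generalize M.χ (π i) (π j) = s
    clear hN halt hne h
    revert p q r s e; decide
  have hgp : ∀ x y0 y1 y2, GPp (h y0 x * h y1 y2) (h y1 x * h y0 y2) (h y2 x * h y0 y1) := by
    intro x y0 y1 y2
    have := N.gp (π x) (π y0) (π y1) (π y2)
    have h2 := (GPp_scale (e * e * (σ x * σ y0 * σ y1 * σ y2)) _ _ _ (by
      have he0 : e ≠ 0 := by rcases he with rfl | rfl <;> decide
      simp only [ne_eq, mul_eq_zero, he0, hσ, or_self, not_false_eq_true])).2 this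
    convert h2 using 1
    all_goals
      simp only [h]
      ac_rfl
  have hq := norm_quad h halt hnorm hgp
  let G : ℕ → ℕ → Prop := fun i j => ∃ (hi : i < n) (hj : j < n), N.χ (π ⟨i, hi⟩) (π ⟨j, hj⟩) ≠ 0
  have hGF : ∀ i j : Fin n, G i j ↔ h i j ≠ 0 := by
    intro i j; rw [hne]
    exact ⟨fun ⟨_, _, h⟩ => h, fun h => ⟨i.2, j.2, h⟩⟩
  obtain ⟨c, hc1, hc2⟩ := structure_thm (n := n) (G := G)
    (by
      rintro i j ⟨hi, hj, H⟩
      refine ⟨hj, hi, fun h0 => H ?_⟩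
      rw [N.alt, h0, neg_zero])
    (by
      rintro i ⟨hi, hj, H⟩
      apply H
      have := N.alt (π ⟨i, hi⟩) (π ⟨i, hi⟩)
      revert this; generalize N.χ (π ⟨i, hi⟩) (π ⟨i, hi⟩) = s; revert s; decide)
    (fun i j H => H.1)
    (by
      intro a b c d hab hbc hcd
      by_cases hd : d < n
      · have := hq ⟨a, by omega⟩ ⟨b, by omega⟩ ⟨c, by omega⟩ ⟨d, hd⟩ hab hbc hcd
        simp only [← hGF] at this
        exact this
      · constructor
        · rintro ⟨_, _, h, _⟩; exact (hd h).elim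
        · rintro (⟨_, _, h, _⟩ | ⟨⟨_, h, _⟩, _⟩) <;> exact (hd h).elim)
  refine ⟨c, hc1, fun i j => ?_⟩
  rw [← hc2, supp_coe, hGF, hne]

theorem MRel.exists_right {n : ℕ} {π : Equiv.Perm (Fin n)} {σ : Fin n → SignType} {M : Chirotope2 n}
    (hσ : ∀ i, σ i ≠ 0) (hM : ∀ i j, i < j → σ i * σ j * M.χ (π i) (π j) ≠ -1)
    {c : OMc} (hc : ∀ i ∈ c.S, i < n) (hcM : ∀ i j : Fin n, Gr c i j → M.χ (π i) (π j) ≠ 0) :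
    ∃ x, x ≤ (toMacP M : WithBot (MacP n)) ∧ MRel π x c := by
  classical
  by_cases hS : c.S.Nonempty
  swap
  · refine ⟨⊥, bot_le, hc, fun i j => ?_⟩
    rw [Finset.not_nonempty_iff_eq_empty] at hS
    simp [supp_bot, Gr, hS]
  let f : Fin n → Fin n → SignType := fun k l =>
    if Gr c (π.symm k) (π.symm l) then M.χ k l else 0
  have falt : ∀ i j, f i j = - f j i := by
    intro i j
    simp only [f]
    by_cases h : Gr c (π.symm i) (π.symm j)
    · simp only [h, h.symm, if_true]; exact M.alt i j
    · have : ¬ Gr c (π.symm j) (π.symm i) := fun h' => h h'.symm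
      simp [h, this]
  have fne : ∀ i j, f (π i) (π j) ≠ 0 ↔ Gr c i j := by
    intro i j
    simp only [f, Equiv.symm_apply_apply]
    by_cases h : Gr c i j
    · simp only [h, if_true, iff_true]; exact hcM _ _ h
    · simp [h]
  let h : Fin n → Fin n → SignType := fun i j => (σ i * σ j) * f (π i) (π j)
  have halt : ∀ i j, h i j = - h j i := by
    intro i j; simp only [h]; rw [falt (π i) (π j), mul_comm (σ i), mul_neg]
  have hne : ∀ i j, h i j ≠ 0 ↔ Gr c i j := by
    intro i j
    rw [← fne]
    simp only [h, ne_eq, mul_eq_zero, hσ, or_self, false_or]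
  have hnorm : ∀ i j, i < j → h i j ≠ -1 := by
    intro i j hij
    simp only [h, f]
    split_ifs
    · exact hM i j hij
    · rw [mul_zero]; decide
  have hq : Quad (fun i j => h i j ≠ 0) := by
    intro a b d e h1 h2 h3
    simp only [hne]
    exact Gr_quad c a b d e h1 h2 h3
  have hgp := norm_gp h halt hnorm hq
  let N : Chirotope2 n := ⟨f, by
    obtain ⟨s, hs⟩ := hS
    obtain ⟨t, ht⟩ := Gr_nbr hs
    exact ⟨π ⟨s, hc s hs⟩, π ⟨t, hc t ht.2.2.1⟩, (fne _ _).2 ht⟩, falt, by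
    intro x y0 y1 y2
    have := hgp (π.symm x) (π.symm y0) (π.symm y1) (π.symm y2)
    refine (GPp_scale (σ (π.symm x) * σ (π.symm y0) * σ (π.symm y1) * σ (π.symm y2)) _ _ _
      (by simp only [ne_eq, mul_eq_zero, hσ, or_self, not_false_eq_true])).1 ?_
    convert this using 1
    all_goals
      simp only [h, Equiv.apply_symm_apply]
      ac_rfl⟩
  refine ⟨(toMacP N : WithBot (MacP n)), (toMacP_le _ _).2 ⟨1, Or.inl rfl, fun i j => ?_⟩, hc,
    fun i j => ?_⟩
  · change f i j = 0 ∨ f i j = _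
    rw [one_mul]
    simp only [f]
    split_ifs
    · exact Or.inr rfl
    · exact Or.inl rfl
  · rw [supp_coe]; exact fne i j

/-- For any rank-2 oriented matroid `M`, the interval `MacP(2,n)_{≤M} ∪ {0̂}` (formalized as
the subposet of `WithBot (MacP n)` of elements `≤ M`, with `0̂ = ⊥`) admits a recursive atom
ordering. -/
theorem macp_below_admits_RAO (n : ℕ) (M : Chirotope2 n) :
    ∃ (t : ℕ) (a : Fin t → {x : WithBot (MacP n) // x ≤ (toMacP M : WithBot (MacP n))}),
      IsRAO (⟨⊥, bot_le⟩ : {x : WithBot (MacP n) // x ≤ (toMacP M : WithBot (MacP n))})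
            ⟨(toMacP M : WithBot (MacP n)), le_rfl⟩ t a := by
  obtain ⟨π, σ, hσ, hM⟩ := sort_chi M
  have hex : ∀ x : {x : WithBot (MacP n) // x ≤ (toMacP M : WithBot (MacP n))}, ∃ c, MRel π x.1 c :=
    fun x => MRel.exists_left hσ hM x.2
  choose g hg using hex
  have hle : ∀ a b, g a ≤ g b ↔ a ≤ b := fun a b => MRel.le a.2 b.2 (hg a) (hg b)
  refine rao_final g hle ?_ _ _ (fun q => bot_le (a := q.1))
  intro a z hz
  have hzn : ∀ i ∈ z.S, i < n := fun i hi => (hg a).1 i (hz.1 i hi)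
  obtain ⟨x, hx, hr⟩ := MRel.exists_right (π := π) hσ hM hzn (by
    intro i j hij
    have h1 := ((hg a).2 i j).2 (hij.mono hz)
    have h2 := (le_iff_supp a.2 le_rfl).1 a.2 _ _ h1
    exact (supp_coe _ _ _).1 h2)
  refine ⟨⟨x, hx⟩, ?_⟩
  have h3 := hg ⟨x, hx⟩
  exact le_antisymm ((MRel.le hx hx h3 hr).2 le_rfl) ((MRel.le hx hx hr h3).2 le_rfl)
end
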